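/- Addition theorem for tameness of multiarrangements II: Let (A,m) be a multiarrangement on an essential arrangement A in K^ℓ and H ∈ A. Assume that the Euler restriction (A^H, m^*) is tame and that (A, m−δ_H) is locally free along H. Then (A,m) is tame whenever (A, m−δ_H) is tame. -/

import Mathlib

noncomputable section
open Classical MvPolynomial

/-- `pdLE R n M` : the `R`-module `M` has projective dimension at most `n`. -/
def pdLE (R : Type) [CommRing R] : ℕ → (M : Type) → [AddCommGroup M] → [Module R M] → Prop
  | 0, M, _, _ => Module.Projective R M
  | n + 1, M, _, _ => ∃ (ι : Type) (f : (ι →₀ R) →ₗ[R] M),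
      Function.Surjective f ∧ pdLE R n (LinearMap.ker f)

/-- Projective dimension as an element of `ℕ∞`. -/
def pdim (R : Type) [CommRing R] (M : Type) [AddCommGroup M] [Module R M] : ℕ∞ :=
  sInf {n : ℕ∞ | ∃ k : ℕ, pdLE R k M ∧ n = (k : ℕ∞)}

/-- The coordinate ring `S = K[x_1, …, x_ℓ]`. -/
abbrev PS (K : Type) [Field K] (ℓ : ℕ) : Type := MvPolynomial (Fin ℓ) K

/-- The free `S`-module of polynomial differential forms of all degrees, realized as the
exterior algebra over `S` on the free module `S^ℓ` (with `dx_i` the standard basis). -/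
abbrev ExtF (K : Type) [Field K] (ℓ : ℕ) : Type :=
  ExteriorAlgebra (PS K ℓ) (Fin ℓ → PS K ℓ)

variable {K : Type} [Field K] {ℓ : ℕ}

/-- The module `Ω^p_V` of polynomial differential `p`-forms. -/
def formsP (K : Type) [Field K] (ℓ : ℕ) (p : ℕ) : Submodule (PS K ℓ) (ExtF K ℓ) :=
  (LinearMap.range (ExteriorAlgebra.ι (PS K ℓ) :
      (Fin ℓ → PS K ℓ) →ₗ[PS K ℓ] ExtF K ℓ)) ^ p

/-- The defining linear form `α = ∑ c_i x_i` of the hyperplane with coefficient vector `c`. -/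
def linP (c : Fin ℓ → K) : PS K ℓ := ∑ i, MvPolynomial.C (c i) * MvPolynomial.X i

/-- The constant one-form `dα = ∑ c_i dx_i`. -/
def dP (c : Fin ℓ → K) : ExtF K ℓ :=
  ExteriorAlgebra.ι (PS K ℓ) (fun i => MvPolynomial.C (c i))

/-- A central hyperplane arrangement in `K^ℓ`: a finite set of (pairwise non-proportional,
nonzero) coefficient vectors of defining linear forms, each representing the hyperplane
`{x : ∑ c_i x_i = 0}`. -/
structure Arrangement (K : Type) [Field K] (ℓ : ℕ) : Type where
  hyps : Finset (Fin ℓ → K)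
  ne_zero : ∀ c ∈ hyps, c ≠ 0
  nonprop : ∀ c ∈ hyps, ∀ c' ∈ hyps, c ≠ c' → ∀ t : K, c ≠ t • c'

/-- The polynomial model of the module `Ω^p(A,m)` of logarithmic `p`-forms of the
multiarrangement `(A,m)`; it is `Q(A,m)·Ω^p(A,m)`, i.e. the image of `Ω^p(A,m)` under the
degree-shifting isomorphism given by multiplication with `Q(A,m)`, so that
`η = Q(A,m)·ω` ranges over polynomial `p`-forms with `dα_H ∧ η ∈ α_H^{m(H)} Ω^{p+1}_V`
for all `H ∈ A`. -/
def Omega (A : Arrangement K ℓ) (m : (Fin ℓ → K) → ℕ) (p : ℕ) :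
    Submodule (PS K ℓ) (ExtF K ℓ) :=
  formsP K ℓ p ⊓ ⨅ c ∈ A.hyps,
    Submodule.comap (LinearMap.mulLeft (PS K ℓ) (dP c))
      (Submodule.map (LinearMap.lsmul (PS K ℓ) (ExtF K ℓ) (linP c ^ m c))
        (formsP K ℓ (p + 1)))

/-- Tameness of a multiarrangement: `pd_S Ω^p(A,m) ≤ p` for all `0 ≤ p ≤ ℓ`. -/
def TameM (A : Arrangement K ℓ) (m : (Fin ℓ → K) → ℕ) : Prop :=
  ∀ p : ℕ, p ≤ ℓ → pdLE (PS K ℓ) p (Omega A m p)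

/-- Tameness of a simple arrangement (constant multiplicity `1`). -/
def Tame (A : Arrangement K ℓ) : Prop := TameM A (fun _ => 1)

/-- Freeness of a multiarrangement: `Ω^1(A,m)` is a free `S`-module. -/
def FreeM (A : Arrangement K ℓ) (m : (Fin ℓ → K) → ℕ) : Prop :=
  Module.Free (PS K ℓ) (Omega A m 1)

/-- An arrangement is essential when the intersection of its hyperplanes is `{0}`,
equivalently the defining forms span the dual space. -/
def Essential (A : Arrangement K ℓ) : Prop :=
  Submodule.span K (A.hyps : Set (Fin ℓ → K)) = ⊤

/-- The localization `A_x = {H ∈ A : x ∈ H}` of an arrangement at a point `x`. -/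
def locArr (A : Arrangement K ℓ) (x : Fin ℓ → K) : Arrangement K ℓ where
  hyps := A.hyps.filter (fun c => ∑ i, c i * x i = 0)
  ne_zero := fun c hc => A.ne_zero c (Finset.mem_filter.mp hc).1
  nonprop := fun c hc c' hc' =>
    A.nonprop c (Finset.mem_filter.mp hc).1 c' (Finset.mem_filter.mp hc').1

/-- `(A,m)` is locally free along the hyperplane `{x : ∑ (c0)_i x_i = 0}` :
`(A_x, m_x)` is free for every nonzero point `x` of this hyperplane. -/
def LocallyFreeAlong (A : Arrangement K ℓ) (m : (Fin ℓ → K) → ℕ) (c0 : Fin ℓ → K) : Prop :=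
  ∀ x : Fin ℓ → K, x ≠ 0 → (∑ i, c0 i * x i = 0) → FreeM (locArr A x) m

/-- The deletion `A ∖ {H}`. -/
def delArr (A : Arrangement K ℓ) (c0 : Fin ℓ → K) : Arrangement K ℓ where
  hyps := A.hyps.erase c0
  ne_zero := fun c hc => A.ne_zero c (Finset.mem_of_mem_erase hc)
  nonprop := fun c hc c' hc' =>
    A.nonprop c (Finset.mem_of_mem_erase hc) c' (Finset.mem_of_mem_erase hc')

/-- The coefficient vector of the restriction of the linear form `c` to the hyperplane `H`
along the linear identification `e : K^{ℓ-1} ≃ H`. -/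
def restrictForm (e : (Fin (ℓ - 1) → K) →ₗ[K] (Fin ℓ → K)) (c : Fin ℓ → K) :
    Fin (ℓ - 1) → K := fun i => ∑ j, c j * e (Pi.single i 1) j

/-- The linear form on `K^ℓ` with coefficient vector `c`. -/
def dotLin (c : Fin ℓ → K) : (Fin ℓ → K) →ₗ[K] K := ∑ i, c i • LinearMap.proj i

/-- `e` identifies `K^{ℓ-1}` with the hyperplane `ker(α_{c0})`. -/
def IsHypEmbedding (c0 : Fin ℓ → K) (e : (Fin (ℓ - 1) → K) →ₗ[K] (Fin ℓ → K)) : Prop :=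
  Function.Injective e ∧ LinearMap.range e = LinearMap.ker (dotLin c0)

/-- `B` (an arrangement in `K^{ℓ-1}`) represents the restriction `A^H` of `A` to the
hyperplane `H` determined by `c0 ∈ A`, via the identification `e : K^{ℓ-1} ≃ H`:
its hyperplanes are exactly the restrictions to `H` of the hyperplanes of `A ∖ {H}`. -/
def IsRestrictionOf (B : Arrangement K (ℓ - 1)) (A : Arrangement K ℓ) (c0 : Fin ℓ → K)
    (e : (Fin (ℓ - 1) → K) →ₗ[K] (Fin ℓ → K)) : Prop :=
  (∀ c ∈ A.hyps, c ≠ c0 → ∃ c' ∈ B.hyps, ∃ t : K, t ≠ 0 ∧ restrictForm e c = t • c') ∧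
  (∀ c' ∈ B.hyps, ∃ c ∈ A.hyps, c ≠ c0 ∧ ∃ t : K, t ≠ 0 ∧ restrictForm e c = t • c')
/-- The Ziegler multiplicity `m^H` on the restriction: `m^H(X) = #{L ∈ A∖{H} : L ∩ H = X}`. -/
def zieglerMult (A : Arrangement K ℓ) (c0 : Fin ℓ → K)
    (e : (Fin (ℓ - 1) → K) →ₗ[K] (Fin ℓ → K)) (c' : Fin (ℓ - 1) → K) : ℕ :=
  (A.hyps.filter (fun c => c ≠ c0 ∧ ∃ t : K, t ≠ 0 ∧ restrictForm e c = t • c')).card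

/-- The wedge `dx_{i_1} ∧ ⋯ ∧ dx_{i_p}` for a list of indices. -/
def wedgeList (l : List (Fin ℓ)) : ExtF K ℓ :=
  (l.map (fun i => ExteriorAlgebra.ι (PS K ℓ) (Pi.single i (1 : PS K ℓ)))).prod

/-- A polynomial `p`-form is homogeneous of (coefficient) degree `d` if it is a sum of
terms `f · dx_{i_1} ∧ ⋯ ∧ dx_{i_p}` with `f` homogeneous of degree `d`. -/
def IsHomogForm (p d : ℕ) (η : ExtF K ℓ) : Prop :=
  η ∈ AddSubgroup.closure {ξ : ExtF K ℓ | ∃ (f : PS K ℓ) (l : List (Fin ℓ)),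
    f.IsHomogeneous d ∧ l.length = p ∧ ξ = f • wedgeList l}

/-- `|m| = ∑_{H ∈ A} m(H)`. -/
def msum (A : Arrangement K ℓ) (m : (Fin ℓ → K) → ℕ) : ℕ := ∑ c ∈ A.hyps, m c

/-- The multiarrangement `(A,m)` is free with exponents `(d_1, …, d_ℓ)`: the polynomial
model of `Ω^1(A,m)` has a homogeneous basis whose `i`-th member has coefficient degree
`|m| - d_i`. -/
def FreeWithExp (A : Arrangement K ℓ) (m : (Fin ℓ → K) → ℕ) (d : Fin ℓ → ℕ) : Prop :=
  ∃ b : Fin ℓ → ExtF K ℓ,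
    (∀ i, b i ∈ Omega A m 1) ∧
    (∀ i, IsHomogForm 1 (msum A m - d i) (b i)) ∧
    LinearIndependent (PS K ℓ) b ∧
    Omega A m 1 ≤ Submodule.span (PS K ℓ) (Set.range b)

/-- The exponent vector `(d_1, d_2, 0, …, 0)`. -/
def expVec (d1 d2 : ℕ) : Fin ℓ → ℕ := fun i =>
  if (i : ℕ) = 0 then d1 else if (i : ℕ) = 1 then d2 else 0

/-- The localization `A_X` of `A` at the lattice element `X = H ∩ L` corresponding,
via the identification `e` of `H` with `K^{ℓ-1}`, to the hyperplane of `H`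
with coefficient vector `c'`. -/
def locOnRestr (A : Arrangement K ℓ) (e : (Fin (ℓ - 1) → K) →ₗ[K] (Fin ℓ → K))
    (c' : Fin (ℓ - 1) → K) : Arrangement K ℓ where
  hyps := A.hyps.filter (fun c => ∃ t : K, restrictForm e c = t • c')
  ne_zero := fun c hc => A.ne_zero c (Finset.mem_filter.mp hc).1
  nonprop := fun c hc c'' hc'' =>
    A.nonprop c (Finset.mem_filter.mp hc).1 c'' (Finset.mem_filter.mp hc'').1

/-- The multiplicity `m - δ_H`. -/
def mdel (m : (Fin ℓ → K) → ℕ) (c0 : Fin ℓ → K) : (Fin ℓ → K) → ℕ :=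
  fun c => if c = c0 then m c - 1 else m c

/-- `ms` is the Euler multiplicity `m^*` on the restriction `B = A^H` (presented via the
identification `e`): for each `X ∈ A^H` the rank-two localization `(A_X, m_X)` is free
with exponents `(d_1^X, d_2^X, 0, …, 0)` ordered so that `(A_X, m_X - δ_H)` is free with
exponents `(d_1^X - 1, d_2^X, 0, …, 0)`, and `m^*(X) = d_2^X`. -/
def IsEulerMult (A : Arrangement K ℓ) (m : (Fin ℓ → K) → ℕ) (c0 : Fin ℓ → K)
    (e : (Fin (ℓ - 1) → K) →ₗ[K] (Fin ℓ → K)) (B : Arrangement K (ℓ - 1))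
    (ms : (Fin (ℓ - 1) → K) → ℕ) : Prop :=
  ∀ c' ∈ B.hyps, ∃ d1 d2 : ℕ,
    FreeWithExp (locOnRestr A e c') m (expVec d1 d2) ∧
    FreeWithExp (locOnRestr A e c') (mdel m c0) (expVec (d1 - 1) d2) ∧
    ms c' = d2

/-- An arrangement is generic if any `k ≤ ℓ-1` of its hyperplanes intersect in
codimension `k`, i.e. any `≤ ℓ-1` of its defining forms are linearly independent. -/
def GenericArr (A : Arrangement K ℓ) : Prop :=
  ∀ s : Finset (Fin ℓ → K), s ⊆ A.hyps → s.card ≤ ℓ - 1 →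
    LinearIndependent K (fun x : {c // c ∈ s} => (x : Fin ℓ → K))

/-- An arrangement is irreducible if it is not a product of two lower-dimensional
arrangements, i.e. its defining forms cannot be split into two complementary proper
subspaces of the dual space. -/
def IrreducibleArr (A : Arrangement K ℓ) : Prop :=
  ¬ ∃ U1 U2 : Submodule K (Fin ℓ → K), U1 ≠ ⊥ ∧ U2 ≠ ⊥ ∧ U1 ⊓ U2 = ⊥ ∧ U1 ⊔ U2 = ⊤ ∧
      ∀ c ∈ A.hyps, c ∈ U1 ∨ c ∈ U2

/-- The defining polynomial `Q(A,m) = ∏_{H ∈ A} α_H^{m(H)}`. -/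
def Qpoly (A : Arrangement K ℓ) (m : (Fin ℓ → K) → ℕ) : PS K ℓ :=
  ∏ c ∈ A.hyps, linP c ^ m c

namespace TameAux

section ProjDim
open CategoryTheory
variable {R : Type} [CommRing R] {M M₁ M₂ M₃ N : Type} [AddCommGroup M] [Module R M]
  [AddCommGroup M₁] [Module R M₁] [AddCommGroup M₂] [Module R M₂] [AddCommGroup M₃] [Module R M₃]
  [AddCommGroup N] [Module R N]

theorem shortExact_of {f : M₁ →ₗ[R] M₂} {g : M₂ →ₗ[R] M₃} (hf : Function.Injective f)
    (hg : Function.Surjective g) (h : Function.Exact f g) :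
    (ShortComplex.mk (ModuleCat.ofHom f) (ModuleCat.ofHom g)
      (by rw [← ModuleCat.ofHom_comp, h.linearMap_comp_eq_zero]; rfl)).ShortExact :=
  ModuleCat.shortComplex_shortExact _ h hf hg

theorem pdLE_iff (n : ℕ) (M : Type) [AddCommGroup M] [Module R M] :
    pdLE R n M ↔ HasProjectiveDimensionLE (ModuleCat.of R M) n := by
  induction n generalizing M with
  | zero =>
    rw [pdLE, ← projective_iff_hasProjectiveDimensionLE_zero]
    exact IsProjective.iff_projective (R := R) (P := M)
  | succ n ih =>
    rw [pdLE]
    constructor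
    · rintro ⟨ι, f, hf, h⟩
      rw [ih] at h
      have hs := LinearMap.shortExact_shortComplexKer hf
      exact (hs.hasProjectiveDimensionLT_X₃_iff n
        ((IsProjective.iff_projective (R := R) (P := ι →₀ R)).1 inferInstance)).2 h
    · intro h
      let f := Finsupp.linearCombination R (id : M → M)
      have hf : Function.Surjective f := Finsupp.linearCombination_id_surjective R M
      refine ⟨M, f, hf, ?_⟩
      rw [ih]
      have hs := LinearMap.shortExact_shortComplexKer hf
      exact (hs.hasProjectiveDimensionLT_X₃_iff n
        ((IsProjective.iff_projective (R := R) (P := M →₀ R)).1 inferInstance)).1 h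

theorem pdLE_mono {m n : ℕ} (hmn : m ≤ n) (h : pdLE R m M) : pdLE R n M := by
  rw [pdLE_iff] at h ⊢
  exact hasProjectiveDimensionLT_of_ge _ (m + 1) _ (by lia)

theorem pdLE_of_projective [Module.Projective R M] (n : ℕ) : pdLE R n M :=
  pdLE_mono (Nat.zero_le n) (show Module.Projective R M from inferInstance)

theorem pdLE_of_equiv (e : M ≃ₗ[R] N) {n : ℕ} (h : pdLE R n M) : pdLE R n N := by
  rw [pdLE_iff] at h ⊢
  exact ModuleCat.hasProjectiveDimensionLE_of_linearEquiv
    (M := ModuleCat.of R M) (N := ModuleCat.of R N) e n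

variable {f : M₁ →ₗ[R] M₂} {g : M₂ →ₗ[R] M₃} {n : ℕ}

theorem pdLE_middle (hf : Function.Injective f) (hg : Function.Surjective g)
    (h : Function.Exact f g) (h₁ : pdLE R n M₁) (h₃ : pdLE R n M₃) :
    pdLE R n M₂ := by
  rw [pdLE_iff] at *
  exact (shortExact_of hf hg h).hasProjectiveDimensionLT_X₂ _ h₁ h₃

theorem pdLE_right (hf : Function.Injective f) (hg : Function.Surjective g)
    (h : Function.Exact f g) (h₁ : pdLE R n M₁) (h₂ : pdLE R (n + 1) M₂) :
    pdLE R (n + 1) M₃ := by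
  rw [pdLE_iff] at *
  exact (shortExact_of hf hg h).hasProjectiveDimensionLT_X₃ _ h₁ h₂

theorem pdLE_left (hf : Function.Injective f) (hg : Function.Surjective g)
    (h : Function.Exact f g) (h₂ : pdLE R n M₂) (h₃ : pdLE R (n + 1) M₃) :
    pdLE R n M₁ := by
  rw [pdLE_iff] at *
  exact (shortExact_of hf hg h).hasProjectiveDimensionLT_X₁ _ h₂ h₃

end ProjDim

section Hilbert
open CategoryTheory Polynomial TensorProduct

attribute [local instance] RingHomInvPair.of_ringEquiv in
theorem pdLE_of_semilinearEquiv {R R' M N : Type} [CommRing R] [CommRing R'] [AddCommGroup M]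
    [Module R M] [AddCommGroup N] [Module R' N] (e : R ≃+* R')
    (e' : M ≃ₛₗ[RingHomClass.toRingHom e] N) {n : ℕ} (h : pdLE R n M) : pdLE R' n N := by
  rw [pdLE_iff] at h ⊢
  exact ModuleCat.hasProjectiveDimensionLE_of_semiLinearEquiv e
    (M := ModuleCat.of R M) (N := ModuleCat.of R' N) e' n

theorem forall_pdLE_of_ringEquiv {R R' : Type} [CommRing R] [CommRing R'] (e : R ≃+* R') {n : ℕ}
    (h : ∀ (M : Type) [AddCommGroup M] [Module R M], pdLE R n M)
    (M : Type) [AddCommGroup M] [Module R' M] : pdLE R' n M := by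
  let : Module R M := Module.compHom M (e : R →+* R')
  let := RingHomInvPair.of_ringEquiv e
  let : RingHomInvPair (e.symm : R' →+* R) (e : R →+* R') := ⟨by ext; simp, by ext; simp⟩
  refine pdLE_of_semilinearEquiv (M := M) e ?_ (h M)
  exact
    { toFun := id
      map_add' := fun _ _ => rfl
      map_smul' := fun _ _ => rfl
      invFun := id
      left_inv := fun _ => rfl
      right_inv := fun _ => rfl }

variable {R : Type} [CommRing R]

theorem pdLE_baseChange (A : Type) [CommRing A] [Algebra R A] [Module.Flat R A] {n : ℕ}
    {N : Type} [AddCommGroup N] [Module R N] (h : pdLE R n N) : pdLE A n (A ⊗[R] N) := by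
  induction n generalizing N with
  | zero =>
    have : Module.Projective R N := h
    exact pdLE_of_projective 0
  | succ n ih =>
    obtain ⟨ι, f, hf, hk⟩ := h
    have h1 : Function.Exact ((LinearMap.ker f).subtype.baseChange A) (f.baseChange A) := by
      exact lTensor_exact (R := R) (M := LinearMap.ker f) (N := ι →₀ R) (P := N) A
        (LinearMap.exact_subtype_ker_map f) hf
    have h2 : Function.Injective ((LinearMap.ker f).subtype.baseChange A) :=
      Module.Flat.lTensor_preserves_injective_linearMap _ (LinearMap.ker f).injective_subtype
    have h3 : Function.Surjective (f.baseChange A) := LinearMap.lTensor_surjective A hf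
    exact pdLE_right h2 h3 h1 (ih hk) (pdLE_of_projective _)

section
variable {M : Type} [AddCommGroup M] [Module R M] [Module R[X] M] [IsScalarTower R R[X] M]

/-- The map `p ⊗ x ↦ p • x`. -/
def polyAct : R[X] ⊗[R] M →ₗ[R[X]] M :=
  AlgebraTensorModule.lift ((LinearMap.lsmul R[X] M).restrictScalars₁₂ R[X] R)

/-- The map `p ⊗ x ↦ X p ⊗ x - p ⊗ X x`. -/
def polyDiff : R[X] ⊗[R] M →ₗ[R[X]] R[X] ⊗[R] M :=
  (Polynomial.X : R[X]) • LinearMap.id -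
    AlgebraTensorModule.map LinearMap.id ((LinearMap.lsmul R[X] M Polynomial.X).restrictScalars R)

theorem polyAct_tmul (p : R[X]) (x : M) : polyAct (p ⊗ₜ[R] x) = p • x := rfl

theorem polyDiff_tmul (p : R[X]) (x : M) :
    polyDiff (p ⊗ₜ[R] x) = (Polynomial.X * p) ⊗ₜ[R] x - p ⊗ₜ[R] ((Polynomial.X : R[X]) • x) := rfl

theorem polyAct_surjective : Function.Surjective (polyAct (R := R) (M := M)) :=
  fun x => ⟨1 ⊗ₜ x, by simp [polyAct_tmul]⟩

theorem polyDiff_exact : Function.Exact (polyDiff (R := R) (M := M)) polyAct := by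
  intro t
  constructor
  · intro ht
    have key : ∀ t : R[X] ⊗[R] M,
        t - (1 : R[X]) ⊗ₜ[R] polyAct t ∈ LinearMap.range (polyDiff (R := R) (M := M)) := by
      intro t
      induction t with
      | zero => simp
      | add a b ha hb =>
        convert add_mem ha hb using 1
        rw [map_add, TensorProduct.tmul_add]; abel
      | tmul p x =>
        rw [polyAct_tmul]
        induction p using Polynomial.induction_on' generalizing x with
        | add p q hp hq =>
          convert add_mem (hp x) (hq x) using 1
          rw [TensorProduct.add_tmul, add_smul, TensorProduct.tmul_add]; abel
        | monomial n a =>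
          induction n generalizing x with
          | zero =>
            rw [Polynomial.monomial_zero_left, ← Polynomial.algebraMap_eq, algebraMap_smul,
              Algebra.algebraMap_eq_smul_one, TensorProduct.smul_tmul, sub_self]
            exact zero_mem _
          | succ n ih =>
            convert add_mem (ih ((Polynomial.X : R[X]) • x))
              (LinearMap.mem_range_self (polyDiff (R := R) (M := M)) (monomial n a ⊗ₜ x)) using 1
            rw [polyDiff_tmul, Polynomial.X_mul_monomial, smul_smul, Polynomial.monomial_mul_X]
            abel
    simpa [ht] using key t
  · rintro ⟨s, rfl⟩
    induction s with
    | zero => simp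
    | add a b ha hb => rw [map_add, map_add, ha, hb, add_zero]
    | tmul p x =>
      rw [polyDiff_tmul, map_sub, polyAct_tmul, polyAct_tmul, smul_smul, mul_comm, sub_self]

theorem polyDiff_injective : Function.Injective (polyDiff (R := R) (M := M)) := by
  rw [injective_iff_map_eq_zero]
  intro t ht
  let E := TensorProduct.equivFinsuppOfBasisLeft (N := M) (Polynomial.basisMonomials R)
  have key : ∀ (t : R[X] ⊗[R] M) (i : ℕ),
      E (polyDiff t) (i + 1) = E t i - (Polynomial.X : R[X]) • E t (i + 1) := by
    intro t i
    induction t with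
    | zero => simp
    | add a b ha hb =>
      simp only [map_add, Finsupp.add_apply, smul_add] at *
      rw [ha, hb]; abel
    | tmul p x =>
      rw [polyDiff_tmul, map_sub, Finsupp.sub_apply]
      simp only [E, TensorProduct.equivFinsuppOfBasisLeft_apply_tmul_apply]
      congr 1
      swap
      · exact smul_comm _ _ _
      change (Polynomial.X * p).coeff (i + 1) • x = p.coeff i • x
      rw [Polynomial.coeff_X_mul]
  have h1 : ∀ i, E t i = (Polynomial.X : R[X]) • E t (i + 1) := by
    intro i
    have := key t i
    rw [ht, map_zero, Finsupp.zero_apply] at this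
    exact (sub_eq_zero.1 this.symm)
  have h2 : ∀ k i, E t i = (Polynomial.X ^ k : R[X]) • E t (i + k) := by
    intro k
    induction k with
    | zero => simp
    | succ k ih => intro i; rw [ih, h1, smul_smul, pow_succ, add_assoc]
  have h3 : E t = 0 := by
    ext i
    rw [h2 ((E t).support.sup id + 1) i]
    have : E t (i + ((E t).support.sup id + 1)) = 0 := by
      by_contra hne
      have := Finset.le_sup (f := id) (Finsupp.mem_support_iff.2 hne)
      simp only [id] at this
      lia
    rw [this, smul_zero, Finsupp.zero_apply]
  exact (LinearEquiv.map_eq_zero_iff E).1 h3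
end

theorem forall_pdLE_polynomial {n : ℕ}
    (h : ∀ (M : Type) [AddCommGroup M] [Module R M], pdLE R n M)
    (M : Type) [AddCommGroup M] [Module R[X] M] : pdLE R[X] (n + 1) M := by
  let : Module R M := Module.compHom M (algebraMap R R[X])
  have : IsScalarTower R R[X] M := ⟨fun a p x => by
    rw [Algebra.smul_def, mul_smul]; rfl⟩
  have h0 := pdLE_baseChange (R := R) R[X] (h M)
  exact pdLE_right polyDiff_injective polyAct_surjective polyDiff_exact h0
    (pdLE_mono (Nat.le_succ n) h0)

theorem hilbert_syzygy (ℓ : ℕ) (M : Type) [AddCommGroup M] [Module (PS K ℓ) M] :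
    pdLE (PS K ℓ) ℓ M := by
  induction ℓ generalizing M with
  | zero =>
    refine forall_pdLE_of_ringEquiv (isEmptyAlgEquiv K (Fin 0)).symm.toRingEquiv ?_ M
    intro M _ _
    exact pdLE_of_projective 0
  | succ n ih =>
    refine forall_pdLE_of_ringEquiv (finSuccEquiv K n).symm.toRingEquiv ?_ M
    exact forall_pdLE_polynomial (fun M _ _ => ih M)
end Hilbert

section ChangeOfRings
open CategoryTheory
variable {R T : Type} [CommRing R] [CommRing T] [Algebra R T]

theorem pdLE_one_finsupp {a : R} (ha : a ∈ nonZeroDivisors R)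
    (hs : Function.Surjective (algebraMap R T))
    (hk : ∀ x, algebraMap R T x = 0 ↔ a ∣ x) (ι : Type) : pdLE R 1 (ι →₀ T) := by
  let f : (ι →₀ R) →ₗ[R] (ι →₀ R) := LinearMap.lsmul R (ι →₀ R) a
  let g : (ι →₀ R) →ₗ[R] (ι →₀ T) := Finsupp.mapRange.linearMap (Algebra.linearMap R T)
  have hf : Function.Injective f := by
    rw [injective_iff_map_eq_zero]
    intro x hx
    ext i
    have : a * x i = 0 := DFunLike.congr_fun hx i
    rw [mul_comm] at this
    exact mem_nonZeroDivisors_iff_right.1 ha _ this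
  have hg : Function.Surjective g := Finsupp.mapRange_surjective _ (map_zero _) hs
  have he : Function.Exact f g := by
    intro x
    constructor
    · intro hx
      have h1 : ∀ i, a ∣ x i := fun i => (hk _).1 (DFunLike.congr_fun hx i)
      refine ⟨x.mapRange (fun y => if h : a ∣ y ∧ y ≠ 0 then h.1.choose else 0) (by simp), ?_⟩
      ext i
      change a * _ = _
      rw [Finsupp.mapRange_apply]
      by_cases h0 : x i = 0
      · simp [h0]
      · rw [dif_pos ⟨h1 i, h0⟩]
        exact (h1 i).choose_spec.symm
    · rintro ⟨y, rfl⟩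
      ext i
      exact (hk _).2 (dvd_mul_right a (y i))
  exact pdLE_right hf hg he (pdLE_of_projective 0) (pdLE_of_projective 1)

theorem pdLE_retract {M N : Type} [AddCommGroup M] [Module R M] [AddCommGroup N] [Module R N]
    (s : M →ₗ[R] N) (f : N →ₗ[R] M) (h : f ∘ₗ s = LinearMap.id) {n : ℕ} (hN : pdLE R n N) :
    pdLE R n M := by
  rw [pdLE_iff] at hN ⊢
  exact Retract.hasProjectiveDimensionLT (X := ModuleCat.of R M) (Y := ModuleCat.of R N)
    ⟨ModuleCat.ofHom s, ModuleCat.ofHom f, by rw [← ModuleCat.ofHom_comp, h]; rfl⟩ _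

theorem pdLE_restrictScalars {a : R} (ha : a ∈ nonZeroDivisors R)
    (hs : Function.Surjective (algebraMap R T))
    (hk : ∀ x, algebraMap R T x = 0 ↔ a ∣ x) {n : ℕ} {N : Type} [AddCommGroup N] [Module T N]
    [Module R N] [IsScalarTower R T N] (h : pdLE T n N) : pdLE R (n + 1) N := by
  induction n generalizing N with
  | zero =>
    have : Module.Projective T N := h
    obtain ⟨s, hs'⟩ := Module.projective_def'.1 this
    refine pdLE_retract (s.restrictScalars R)
      ((Finsupp.linearCombination T (id : N → N)).restrictScalars R) ?_
      (pdLE_one_finsupp ha hs hk N)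
    ext x
    exact LinearMap.congr_fun hs' x
  | succ n ih =>
    obtain ⟨ι, f, hf, hfk⟩ := h
    have h1 : pdLE R (n + 1) (LinearMap.ker f) := ih hfk
    have he : Function.Exact ((LinearMap.ker f).subtype.restrictScalars R)
        (f.restrictScalars R) := LinearMap.exact_subtype_ker_map f
    exact pdLE_right (M₁ := LinearMap.ker f) (M₂ := ι →₀ T) (M₃ := N)
      (f := (LinearMap.ker f).subtype.restrictScalars R) (g := f.restrictScalars R)
      (LinearMap.ker f).injective_subtype hf he h1
      (pdLE_mono (by lia) (pdLE_one_finsupp ha hs hk ι))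

end ChangeOfRings

section RegularSequence
open RingTheory.Sequence

/-- The ideal generated by the variables. -/
abbrev maxId (K : Type) [Field K] (ℓ : ℕ) : Ideal (PS K ℓ) :=
  Ideal.span (Set.range (X : Fin ℓ → PS K ℓ))

theorem maxId_ne_top : maxId K ℓ ≠ ⊤ := by
  intro h
  have h1 : (1 : PS K ℓ) ∈ maxId K ℓ := h ▸ Submodule.mem_top
  rw [maxId, ← Set.image_univ, mem_ideal_span_X_image] at h1
  obtain ⟨i, -, hi⟩ := h1 0 (by simp)
  exact hi rfl

theorem isWeaklyRegular_vars :
    IsWeaklyRegular (PS K ℓ) (List.ofFn (X : Fin ℓ → PS K ℓ)) := by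
  rw [isWeaklyRegular_iff]
  intro i hi
  have hi' : i < ℓ := by simpa using hi
  have hI : Ideal.ofList ((List.ofFn (X : Fin ℓ → PS K ℓ)).take i) =
      Ideal.span ((X : Fin ℓ → PS K ℓ) '' {j | (j : ℕ) < i}) := by
    rw [Ideal.ofList]
    congr 1
    ext f
    simp only [Set.mem_ofPred_eq, Set.mem_image, List.mem_take_iff_getElem, List.getElem_ofFn,
      List.length_ofFn]
    constructor
    · rintro ⟨j, hj, rfl⟩
      exact ⟨⟨j, by omega⟩, by simp; omega, rfl⟩
    · rintro ⟨j, hj, rfl⟩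
      exact ⟨j, by omega, rfl⟩
  rw [isSMulRegular_iff_right_eq_zero_of_smul]
  intro x hx
  obtain ⟨f, rfl⟩ := Submodule.Quotient.mk_surjective _ x
  rw [← Submodule.Quotient.mk_smul, Submodule.Quotient.mk_eq_zero, smul_eq_mul, hI,
    Ideal.mul_top, mem_ideal_span_X_image] at hx
  rw [Submodule.Quotient.mk_eq_zero, smul_eq_mul, hI, Ideal.mul_top, mem_ideal_span_X_image]
  intro m hm
  rw [List.getElem_ofFn, smul_eq_mul] at hx
  obtain ⟨j, hj, hj'⟩ := hx (Finsupp.single ⟨i, hi'⟩ 1 + m) (by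
    rw [mem_support_iff, coeff_X_mul]; exact mem_support_iff.1 hm)
  refine ⟨j, hj, ?_⟩
  have hne : (⟨i, hi'⟩ : Fin ℓ) ≠ j := by
    rintro rfl
    exact lt_irrefl i hj
  simpa [Finsupp.single_apply, hne] using hj'

theorem isWeaklyRegular_vars_free (G : Type) [AddCommGroup G] [Module (PS K ℓ) G]
    [Module.Free (PS K ℓ) G] :
    IsWeaklyRegular G (List.ofFn (X : Fin ℓ → PS K ℓ)) :=
  (LinearEquiv.isWeaklyRegular_congr (TensorProduct.rid (PS K ℓ) G) _).1
    isWeaklyRegular_vars.isWeaklyRegular_lTensor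

theorem maxId_smul_top_ne_top (G : Type) [AddCommGroup G] [Module (PS K ℓ) G]
    [Module.Free (PS K ℓ) G] [Nontrivial G] : maxId K ℓ • (⊤ : Submodule (PS K ℓ) G) ≠ ⊤ := by
  intro h
  let b : Module.Basis _ (PS K ℓ) G := Module.Free.chooseBasis (PS K ℓ) G
  have : Nonempty (Module.Free.ChooseBasisIndex (PS K ℓ) G) := b.index_nonempty
  obtain ⟨i⟩ := this
  apply maxId_ne_top (K := K) (ℓ := ℓ)
  have h1 : Submodule.map (b.coord i : G →ₗ[PS K ℓ] PS K ℓ)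
      (maxId K ℓ • (⊤ : Submodule (PS K ℓ) G)) ≤ maxId K ℓ := by
    rw [Submodule.map_smul'']
    exact Submodule.smul_le.2 fun r hr x _ => Ideal.mul_mem_right _ _ hr
  rw [h] at h1
  exact (Ideal.eq_top_iff_one _).2 (h1 ⟨b i, trivial, by simp⟩)

theorem ofList_vars : Ideal.ofList (List.ofFn (X : Fin ℓ → PS K ℓ)) = maxId K ℓ := by
  rw [Ideal.ofList, maxId]
  congr 1
  ext f
  simp [List.mem_ofFn]

end RegularSequence

section Depth
open CategoryTheory Abelian

/-- The residue field at the origin. -/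
abbrev resMod (K : Type) [Field K] (ℓ : ℕ) : ModuleCat.{0} (PS K ℓ) :=
  ModuleCat.of (PS K ℓ) (PS K ℓ ⧸ maxId K ℓ)

theorem ext_resMod_free (G : Type) [AddCommGroup G] [Module (PS K ℓ) G]
    [Module.Free (PS K ℓ) G] [Module.Finite (PS K ℓ) G] {i : ℕ} (hi : i < ℓ) :
    Subsingleton (Ext (resMod K ℓ) (ModuleCat.of (PS K ℓ) G) i) := by
  by_cases hG : Subsingleton G
  · refine subsingleton_of_forall_eq 0 fun x => ?_
    have h0 : 𝟙 (ModuleCat.of (PS K ℓ) G) = 0 :=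
      (ModuleCat.isZero_of_subsingleton (ModuleCat.of (PS K ℓ) G)).eq_of_src _ _
    rw [← Ext.comp_mk₀_id x, h0, Ext.mk₀_zero, Ext.comp_zero]
  · have : Nontrivial G := not_subsingleton_iff_nontrivial.1 hG
    refine ModuleCat.subsingleton_ext_of_exists_isRegular (maxId K ℓ) (resMod K ℓ) ?_
      (ModuleCat.of (PS K ℓ) G) (lt_top_iff_ne_top.2 (maxId_smul_top_ne_top G))
      (List.ofFn (X : Fin ℓ → PS K ℓ)) ?_ ?_ i (by simpa using hi)
    · rw [Module.support_eq_zeroLocus, Ideal.annihilator_quotient]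
    · intro r hr
      rw [List.mem_ofFn] at hr
      exact Ideal.subset_span hr
    · refine ⟨isWeaklyRegular_vars_free G, ?_⟩
      rw [ofList_vars]
      exact (maxId_smul_top_ne_top G).symm

theorem ext_resMod_of_pdLE {n : ℕ} (M : Type) [AddCommGroup M] [Module (PS K ℓ) M]
    [Module.Finite (PS K ℓ) M] (h : pdLE (PS K ℓ) n M) {i : ℕ} (hi : i + n < ℓ) :
    Subsingleton (Ext (resMod K ℓ) (ModuleCat.of (PS K ℓ) M) i) := by
  induction n generalizing M i with
  | zero =>
    have : Module.Projective (PS K ℓ) M := h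
    obtain ⟨k, f, g, hf, hg, hfg⟩ := Module.Finite.exists_comp_eq_id_of_projective (PS K ℓ) M
    refine subsingleton_of_forall_eq 0 fun x => ?_
    have hid : 𝟙 (ModuleCat.of (PS K ℓ) M) = ModuleCat.ofHom g ≫ ModuleCat.ofHom f := by
      rw [← ModuleCat.ofHom_comp, hfg]; rfl
    have := ext_resMod_free (Fin k → PS K ℓ) (K := K) (ℓ := ℓ) (i := i) (by omega)
    rw [← Ext.comp_mk₀_id x, hid, ← Ext.mk₀_comp_mk₀, ← Ext.comp_assoc_of_third_deg_zero,
      Subsingleton.elim (x.comp (Ext.mk₀ (ModuleCat.ofHom g)) (add_zero i)) 0, Ext.zero_comp]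
  | succ n ih =>
    obtain ⟨k, f, hf⟩ := Module.Finite.exists_fin' (PS K ℓ) M
    have hs := LinearMap.shortExact_shortComplexKer hf
    have hk : pdLE (PS K ℓ) n (LinearMap.ker f) :=
      pdLE_left (M₁ := LinearMap.ker f) (M₂ := Fin k → PS K ℓ) (M₃ := M)
        (LinearMap.ker f).injective_subtype hf (LinearMap.exact_subtype_ker_map f)
        (pdLE_of_projective n) h
    have h1 := ih (LinearMap.ker f) hk (i := i + 1) (by omega)
    have h2 := ext_resMod_free (Fin k → PS K ℓ) (K := K) (ℓ := ℓ) (i := i) (by omega)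
    refine subsingleton_of_forall_eq 0 fun x => ?_
    obtain ⟨y, rfl⟩ := Ext.covariant_sequence_exact₃ _ hs x rfl (h1.elim _ _)
    rw [h2.elim y 0, Ext.zero_comp]

end Depth

section Obstruction
open CategoryTheory Abelian

theorem resMod_hom_eq_zero {C : Type} [AddCommGroup C] [Module (PS K ℓ) C]
    (hC : ∀ y : C, (∀ i, (X i : PS K ℓ) • y = 0) → y = 0)
    (φ : (PS K ℓ ⧸ maxId K ℓ) →ₗ[PS K ℓ] C) : φ = 0 := by
  have h1 : φ (Submodule.Quotient.mk 1) = 0 := by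
    refine hC _ fun i => ?_
    rw [← map_smul, ← Submodule.Quotient.mk_smul, smul_eq_mul, mul_one,
      (Submodule.Quotient.mk_eq_zero _).2, map_zero]
    exact Ideal.subset_span ⟨i, rfl⟩
  ext
  simpa using h1

theorem ext_one_of_saturated {M₂ G : Type} [AddCommGroup M₂] [Module (PS K ℓ) M₂]
    [AddCommGroup G] [Module (PS K ℓ) G] [Module.Free (PS K ℓ) G] [Module.Finite (PS K ℓ) G]
    (hℓ : 2 ≤ ℓ) {f : M₂ →ₗ[PS K ℓ] G} (hf : Function.Injective f)
    (hsat : ∀ x : G, (∀ i, (X i : PS K ℓ) • x ∈ LinearMap.range f) → x ∈ LinearMap.range f) :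
    Subsingleton (Ext (resMod K ℓ) (ModuleCat.of (PS K ℓ) M₂) 1) := by
  have hs := shortExact_of hf (LinearMap.range f).mkQ_surjective
    (LinearMap.exact_map_mkQ_range f)
  have h1 := ext_resMod_free (K := K) (ℓ := ℓ) G (i := 1) (by omega)
  refine subsingleton_of_forall_eq 0 fun x => ?_
  obtain ⟨y, rfl⟩ := Ext.covariant_sequence_exact₁ _ hs x (h1.elim _ _) (zero_add 1)
  have hy : (Ext.homEquiv₀ y).hom = 0 := by
    refine resMod_hom_eq_zero (fun z hz => ?_) _
    obtain ⟨z, rfl⟩ := Submodule.Quotient.mk_surjective _ z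
    rw [Submodule.Quotient.mk_eq_zero]
    refine hsat z fun i => ?_
    rw [← Submodule.Quotient.mk_eq_zero, Submodule.Quotient.mk_smul]
    exact hz i
  have hy' : Ext.homEquiv₀ y = 0 := ModuleCat.hom_ext hy
  rw [← Ext.mk₀_homEquiv₀_apply y, hy', Ext.mk₀_zero, Ext.zero_comp]

/-- If the outer terms of `0 → M₁ → M₂ → N` have enough depth, then the image of `M₂` in `N` is
saturated with respect to the irrelevant ideal. -/
theorem mem_range_of_vars_smul_mem_range {M₁ M₂ N : Type} [AddCommGroup M₁] [Module (PS K ℓ) M₁]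
    [Module.Finite (PS K ℓ) M₁] [AddCommGroup M₂] [Module (PS K ℓ) M₂] [AddCommGroup N]
    [Module (PS K ℓ) N] {p : ℕ} (hp : p + 3 ≤ ℓ) (hM₁ : pdLE (PS K ℓ) p M₁)
    (hM₂ : Subsingleton (Ext (resMod K ℓ) (ModuleCat.of (PS K ℓ) M₂) 1))
    {f : M₁ →ₗ[PS K ℓ] M₂} {g : M₂ →ₗ[PS K ℓ] N} (hf : Function.Injective f)
    (hfg : Function.Exact f g)
    (hN : ∀ y : N, (∀ i, (X i : PS K ℓ) • y = 0) → y = 0) (y : N)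
    (hy : ∀ i, (X i : PS K ℓ) • y ∈ LinearMap.range g) : y ∈ LinearMap.range g := by
  have hs := shortExact_of (M₁ := M₁) (M₂ := M₂) (M₃ := LinearMap.range g) hf
    g.surjective_rangeRestrict
    (g := g.rangeRestrict) (fun x => by
      rw [← hfg x, Subtype.ext_iff]; rfl)
  have hE2 := ext_resMod_of_pdLE (K := K) (ℓ := ℓ) M₁ hM₁ (i := 2) (by omega)
  have hE1 : Subsingleton (Ext (resMod K ℓ) (ModuleCat.of (PS K ℓ) (LinearMap.range g)) 1) := by
    refine subsingleton_of_forall_eq 0 fun x => ?_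
    obtain ⟨z, rfl⟩ := Ext.covariant_sequence_exact₃ _ hs x rfl (hE2.elim _ _)
    rw [hM₂.elim z 0, Ext.zero_comp]
  have hs' := shortExact_of (LinearMap.range g).injective_subtype
    (LinearMap.range g).mkQ_surjective (LinearMap.exact_subtype_mkQ (LinearMap.range g))
  let φ : (PS K ℓ ⧸ maxId K ℓ) →ₗ[PS K ℓ] N ⧸ LinearMap.range g :=
    Submodule.liftQ _ (LinearMap.toSpanSingleton (PS K ℓ) _ (Submodule.Quotient.mk y)) (by
      rw [maxId, Ideal.span, Submodule.span_le]
      rintro _ ⟨i, rfl⟩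
      rw [SetLike.mem_coe, LinearMap.mem_ker, LinearMap.toSpanSingleton_apply,
        ← Submodule.Quotient.mk_smul, Submodule.Quotient.mk_eq_zero]
      exact hy i)
  obtain ⟨z, hz⟩ := Ext.covariant_sequence_exact₃ (resMod K ℓ) hs'
    (Ext.mk₀ (ModuleCat.ofHom φ)) (zero_add 1) (hE1.elim _ _)
  have hz0 : Ext.homEquiv₀ z = 0 := ModuleCat.hom_ext (resMod_hom_eq_zero hN _)
  rw [← Ext.mk₀_homEquiv₀_apply z, hz0, Ext.mk₀_zero, Ext.zero_comp] at hz
  have hφ : φ = 0 := by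
    have h0 : ModuleCat.ofHom φ = 0 := by
      apply (Ext.mk₀_bijective _ _).1
      rw [← hz, Ext.mk₀_zero]
    exact congrArg ModuleCat.Hom.hom h0
  have h1 : φ (Submodule.Quotient.mk 1) = 0 := by rw [hφ]; rfl
  have h2 : φ (Submodule.Quotient.mk 1) = Submodule.Quotient.mk y :=
    one_smul (PS K ℓ) (Submodule.Quotient.mk y : N ⧸ LinearMap.range g)
  rw [← Submodule.Quotient.mk_eq_zero (LinearMap.range g), ← h2, h1]

end Obstruction

section ScalarDivisibility
variable {R M : Type} [CommRing R] [AddCommGroup M] [Module R M]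

/-- `f` divides the vector `η`. -/
def SDvd (f : R) (η : M) : Prop := ∃ ξ, η = f • ξ

theorem sdvd_smul_self (f : R) (η : M) : SDvd f (f • η) := ⟨η, rfl⟩

theorem sdvd_zero (f : R) : SDvd f (0 : M) := ⟨0, by simp⟩

theorem SDvd.add {f : R} {η ξ : M} : SDvd f η → SDvd f ξ → SDvd f (η + ξ) := by
  rintro ⟨a, rfl⟩ ⟨b, rfl⟩
  exact ⟨a + b, (smul_add _ _ _).symm⟩

theorem SDvd.neg {f : R} {η : M} : SDvd f η → SDvd f (-η) := by
  rintro ⟨a, rfl⟩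
  exact ⟨-a, (smul_neg _ _).symm⟩

theorem SDvd.smul {f : R} {η : M} (g : R) : SDvd f η → SDvd f (g • η) := by
  rintro ⟨a, rfl⟩
  exact ⟨g • a, smul_comm _ _ _⟩

theorem SDvd.of_dvd {f g : R} {η : M} (hfg : f ∣ g) : SDvd g η → SDvd f η := by
  rintro ⟨a, rfl⟩
  obtain ⟨b, rfl⟩ := hfg
  exact ⟨b • a, mul_smul _ _ _⟩

theorem SDvd.smul_smul {f g : R} {η : M} : SDvd f η → SDvd (g * f) (g • η) := by
  rintro ⟨a, rfl⟩
  exact ⟨a, (mul_smul _ _ _).symm⟩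

theorem sdvd_smul_of_dvd {f g : R} (h : f ∣ g) (η : M) : SDvd f (g • η) :=
  (sdvd_smul_self g η).of_dvd h

variable {A : Type} [Ring A] [Algebra R A]

theorem SDvd.mul_left {f : R} {η : A} (ξ : A) : SDvd f η → SDvd f (ξ * η) := by
  rintro ⟨a, rfl⟩
  exact ⟨ξ * a, by simp⟩

theorem SDvd.mul_right {f : R} {η : A} (ξ : A) : SDvd f η → SDvd f (η * ξ) := by
  rintro ⟨a, rfl⟩
  exact ⟨a * ξ, by simp⟩

theorem sdvd_iff_repr {ι : Type} (b : Module.Basis ι R M) {f : R} {η : M} :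
    SDvd f η ↔ ∀ i, f ∣ b.repr η i := by
  constructor
  · rintro ⟨ξ, rfl⟩ i
    exact ⟨b.repr ξ i, by simp⟩
  · intro h
    choose g hg using h
    refine ⟨b.repr.symm ((b.repr η).support.sum fun i => Finsupp.single i (g i)), ?_⟩
    apply b.repr.injective
    ext i
    simp only [map_smul, LinearEquiv.apply_symm_apply, Finsupp.smul_apply,
      Finsupp.finsetSum_apply, Finsupp.single_apply, smul_eq_mul, Finset.sum_ite_eq',
      Finsupp.mem_support_iff]
    split_ifs with h0
    · exact hg i
    · rw [mul_zero]; exact not_not.1 h0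

variable [Module.Free R M]

theorem SDvd.of_smul [DecompositionMonoid R] {f g : R} {η : M} (hfg : IsRelPrime f g)
    (h : SDvd f (g • η)) : SDvd f η := by
  let b : Module.Basis _ R M := Module.Free.chooseBasis R M
  rw [sdvd_iff_repr b] at h ⊢
  intro i
  have := h i
  rw [map_smul, Finsupp.smul_apply, smul_eq_mul] at this
  exact hfg.dvd_of_dvd_mul_left this

theorem sdvd_prod [DecompositionMonoid R] {ι : Type} {s : Finset ι} {f : ι → R} {η : M}
    (hf : (s : Set ι).Pairwise (Function.onFun IsRelPrime f)) (h : ∀ i ∈ s, SDvd (f i) η) :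
    SDvd (∏ i ∈ s, f i) η := by
  let b : Module.Basis _ R M := Module.Free.chooseBasis R M
  rw [sdvd_iff_repr b]
  exact fun j => Finset.prod_dvd_of_isRelPrime hf fun i hi => (sdvd_iff_repr b).1 (h i hi) j

theorem smul_left_cancel [IsDomain R] {f : R} (hf : f ≠ 0) {η ξ : M} (h : f • η = f • ξ) :
    η = ξ := by
  let b : Module.Basis _ R M := Module.Free.chooseBasis R M
  apply b.repr.injective
  ext i
  have := congrArg (fun x => b.repr x i) h
  simpa [hf] using this

theorem sdvd_of_smul_smul [IsDomain R] {f g : R} (hg : g ≠ 0) {η : M} (h : SDvd (g * f) (g • η)) :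
    SDvd f η := by
  obtain ⟨ξ, hξ⟩ := h
  exact ⟨ξ, smul_left_cancel hg (by rw [hξ, mul_smul])⟩

end ScalarDivisibility

section LinearForms

theorem linP_smul (t : K) (c : Fin ℓ → K) : linP (t • c) = C t * linP c := by
  simp [linP, Finset.mul_sum, mul_assoc]

theorem linP_add (c c' : Fin ℓ → K) : linP (c + c') = linP c + linP c' := by
  simp [linP, Finset.sum_add_distrib, add_mul]

theorem linP_single (i : Fin ℓ) : linP (Pi.single i (1 : K)) = X i := by
  rw [linP, Finset.sum_eq_single i]
  · simp
  · intro j _ hj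
    simp [hj]
  · simp

theorem eval_linP (x c : Fin ℓ → K) : eval x (linP c) = ∑ i, c i * x i := by
  simp [linP]

theorem irreducible_linP {c : Fin ℓ → K} (hc : c ≠ 0) : Irreducible (linP c) := by
  have h : linP c = sumSMulX (Finsupp.equivFunOnFinite.symm c) := by
    simp [linP, sumSMulX, Finsupp.linearCombination_apply, Finsupp.sum_fintype, smul_eq_C_mul]
  rw [h]
  obtain ⟨i, hi⟩ := Function.ne_iff.1 hc
  refine irreducible_sumSMulX _ ⟨i, by simpa using hi⟩ fun r hr => ?_
  rw [isUnit_iff_ne_zero]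
  rintro rfl
  exact hi (by simpa using hr i)

theorem linP_ne_zero {c : Fin ℓ → K} (hc : c ≠ 0) : linP c ≠ 0 := (irreducible_linP hc).ne_zero

theorem prime_linP {c : Fin ℓ → K} (hc : c ≠ 0) : Prime (linP c) := (irreducible_linP hc).prime

theorem exists_eq_smul_of_dvd {c c' : Fin ℓ → K} (hc : c ≠ 0) (h : linP c ∣ linP c') :
    ∃ t : K, c' = t • c := by
  obtain ⟨j, hj⟩ := Function.ne_iff.1 hc
  rw [Pi.zero_apply] at hj
  obtain ⟨g, hg⟩ := h
  refine ⟨c' j / c j, ?_⟩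
  ext i
  have key : ∀ d : Fin ℓ → K, ∑ k, d k * (c j • Pi.single i (1 : K) - c i • Pi.single j (1 : K)
      : Fin ℓ → K) k = d i * c j - d j * c i := by
    intro d
    simp [mul_sub, Finset.sum_sub_distrib, Pi.single_apply]
  have h1 := congrArg (eval (c j • Pi.single i (1 : K) - c i • Pi.single j (1 : K))) hg
  rw [map_mul, eval_linP, eval_linP, key, key, mul_comm (c i), sub_self, zero_mul] at h1
  rw [Pi.smul_apply, smul_eq_mul, div_mul_eq_mul_div, eq_div_iff hj]
  exact sub_eq_zero.1 h1

theorem isRelPrime_linP {c c' : Fin ℓ → K} (hc : c ≠ 0) (h : ∀ t : K, c' ≠ t • c) :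
    IsRelPrime (linP c) (linP c') := by
  rw [(irreducible_linP hc).isRelPrime_iff_not_dvd]
  intro hd
  obtain ⟨t, ht⟩ := exists_eq_smul_of_dvd hc hd
  exact h t ht

theorem isRelPrime_of_mem_hyps (A : Arrangement K ℓ) {c c' : Fin ℓ → K} (hc : c ∈ A.hyps)
    (hc' : c' ∈ A.hyps) (h : c ≠ c') : IsRelPrime (linP c) (linP c') :=
  isRelPrime_linP (A.ne_zero c hc) (A.nonprop c' hc' c hc (Ne.symm h))

theorem pairwise_isRelPrime_hyps (A : Arrangement K ℓ) (m : (Fin ℓ → K) → ℕ) :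
    (A.hyps : Set (Fin ℓ → K)).Pairwise
      (Function.onFun IsRelPrime fun c => linP c ^ m c) :=
  fun _ hc _ hc' h => (isRelPrime_of_mem_hyps A hc hc' h).pow

theorem Qpoly_ne_zero (A : Arrangement K ℓ) (m : (Fin ℓ → K) → ℕ) : Qpoly A m ≠ 0 :=
  Finset.prod_ne_zero_iff.2 fun c hc => pow_ne_zero _ (linP_ne_zero (A.ne_zero c hc))

end LinearForms

section Forms

instance : Module.Free (PS K ℓ) (ExtF K ℓ) :=
  Module.Free.of_basis (Pi.basisFun (PS K ℓ) (Fin ℓ)).ExteriorAlgebra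

instance : Module.Finite (PS K ℓ) (ExtF K ℓ) :=
  Module.Finite.of_basis (Pi.basisFun (PS K ℓ) (Fin ℓ)).ExteriorAlgebra

theorem dP_mul_self (c : Fin ℓ → K) : dP c * dP c = 0 := ExteriorAlgebra.ι_sq_zero _

theorem dP_mem (c : Fin ℓ → K) : dP c ∈ formsP K ℓ 1 := by
  rw [formsP, pow_one]; exact ⟨_, rfl⟩

theorem formsP_mul {p q : ℕ} {η ξ : ExtF K ℓ} (hη : η ∈ formsP K ℓ p) (hξ : ξ ∈ formsP K ℓ q) :
    η * ξ ∈ formsP K ℓ (p + q) := by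
  rw [formsP, pow_add]; exact Submodule.mul_mem_mul hη hξ

theorem dP_mul_mem (c : Fin ℓ → K) {p : ℕ} {η : ExtF K ℓ} (hη : η ∈ formsP K ℓ p) :
    dP c * η ∈ formsP K ℓ (p + 1) := by
  rw [add_comm]; exact formsP_mul (dP_mem c) hη

theorem mem_formsP_of_smul {p : ℕ} {f : PS K ℓ} (hf : f ≠ 0) {η : ExtF K ℓ}
    (h : f • η ∈ formsP K ℓ p) : η ∈ formsP K ℓ p := by
  let 𝒜 : ℕ → Submodule (PS K ℓ) (ExtF K ℓ) := formsP K ℓ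
  let _ : GradedAlgebra 𝒜 := ExteriorAlgebra.gradedAlgebra (PS K ℓ) (Fin ℓ → PS K ℓ)
  have h0 : ∀ j ≠ p, (DirectSum.decompose 𝒜 η j : ExtF K ℓ) = 0 := by
    intro j hj
    have h1 : (DirectSum.decompose 𝒜 (f • η) j : ExtF K ℓ) = 0 :=
      DirectSum.decompose_of_mem_ne 𝒜 h (Ne.symm hj)
    rw [DirectSum.decompose_smul, DirectSum.smul_apply, Submodule.coe_smul] at h1
    exact smul_left_cancel hf (by rw [h1, smul_zero])
  rw [← DirectSum.sum_support_decompose 𝒜 η]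
  refine Submodule.sum_mem _ fun j _ => ?_
  by_cases hj : j = p
  · subst hj; exact (DirectSum.decompose 𝒜 η j).2
  · rw [h0 j hj]; exact zero_mem _

theorem mem_Omega {A : Arrangement K ℓ} {m : (Fin ℓ → K) → ℕ} {p : ℕ} {η : ExtF K ℓ} :
    η ∈ Omega A m p ↔
      η ∈ formsP K ℓ p ∧ ∀ c ∈ A.hyps, SDvd (linP c ^ m c) (dP c * η) := by
  rw [Omega, Submodule.mem_inf]
  refine and_congr_right fun hη => ?_
  simp only [Submodule.mem_iInf, Submodule.mem_comap, Submodule.mem_map, LinearMap.mulLeft_apply]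
  refine forall₂_congr fun c hc => ?_
  constructor
  · rintro ⟨ξ, -, h⟩
    exact ⟨ξ, h.symm⟩
  · rintro ⟨ξ, h⟩
    refine ⟨ξ, ?_, h.symm⟩
    exact mem_formsP_of_smul (pow_ne_zero (m c) (linP_ne_zero (A.ne_zero c hc)))
      (h ▸ dP_mul_mem c hη)

end Forms

section SemilinearMap
variable {R R' M M' : Type} [CommRing R] [CommRing R'] [AddCommGroup M] [Module R M]
  [AddCommGroup M'] [Module R' M']

/-- The ring homomorphism between exterior algebras induced by a semilinear map. -/
def extMap (r : R →+* R') (f : M →ₛₗ[r] M') : ExteriorAlgebra R M →+* ExteriorAlgebra R' M' :=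
  letI : Algebra R (ExteriorAlgebra R' M') := Algebra.compHom _ r
  (ExteriorAlgebra.lift R (M := M) (A := ExteriorAlgebra R' M')
    ⟨{ toFun := fun x => ExteriorAlgebra.ι R' (f x)
       map_add' := fun x y => by rw [map_add, map_add]
       map_smul' := fun a x => by rw [map_smulₛₗ, map_smul]; rfl },
     fun x => ExteriorAlgebra.ι_sq_zero (f x)⟩).toRingHom

theorem extMap_ι (r : R →+* R') (f : M →ₛₗ[r] M') (x : M) :
    extMap r f (ExteriorAlgebra.ι R x) = ExteriorAlgebra.ι R' (f x) := by
  let _ : Algebra R (ExteriorAlgebra R' M') := Algebra.compHom _ r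
  exact ExteriorAlgebra.lift_ι_apply R _ _ x

theorem extMap_algebraMap (r : R →+* R') (f : M →ₛₗ[r] M') (a : R) :
    extMap r f (algebraMap R _ a) = algebraMap R' _ (r a) := by
  let _ : Algebra R (ExteriorAlgebra R' M') := Algebra.compHom _ r
  exact AlgHom.commutes (ExteriorAlgebra.lift R (M := M) (A := ExteriorAlgebra R' M') _) a

theorem extMap_smul (r : R →+* R') (f : M →ₛₗ[r] M') (a : R) (x : ExteriorAlgebra R M) :
    extMap r f (a • x) = r a • extMap r f x := by
  rw [Algebra.smul_def, map_mul, extMap_algebraMap, ← Algebra.smul_def]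

end SemilinearMap

section Induction

theorem dP_add (c c' : Fin ℓ → K) : dP (c + c') = dP c + dP c' := by
  rw [dP, dP, dP, ← map_add]
  congr 1
  ext1 i
  simp

theorem dP_smul (t : K) (c : Fin ℓ → K) : dP (t • c) = (C t : PS K ℓ) • dP c := by
  rw [dP, dP, ← map_smul]
  congr 1
  ext1 i
  simp

theorem ι_eq_sum (x : Fin ℓ → PS K ℓ) :
    ExteriorAlgebra.ι (PS K ℓ) x = ∑ j, x j • dP (Pi.single j (1 : K)) := by
  simp only [dP]
  simp_rw [← map_smul]
  rw [← map_sum]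
  congr 1
  ext1 i
  simp [Pi.single_apply, Finset.sum_apply]

theorem ExtF_induction {P : ExtF K ℓ → Prop} (hC : ∀ f : PS K ℓ, P (algebraMap _ _ f))
    (hd : ∀ c, P (dP c)) (hmul : ∀ x y, P x → P y → P (x * y))
    (hadd : ∀ x y, P x → P y → P (x + y)) (x : ExtF K ℓ) : P x := by
  induction x using ExteriorAlgebra.induction with
  | algebraMap r => exact hC r
  | ι x =>
    rw [ι_eq_sum]
    refine Finset.sum_induction _ P hadd ?_ fun j _ => ?_
    · simpa using hC 0
    · rw [Algebra.smul_def]; exact hmul _ _ (hC _) (hd _)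
  | mul a b ha hb => exact hmul a b ha hb
  | add a b ha hb => exact hadd a b ha hb

theorem dP_mul_swap (c c' : Fin ℓ → K) : dP c * dP c' = -(dP c' * dP c) :=
  eq_neg_of_add_eq_zero_left (ExteriorAlgebra.ι_add_mul_swap _ _)

theorem exists_dP_mul_eq_mul_dP (c : Fin ℓ → K) (z : ExtF K ℓ) :
    ∃ z', dP c * z = z' * dP c := by
  induction z using ExtF_induction with
  | hC f => exact ⟨_, (Algebra.commutes f _).symm⟩
  | hd c' => exact ⟨-dP c', by rw [dP_mul_swap, neg_mul]⟩
  | hmul x y hx hy =>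
    obtain ⟨x', hx⟩ := hx
    obtain ⟨y', hy⟩ := hy
    exact ⟨x' * y', by rw [← mul_assoc, hx, mul_assoc, hy, mul_assoc]⟩
  | hadd x y hx hy =>
    obtain ⟨x', hx⟩ := hx
    obtain ⟨y', hy⟩ := hy
    exact ⟨x' + y', by rw [mul_add, add_mul, hx, hy]⟩

theorem exists_mul_dP_eq_dP_mul (c : Fin ℓ → K) (z : ExtF K ℓ) :
    ∃ z', z * dP c = dP c * z' := by
  induction z using ExtF_induction with
  | hC f => exact ⟨_, Algebra.commutes f _⟩
  | hd c' => exact ⟨-dP c', by rw [dP_mul_swap, mul_neg]⟩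
  | hmul x y hx hy =>
    obtain ⟨x', hx⟩ := hx
    obtain ⟨y', hy⟩ := hy
    exact ⟨x' * y', by rw [mul_assoc, hy, ← mul_assoc, hx, mul_assoc]⟩
  | hadd x y hx hy =>
    obtain ⟨x', hx⟩ := hx
    obtain ⟨y', hy⟩ := hy
    exact ⟨x' + y', by rw [mul_add, add_mul, hx, hy]⟩

theorem dP_mul_mul_dP (c : Fin ℓ → K) (z : ExtF K ℓ) : dP c * z * dP c = 0 := by
  obtain ⟨z', hz⟩ := exists_mul_dP_eq_dP_mul c z
  rw [mul_assoc, hz, ← mul_assoc, dP_mul_self, zero_mul]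

/-- The submodule `formsP` is spanned by products of constant one-forms. -/
theorem formsP_induction {P : ℕ → ExtF K ℓ → Prop}
    (hC : ∀ f : PS K ℓ, P 0 (algebraMap _ _ f))
    (hadd : ∀ p x y, P p x → P p y → P p (x + y)) (hsmul : ∀ p (f : PS K ℓ) x, P p x → P p (f • x))
    (hd : ∀ p c x, x ∈ formsP K ℓ p → P p x → P (p + 1) (dP c * x)) {p : ℕ} {η : ExtF K ℓ}
    (hη : η ∈ formsP K ℓ p) : P p η := by
  induction hη using Submodule.pow_induction_on_left' with
  | algebraMap r => exact hC r
  | add x y i hx hy hx' hy' => exact hadd i x y hx' hy'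
  | mem_mul m hm i x hx hx' =>
    obtain ⟨w, rfl⟩ := hm
    have h0 : P (i + 1) 0 := by
      simpa using hsmul _ 0 _ (hd i 0 x hx hx')
    rw [ι_eq_sum, Finset.sum_mul]
    refine Finset.sum_induction _ (P (i + 1)) (hadd _) h0 fun j _ => ?_
    rw [smul_mul_assoc]
    exact hsmul _ _ _ (hd _ _ _ hx hx')

end Induction

section Pullback
variable {n k l : ℕ}

/-- The pairing of a coefficient vector with a point. -/
def dot (c x : Fin n → K) : K := ∑ i, c i * x i

theorem dot_add (c x y : Fin n → K) : dot c (x + y) = dot c x + dot c y := by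
  simp [dot, mul_add, Finset.sum_add_distrib]

theorem dot_smul (c : Fin n → K) (t : K) (x : Fin n → K) : dot c (t • x) = t * dot c x := by
  simp [dot, Finset.mul_sum, mul_left_comm]

theorem dot_single (c : Fin n → K) (i : Fin n) : dot c (Pi.single i 1) = c i := by
  simp [dot, Pi.single_apply]

theorem single_dot (x : Fin n → K) (i : Fin n) : dot (Pi.single i 1) x = x i := by
  simp [dot, Pi.single_apply]

theorem smul_dot (c : Fin n → K) (t : K) (x : Fin n → K) : dot (t • c) x = t * dot c x := by
  simp [dot, Finset.mul_sum, mul_assoc]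

/-- The pull-back of a linear form along `e`, in coordinates. -/
def rstr (e : (Fin n → K) →ₗ[K] (Fin k → K)) (c : Fin k → K) : Fin n → K :=
  fun i => ∑ j, c j * e (Pi.single i 1) j

theorem dot_rstr (e : (Fin n → K) →ₗ[K] (Fin k → K)) (c : Fin k → K) (x : Fin n → K) :
    dot (rstr e c) x = dot c (e x) := by
  have hx : x = ∑ i, x i • Pi.single i (1 : K) := by
    ext i
    simp [Finset.sum_apply, Pi.single_apply]
  conv_rhs => rw [hx]
  simp only [dot, rstr, map_sum, map_smul, Finset.sum_apply, Pi.smul_apply, smul_eq_mul,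
    Finset.sum_mul, Finset.mul_sum]
  rw [Finset.sum_comm]
  refine Finset.sum_congr rfl fun j _ => Finset.sum_congr rfl fun i _ => by ring

theorem eq_of_dot {c c' : Fin n → K} (h : ∀ x, dot c x = dot c' x) : c = c' := by
  ext i
  rw [← dot_single c i, ← dot_single c' i, h]

theorem rstr_comp (e : (Fin n → K) →ₗ[K] (Fin k → K)) (f : (Fin l → K) →ₗ[K] (Fin n → K))
    (c : Fin k → K) : rstr f (rstr e c) = rstr (e ∘ₗ f) c :=
  eq_of_dot fun x => by simp [dot_rstr]

theorem rstr_smul (e : (Fin n → K) →ₗ[K] (Fin k → K)) (t : K) (c : Fin k → K) :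
    rstr e (t • c) = t • rstr e c := by
  ext i
  simp [rstr, mul_assoc, Finset.mul_sum]

/-- The pull-back of polynomials along `e`. -/
def pullP (e : (Fin n → K) →ₗ[K] (Fin k → K)) : PS K k →ₐ[K] PS K n :=
  aeval fun j => linP (rstr e (Pi.single j 1))

theorem pullP_linP (e : (Fin n → K) →ₗ[K] (Fin k → K)) (c : Fin k → K) :
    pullP e (linP c) = linP (rstr e c) := by
  simp only [pullP, linP, map_sum, map_mul, algHom_C, aeval_X, algebraMap_eq, Finset.mul_sum]
  rw [Finset.sum_comm]
  refine Finset.sum_congr rfl fun i _ => ?_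
  simp_rw [← mul_assoc, ← C_mul]
  rw [← Finset.sum_mul, ← map_sum]
  simp [rstr, Pi.single_apply]

theorem pullP_comp (e : (Fin n → K) →ₗ[K] (Fin k → K)) (f : (Fin l → K) →ₗ[K] (Fin n → K))
    (x : PS K k) : pullP f (pullP e x) = pullP (e ∘ₗ f) x := by
  have : (pullP f).comp (pullP e) = pullP (e ∘ₗ f) := by
    apply algHom_ext
    intro i
    rw [AlgHom.comp_apply, ← linP_single, pullP_linP, pullP_linP, pullP_linP, rstr_comp]
  exact congrArg (fun g => g x) this

theorem rstr_id (c : Fin n → K) : rstr LinearMap.id c = c := eq_of_dot fun x => by simp [dot_rstr]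

theorem pullP_id (x : PS K n) : pullP LinearMap.id x = x := by
  have : pullP LinearMap.id = AlgHom.id K (PS K n) := by
    apply algHom_ext
    intro i
    rw [AlgHom.id_apply, ← linP_single, pullP_linP, rstr_id]
  exact congrArg (fun g => g x) this

/-- The pull-back of one-forms along `e`. -/
def pullV (e : (Fin n → K) →ₗ[K] (Fin k → K)) :
    (Fin k → PS K k) →ₛₗ[(pullP e : PS K k →+* PS K n)] (Fin n → PS K n) where
  toFun x i := ∑ j, pullP e (x j) * C (e (Pi.single i 1) j)
  map_add' x y := by
    ext1 i
    simp [add_mul, Finset.sum_add_distrib]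
  map_smul' a x := by
    ext1 i
    simp [mul_assoc, Finset.mul_sum]

/-- The pull-back of differential forms along `e`. -/
def pullF (e : (Fin n → K) →ₗ[K] (Fin k → K)) : ExtF K k →+* ExtF K n :=
  extMap (pullP e : PS K k →+* PS K n) (pullV e)

theorem pullF_algebraMap (e : (Fin n → K) →ₗ[K] (Fin k → K)) (a : PS K k) :
    pullF e (algebraMap _ _ a) = algebraMap _ _ (pullP e a) := extMap_algebraMap _ _ _

theorem pullF_smul (e : (Fin n → K) →ₗ[K] (Fin k → K)) (a : PS K k) (η : ExtF K k) :
    pullF e (a • η) = pullP e a • pullF e η := extMap_smul _ _ _ _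

theorem pullF_dP (e : (Fin n → K) →ₗ[K] (Fin k → K)) (c : Fin k → K) :
    pullF e (dP c) = dP (rstr e c) := by
  rw [pullF, dP, extMap_ι, dP]
  congr 1
  ext1 i
  simp [pullV, rstr, algHom_C]

theorem pullF_comp (e : (Fin n → K) →ₗ[K] (Fin k → K)) (f : (Fin l → K) →ₗ[K] (Fin n → K))
    (x : ExtF K k) : pullF f (pullF e x) = pullF (e ∘ₗ f) x := by
  induction x using ExtF_induction with
  | hC f => simp only [pullF_algebraMap, pullP_comp]
  | hd c => simp only [pullF_dP, rstr_comp]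
  | hmul x y hx hy => simp only [map_mul, hx, hy]
  | hadd x y hx hy => simp only [map_add, hx, hy]

theorem pullF_id (x : ExtF K n) : pullF LinearMap.id x = x := by
  induction x using ExtF_induction with
  | hC f => simp only [pullF_algebraMap, pullP_id]
  | hd c => simp only [pullF_dP, rstr_id]
  | hmul x y hx hy => simp only [map_mul, hx, hy]
  | hadd x y hx hy => simp only [map_add, hx, hy]

theorem pullF_mem (e : (Fin n → K) →ₗ[K] (Fin k → K)) {p : ℕ} {η : ExtF K k}
    (hη : η ∈ formsP K k p) : pullF e η ∈ formsP K n p := by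
  refine formsP_induction (P := fun p η => pullF e η ∈ formsP K n p) ?_ ?_ ?_ ?_ hη
  · intro f
    rw [pullF_algebraMap, formsP, pow_zero]
    exact Submodule.algebraMap_mem _
  · intro p x y hx hy
    rw [map_add]; exact add_mem hx hy
  · intro p f x hx
    rw [pullF_smul]; exact Submodule.smul_mem _ _ hx
  · intro p c x _ hx
    rw [map_mul, pullF_dP]; exact dP_mul_mem _ hx

end Pullback

section Contraction

/-- Contraction with the constant vector field `v`. -/
def contr (v : Fin ℓ → K) : ExtF K ℓ →ₗ[PS K ℓ] ExtF K ℓ :=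
  CliffordAlgebra.contractLeft (Q := (0 : QuadraticForm (PS K ℓ) (Fin ℓ → PS K ℓ)))
    (∑ i, (C (v i) : PS K ℓ) • LinearMap.proj i)

theorem contr_dP_mul (v c : Fin ℓ → K) (η : ExtF K ℓ) :
    contr v (dP c * η) = (C (dot c v) : PS K ℓ) • η - dP c * contr v η := by
  refine (CliffordAlgebra.contractLeft_ι_mul _ _ _).trans ?_
  congr 2
  simp [dot, mul_comm]

theorem contr_algebraMap (v : Fin ℓ → K) (f : PS K ℓ) :
    contr v (algebraMap _ _ f) = 0 :=
  CliffordAlgebra.contractLeft_algebraMap _ _ _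

theorem contr_mem (v : Fin ℓ → K) {p : ℕ} {η : ExtF K ℓ}
    (hη : η ∈ formsP K ℓ p) : contr v η ∈ formsP K ℓ (p - 1) ∧ (p = 0 → contr v η = 0) := by
  refine formsP_induction
    (P := fun p η => contr v η ∈ formsP K ℓ (p - 1) ∧ (p = 0 → contr v η = 0)) ?_ ?_ ?_ ?_ hη
  · intro f
    rw [contr_algebraMap]; exact ⟨zero_mem _, fun _ => rfl⟩
  · intro p x y hx hy
    rw [map_add]; exact ⟨add_mem hx.1 hy.1, fun h => by rw [hx.2 h, hy.2 h, add_zero]⟩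
  · intro p f x hx
    rw [map_smul]; exact ⟨Submodule.smul_mem _ _ hx.1, fun h => by rw [hx.2 h, smul_zero]⟩
  · intro p c x hx hx'
    refine ⟨?_, fun h => absurd h (Nat.succ_ne_zero p)⟩
    rw [contr_dP_mul]
    refine sub_mem (Submodule.smul_mem _ _ hx) ?_
    rcases p with _ | p
    · rw [hx'.2 rfl, mul_zero]; exact zero_mem _
    · exact dP_mul_mem c hx'.1

end Contraction

section Residue
variable {n : ℕ}

/-- A splitting `K^ℓ = e(K^n) ⊕ K v` with `e(K^n)` the hyperplane defined by `c0`. -/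
structure IsSplit (c0 : Fin ℓ → K) (e : (Fin n → K) →ₗ[K] (Fin ℓ → K))
    (q : (Fin ℓ → K) →ₗ[K] (Fin n → K)) (v : Fin ℓ → K) : Prop where
  q_e : ∀ y, q (e y) = y
  dot_e : ∀ y, dot c0 (e y) = 0
  dot_v : dot c0 v = 1
  split : ∀ x, e (q x) + dot c0 x • v = x

theorem dotLin_apply (c x : Fin ℓ → K) : dotLin c x = dot c x := by
  simp [dotLin, dot, LinearMap.sum_apply]

theorem exists_isSplit {c0 : Fin ℓ → K} (hc0 : c0 ≠ 0)
    {e : (Fin (ℓ - 1) → K) →ₗ[K] (Fin ℓ → K)} (he : IsHypEmbedding c0 e) :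
    ∃ q v, IsSplit c0 e q v := by
  obtain ⟨i, hi⟩ := Function.ne_iff.1 hc0
  rw [Pi.zero_apply] at hi
  have hv : dot c0 ((c0 i)⁻¹ • Pi.single i 1) = 1 := by
    rw [dot_smul, dot_single, inv_mul_cancel₀ hi]
  have hker : ∀ x, dot c0 x = 0 ↔ ∃ y, e y = x := by
    intro x
    rw [← dotLin_apply, ← LinearMap.mem_ker, ← he.2, LinearMap.mem_range]
  obtain ⟨g, hg⟩ := e.exists_leftInverse_of_injective (LinearMap.ker_eq_bot.2 he.1)
  have hg' : ∀ y, g (e y) = y := fun y => congrArg (fun f => f y) hg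
  refine ⟨g ∘ₗ (LinearMap.id - (dotLin c0).smulRight ((c0 i)⁻¹ • Pi.single i 1)),
    (c0 i)⁻¹ • Pi.single i 1, ?_, fun y => (hker _).2 ⟨y, rfl⟩, hv, ?_⟩
  · intro y
    have : dotLin c0 (e y) = 0 := by rw [dotLin_apply]; exact (hker _).2 ⟨y, rfl⟩
    simp [this, hg']
  · intro x
    obtain ⟨y, hy⟩ := (hker (x - dot c0 x • (c0 i)⁻¹ • Pi.single i 1)).1 (by
      rw [sub_eq_add_neg, dot_add, ← neg_smul, dot_smul, hv]; ring)
    simp only [LinearMap.comp_apply, LinearMap.sub_apply, LinearMap.id_apply,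
      LinearMap.smulRight_apply, dotLin_apply]
    rw [← hy, hg', hy, sub_add_cancel]

variable {c0 v : Fin ℓ → K} {e : (Fin n → K) →ₗ[K] (Fin ℓ → K)}
  {q : (Fin ℓ → K) →ₗ[K] (Fin n → K)}

namespace IsSplit

theorem ne_zero (h : IsSplit c0 e q v) : c0 ≠ 0 := by
  rintro rfl
  have := h.dot_v
  simp [dot] at this

theorem rstr_self (h : IsSplit c0 e q v) : rstr e c0 = 0 :=
  eq_of_dot fun x => by rw [dot_rstr, h.dot_e]; simp [dot]

theorem rstr_rstr (h : IsSplit c0 e q v) (c : Fin n → K) : rstr e (rstr q c) = c :=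
  eq_of_dot fun x => by rw [dot_rstr, dot_rstr, h.q_e]

theorem sub_rstr (h : IsSplit c0 e q v) (c : Fin ℓ → K) :
    c = rstr q (rstr e c) + dot c v • c0 := by
  refine eq_of_dot fun x => ?_
  conv_lhs => rw [← h.split x, dot_add, dot_smul]
  have : ∀ a b x : Fin ℓ → K, dot (a + b) x = dot a x + dot b x := by
    intro a b x
    simp [dot, add_mul, Finset.sum_add_distrib]
  rw [this, smul_dot, dot_rstr, dot_rstr, mul_comm]

theorem pullP_self (h : IsSplit c0 e q v) : pullP e (linP c0) = 0 := by
  rw [pullP_linP, h.rstr_self]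
  simp [linP]

theorem pullF_self (h : IsSplit c0 e q v) : pullF e (dP c0) = 0 := by
  rw [pullF_dP, h.rstr_self]
  have := dP_smul (0 : K) (0 : Fin n → K)
  simpa using this

theorem pullP_pullP (h : IsSplit c0 e q v) (x : PS K n) : pullP e (pullP q x) = x := by
  rw [pullP_comp, show q ∘ₗ e = LinearMap.id from LinearMap.ext h.q_e, pullP_id]

theorem pullF_pullF (h : IsSplit c0 e q v) (x : ExtF K n) : pullF e (pullF q x) = x := by
  rw [pullF_comp, show q ∘ₗ e = LinearMap.id from LinearMap.ext h.q_e, pullF_id]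

theorem pullP_surjective (h : IsSplit c0 e q v) : Function.Surjective (pullP e) :=
  fun x => ⟨_, h.pullP_pullP x⟩

theorem dvd_sub (h : IsSplit c0 e q v) (f : PS K ℓ) :
    linP c0 ∣ f - pullP q (pullP e f) := by
  induction f using MvPolynomial.induction_on with
  | C a => simp [algHom_C]
  | add f g hf hg =>
    have : f + g - pullP q (pullP e (f + g)) =
        (f - pullP q (pullP e f)) + (g - pullP q (pullP e g)) := by
      rw [map_add, map_add]; ring
    rw [this]; exact dvd_add hf hg
  | mul_X f i hf =>
    have hX : (X i : PS K ℓ) = pullP q (pullP e (X i)) +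
        C (dot (Pi.single i 1) v) * linP c0 := by
      rw [← linP_single, pullP_linP, pullP_linP, ← linP_smul, ← linP_add, ← h.sub_rstr]
    have : f * X i - pullP q (pullP e (f * X i)) = (f - pullP q (pullP e f)) * X i +
        pullP q (pullP e f) * (X i - pullP q (pullP e (X i))) := by
      rw [map_mul, map_mul]; ring
    rw [this]
    refine dvd_add (hf.mul_right _) (Dvd.dvd.mul_left ?_ _)
    rw [sub_eq_of_eq_add' hX]
    exact dvd_mul_left _ _

theorem pullP_eq_zero_iff (h : IsSplit c0 e q v) (f : PS K ℓ) :
    pullP e f = 0 ↔ linP c0 ∣ f := by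
  constructor
  · intro hf
    simpa [hf] using h.dvd_sub f
  · rintro ⟨g, rfl⟩
    rw [map_mul, h.pullP_self, zero_mul]

theorem sdvd_dP_mul_sub (h : IsSplit c0 e q v) (η : ExtF K ℓ) :
    SDvd (linP c0) (dP c0 * (η - pullF q (pullF e η))) := by
  induction η using ExtF_induction with
  | hC f =>
    rw [pullF_algebraMap, pullF_algebraMap, ← map_sub, ← Algebra.commutes, ← Algebra.smul_def]
    exact sdvd_smul_of_dvd (h.dvd_sub f) _
  | hd c =>
    rw [pullF_dP, pullF_dP]
    have : dP c = dP (rstr q (rstr e c)) + (C (dot c v) : PS K ℓ) • dP c0 := by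
      rw [← dP_smul, ← dP_add, ← h.sub_rstr]
    rw [sub_eq_of_eq_add' this, mul_smul_comm, dP_mul_self, smul_zero]
    exact sdvd_zero _
  | hmul x y hx hy =>
    obtain ⟨z, hz⟩ := exists_dP_mul_eq_mul_dP c0 (pullF q (pullF e x))
    have : dP c0 * (x * y - pullF q (pullF e (x * y))) =
        dP c0 * (x - pullF q (pullF e x)) * y +
          z * (dP c0 * (y - pullF q (pullF e y))) := by
      rw [← mul_assoc z, ← hz, map_mul, map_mul]
      noncomm_ring
    rw [this]
    exact (hx.mul_right _).add (hy.mul_left _)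
  | hadd x y hx hy =>
    have : dP c0 * (x + y - pullF q (pullF e (x + y))) =
        dP c0 * (x - pullF q (pullF e x)) + dP c0 * (y - pullF q (pullF e y)) := by
      rw [map_add, map_add]
      noncomm_ring
    rw [this]
    exact hx.add hy

theorem eq_add_contr (h : IsSplit c0 e q v) (η : ExtF K ℓ) :
    η = dP c0 * contr v η + contr v (dP c0 * η) := by
  rw [contr_dP_mul, h.dot_v, C_1, one_smul, add_sub_cancel]

theorem pullF_smul_self (h : IsSplit c0 e q v) (η : ExtF K ℓ) :
    pullF e (linP c0 • η) = 0 := by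
  rw [pullF_smul, h.pullP_self, zero_smul]

theorem pullF_eq_zero_iff (h : IsSplit c0 e q v) (η : ExtF K ℓ) :
    pullF e η = 0 ↔ SDvd (linP c0) (dP c0 * η) := by
  constructor
  · intro hη
    simpa [hη] using h.sdvd_dP_mul_sub η
  · rintro ⟨ξ, hξ⟩
    rw [h.eq_add_contr η, hξ, map_smul, map_add, map_mul, h.pullF_self, zero_mul, zero_add,
      h.pullF_smul_self]

end IsSplit

/-- The residue along the hyperplane parametrized by `e`. -/
def res (e : (Fin n → K) →ₗ[K] (Fin ℓ → K)) (v : Fin ℓ → K) : ExtF K ℓ →+ ExtF K n :=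
  (pullF e : ExtF K ℓ →+ ExtF K n).comp (contr v).toAddMonoidHom

theorem res_apply (η : ExtF K ℓ) : res e v η = pullF e (contr v η) := rfl

theorem res_smul (f : PS K ℓ) (η : ExtF K ℓ) : res e v (f • η) = pullP e f • res e v η := by
  rw [res_apply, map_smul, pullF_smul, res_apply]

theorem res_mem {p : ℕ} {η : ExtF K ℓ} (hη : η ∈ formsP K ℓ (p + 1)) :
    res e v η ∈ formsP K n p :=
  pullF_mem e (contr_mem v hη).1

namespace IsSplit

theorem res_dP_mul (h : IsSplit c0 e q v) (η : ExtF K ℓ) :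
    res e v (dP c0 * η) = pullF e η := by
  rw [res_apply, contr_dP_mul, h.dot_v, C_1, one_smul, map_sub, map_mul, h.pullF_self, zero_mul,
    sub_zero]

theorem res_smul_self (h : IsSplit c0 e q v) (η : ExtF K ℓ) :
    res e v (linP c0 • η) = 0 := by
  rw [res_smul, h.pullP_self, zero_smul]

theorem sdvd_of_res_eq_zero (h : IsSplit c0 e q v) {η : ExtF K ℓ}
    (hη : SDvd (linP c0) (dP c0 * η)) (hr : res e v η = 0) : SDvd (linP c0) η := by
  obtain ⟨ξ, hξ⟩ := hη
  rw [h.eq_add_contr η, hξ, map_smul]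
  exact ((h.pullF_eq_zero_iff _).1 hr).add (sdvd_smul_self _ _)

end IsSplit

end Residue

section Wedge

/-- If `η` and `ξ` are logarithmic along the same form, then their product is divisible. -/
theorem SDvd.wedge {c : Fin ℓ → K} (hc : c ≠ 0) {f g : PS K ℓ} (hgf : g ∣ f) {η ξ : ExtF K ℓ}
    (hη : SDvd f (dP c * η)) (hξ : SDvd g (dP c * ξ)) : SDvd g (η * ξ) := by
  obtain ⟨i, hi⟩ := Function.ne_iff.1 hc
  rw [Pi.zero_apply] at hi
  let v : Fin ℓ → K := (c i)⁻¹ • Pi.single i 1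
  have hv : dot c v = 1 := by rw [dot_smul, dot_single, inv_mul_cancel₀ hi]
  have key : ∀ x : ExtF K ℓ, x = dP c * contr v x + contr v (dP c * x) := by
    intro x
    rw [contr_dP_mul, hv, C_1, one_smul, add_sub_cancel]
  obtain ⟨a, ha⟩ := hη.of_dvd hgf
  obtain ⟨z, hz⟩ := exists_dP_mul_eq_mul_dP c (contr v η)
  have : η * ξ = z * (dP c * ξ) + g • (contr v a * ξ) := by
    conv_lhs => rw [key η, ha, map_smul, hz, add_mul, mul_assoc, smul_mul_assoc]
  rw [this]
  exact (hξ.mul_left _).add (sdvd_smul_self _ _)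

theorem sdvd_Qpoly {A : Arrangement K ℓ} {m : (Fin ℓ → K) → ℕ} {η : ExtF K ℓ}
    (h : ∀ c ∈ A.hyps, SDvd (linP c ^ m c) η) : SDvd (Qpoly A m) η :=
  sdvd_prod (pairwise_isRelPrime_hyps A m) h

theorem linP_pow_dvd_Qpoly {A : Arrangement K ℓ} {c : Fin ℓ → K} (hc : c ∈ A.hyps)
    (m : (Fin ℓ → K) → ℕ) : linP c ^ m c ∣ Qpoly A m :=
  Finset.dvd_prod_of_mem _ hc

/-- The product of logarithmic forms is, up to the factor `Q`, logarithmic. -/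
theorem Omega_mul {A : Arrangement K ℓ} {m : (Fin ℓ → K) → ℕ} {p r : ℕ} {η ξ : ExtF K ℓ}
    (hη : η ∈ Omega A m p) (hξ : ξ ∈ Omega A m r) :
    ∃ ζ ∈ Omega A m (p + r), η * ξ = Qpoly A m • ζ := by
  rw [mem_Omega] at hη hξ
  obtain ⟨ζ, hζ⟩ := sdvd_Qpoly (A := A) (m := m) (η := η * ξ) fun c hc =>
    (hη.2 c hc).wedge (A.ne_zero c hc) dvd_rfl (hξ.2 c hc)
  refine ⟨ζ, mem_Omega.2 ⟨mem_formsP_of_smul (Qpoly_ne_zero A m)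
    (hζ ▸ formsP_mul hη.1 hξ.1), fun c hc => ?_⟩, hζ⟩
  obtain ⟨z, hz⟩ := exists_dP_mul_eq_mul_dP c η
  have h1 : SDvd (linP c ^ m c * linP c ^ m c) (Qpoly A m • (dP c * ζ)) := by
    rw [← mul_smul_comm, ← hζ]
    obtain ⟨a, ha⟩ := hη.2 c hc
    rw [← mul_assoc, ha, smul_mul_assoc]
    refine SDvd.smul_smul ?_
    have h2 : SDvd (linP c ^ m c) (dP c * a) := by
      have h0 : dP c * a = 0 := by
        have : linP c ^ m c • (dP c * a) = linP c ^ m c • (0 : ExtF K ℓ) := by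
          rw [← mul_smul_comm, ← ha, ← mul_assoc, dP_mul_self, zero_mul, smul_zero]
        exact smul_left_cancel (pow_ne_zero _ (linP_ne_zero (A.ne_zero c hc))) this
      rw [h0]; exact sdvd_zero _
    exact h2.wedge (A.ne_zero c hc) dvd_rfl (hξ.2 c hc)
  rw [Qpoly, ← Finset.mul_prod_erase _ _ hc, mul_smul] at h1
  refine SDvd.of_smul ?_ (sdvd_of_smul_smul (pow_ne_zero _ (linP_ne_zero (A.ne_zero c hc))) h1)
  refine IsRelPrime.prod_right fun c' hc' => ?_
  exact pairwise_isRelPrime_hyps A m hc (Finset.mem_of_mem_erase hc')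
    (Finset.ne_of_mem_erase hc').symm

end Wedge

section TopForm

/-- The standard basis of the module of differential forms. -/
def extBasis (K : Type) [Field K] (ℓ : ℕ) : Module.Basis (Finset (Fin ℓ)) (PS K ℓ) (ExtF K ℓ) :=
  (Pi.basisFun (PS K ℓ) (Fin ℓ)).ExteriorAlgebra

/-- The coefficient of a form at `dx_1 ∧ ⋯ ∧ dx_ℓ`. -/
def top (K : Type) [Field K] (ℓ : ℕ) : ExtF K ℓ →ₗ[PS K ℓ] PS K ℓ :=
  (extBasis K ℓ).coord Finset.univ

theorem extBasis_mem (s : Finset (Fin ℓ)) : extBasis K ℓ s ∈ formsP K ℓ s.card := by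
  rw [extBasis, ExteriorAlgebra.basis_apply]
  exact ExteriorAlgebra.ιMulti_range (PS K ℓ) s.card ⟨_, rfl⟩

theorem top_extBasis (s : Finset (Fin ℓ)) :
    top K ℓ (extBasis K ℓ s) = if s = Finset.univ then 1 else 0 := by
  rw [top, Module.Basis.coord_apply, Module.Basis.repr_self, Finsupp.single_apply]

theorem top_eq_zero {r : ℕ} (hr : r ≠ ℓ) {η : ExtF K ℓ} (hη : η ∈ formsP K ℓ r) :
    top K ℓ η = 0 := by
  let 𝒜 : ℕ → Submodule (PS K ℓ) (ExtF K ℓ) := formsP K ℓ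
  let _ : GradedAlgebra 𝒜 := ExteriorAlgebra.gradedAlgebra (PS K ℓ) (Fin ℓ → PS K ℓ)
  have h1 : (DirectSum.decompose 𝒜 η ℓ : ExtF K ℓ) = 0 :=
    DirectSum.decompose_of_mem_ne 𝒜 hη hr
  have h2 : ∀ s : Finset (Fin ℓ), (DirectSum.decompose 𝒜 (extBasis K ℓ s) ℓ : ExtF K ℓ) =
      if s = Finset.univ then extBasis K ℓ s else 0 := by
    intro s
    split_ifs with hs
    · refine DirectSum.decompose_of_mem_same 𝒜 ?_
      have := extBasis_mem (K := K) s
      rwa [hs, Finset.card_univ, Fintype.card_fin, ← hs] at this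
    · refine DirectSum.decompose_of_mem_ne 𝒜 (extBasis_mem s) fun h => hs ?_
      exact Finset.eq_univ_of_card s (by rw [h, Fintype.card_fin])
  have h3 : top K ℓ η • extBasis K ℓ Finset.univ = 0 := by
    rw [← h1]
    conv_rhs => rw [← (extBasis K ℓ).sum_repr η]
    rw [DirectSum.decompose_sum, DFinsupp.finsetSum_apply, AddSubmonoidClass.coe_finsetSum]
    simp_rw [DirectSum.decompose_smul, DirectSum.smul_apply, Submodule.coe_smul, h2]
    simp [top]
  have h4 := congrArg (top K ℓ) h3
  rwa [map_smul, map_zero, top_extBasis, if_pos rfl, smul_eq_mul, mul_one] at h4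

theorem map_mem (T : (Fin ℓ → PS K ℓ) →ₗ[PS K ℓ] (Fin ℓ → PS K ℓ)) {p : ℕ} {η : ExtF K ℓ}
    (hη : η ∈ formsP K ℓ p) : ExteriorAlgebra.map T η ∈ formsP K ℓ p := by
  refine formsP_induction (P := fun p η => ExteriorAlgebra.map T η ∈ formsP K ℓ p) ?_ ?_ ?_ ?_ hη
  · intro f
    rw [AlgHom.commutes, formsP, pow_zero]
    exact Submodule.algebraMap_mem _
  · intro p x y hx hy
    rw [map_add]; exact add_mem hx hy
  · intro p f x hx
    rw [map_smul]; exact Submodule.smul_mem _ _ hx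
  · intro p c x _ hx
    rw [map_mul, dP, ExteriorAlgebra.map_apply_ι, add_comm]
    refine formsP_mul ?_ hx
    rw [formsP, pow_one]; exact ⟨_, rfl⟩

theorem top_map (T : (Fin ℓ → PS K ℓ) →ₗ[PS K ℓ] (Fin ℓ → PS K ℓ)) (η : ExtF K ℓ) :
    top K ℓ (ExteriorAlgebra.map T η) = LinearMap.det T * top K ℓ η := by
  have key : (top K ℓ).comp (ExteriorAlgebra.map T).toLinearMap =
      LinearMap.det T • top K ℓ := by
    refine (extBasis K ℓ).ext fun s => ?_
    rw [LinearMap.comp_apply, AlgHom.toLinearMap_apply, LinearMap.smul_apply]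
    by_cases hs : s.card = ℓ
    · rw [extBasis, ExteriorAlgebra.basis_apply_ofCard _ hs]
      generalize Set.powersetCard.ofCard hs = t
      have h := ((top K ℓ).compAlternatingMap
        (ExteriorAlgebra.ιMulti (PS K ℓ) ℓ)).eq_smul_basis_det (Pi.basisFun (PS K ℓ) (Fin ℓ))
      have h' := fun u => congrArg (fun f => f u) h
      simp only [LinearMap.compAlternatingMap_apply, AlternatingMap.smul_apply] at h'
      have hu : ExteriorAlgebra.ιMulti_family (PS K ℓ) ℓ (Pi.basisFun (PS K ℓ) (Fin ℓ)) t =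
          ExteriorAlgebra.ιMulti (PS K ℓ) ℓ
            (Pi.basisFun (PS K ℓ) (Fin ℓ) ∘ Set.powersetCard.ofFinEmbEquiv.symm t) := rfl
      rw [hu, ExteriorAlgebra.map_apply_ιMulti, h' (T ∘ _), h' (_ ∘ _), Module.Basis.det_comp]
      simp only [smul_eq_mul]
      ring
    · rw [top_eq_zero hs (map_mem T (extBasis_mem s)), top_eq_zero hs (extBasis_mem s), smul_zero]
  exact congrArg (fun f => f η) key

theorem extBasis_mul (s t : Finset (Fin ℓ)) (h : Disjoint s t) :
    ∃ ε : ℤˣ, extBasis K ℓ s * extBasis K ℓ t = ε • extBasis K ℓ (s ∪ t) := by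
  have := ExteriorAlgebra.basis_mul_of_disjoint (Pi.basisFun (PS K ℓ) (Fin ℓ))
    (⟨s, rfl⟩ : Set.powersetCard (Fin ℓ) s.card) (⟨t, rfl⟩ : Set.powersetCard (Fin ℓ) t.card) h
  rw [Set.powersetCard.coe_disjUnion, Finset.disjUnion_eq_union] at this
  exact ⟨_, this⟩

theorem extBasis_mul_of_not_disjoint (s t : Finset (Fin ℓ)) (h : ¬ Disjoint s t) :
    extBasis K ℓ s * extBasis K ℓ t = 0 :=
  ExteriorAlgebra.basis_mul_of_not_disjoint (Pi.basisFun (PS K ℓ) (Fin ℓ))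
    (⟨s, rfl⟩ : Set.powersetCard (Fin ℓ) s.card) (⟨t, rfl⟩ : Set.powersetCard (Fin ℓ) t.card) h

theorem exists_sign (s : Finset (Fin ℓ)) :
    ∃ ε : PS K ℓ, ε * ε = 1 ∧ ∀ t, top K ℓ (extBasis K ℓ t * extBasis K ℓ sᶜ) =
      if t = s then ε else 0 := by
  obtain ⟨ε, hε⟩ := extBasis_mul (K := K) s sᶜ disjoint_compl_right
  have htop : ∀ (u : ℤˣ) (x : ExtF K ℓ), top K ℓ (u • x) = ((u : ℤ) : PS K ℓ) * top K ℓ x := by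
    intro u x
    rw [Units.smul_def, map_zsmul, zsmul_eq_mul]
  refine ⟨((ε : ℤ) : PS K ℓ), ?_, fun t => ?_⟩
  · rw [← Int.cast_mul, ← Units.val_mul, Int.units_mul_self]; simp
  · split_ifs with h
    · subst h
      rw [hε, htop, Finset.union_compl, top_extBasis, if_pos rfl, mul_one]
    · by_cases hd : Disjoint t sᶜ
      · obtain ⟨ε', hε'⟩ := extBasis_mul (K := K) t sᶜ hd
        have hts : t ⊆ s := by
          intro i hi
          by_contra hi'
          exact Finset.disjoint_left.mp hd hi (Finset.mem_compl.mpr hi')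
        obtain ⟨i, hi, hi'⟩ := Finset.exists_of_ssubset (hts.ssubset_of_ne h)
        rw [hε', htop, top_extBasis, if_neg, mul_zero]
        intro hu
        have := hu ▸ Finset.mem_univ i
        simp [hi, hi'] at this
      · rw [extBasis_mul_of_not_disjoint _ _ hd, map_zero]

/-- The sign of the product of complementary basis forms. -/
def sgn (K : Type) [Field K] {ℓ : ℕ} (s : Finset (Fin ℓ)) : PS K ℓ :=
  (exists_sign (K := K) s).choose

theorem eq_sum_top (η : ExtF K ℓ) : η =
    ∑ s : Finset (Fin ℓ), (sgn K s * top K ℓ (η * extBasis K ℓ sᶜ)) • extBasis K ℓ s := by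
  conv_lhs => rw [← (extBasis K ℓ).sum_repr η]
  refine Finset.sum_congr rfl fun s _ => ?_
  obtain ⟨h1, h2⟩ := (exists_sign (K := K) s).choose_spec
  have h3 : top K ℓ (η * extBasis K ℓ sᶜ) = (extBasis K ℓ).repr η s * sgn K s := by
    conv_lhs => rw [← (extBasis K ℓ).sum_repr η, Finset.sum_mul, map_sum]
    rw [Finset.sum_eq_single s, smul_mul_assoc, map_smul, h2, if_pos rfl, smul_eq_mul, sgn]
    · intro t _ hts
      rw [smul_mul_assoc, map_smul, h2, if_neg hts, smul_zero]
    · exact fun h => absurd (Finset.mem_univ s) h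
  rw [h3, mul_left_comm]
  conv_rhs => rw [sgn, h1, mul_one]

theorem exists_adjugate (T : (Fin ℓ → PS K ℓ) →ₗ[PS K ℓ] (Fin ℓ → PS K ℓ)) :
    ∃ T' : (Fin ℓ → PS K ℓ) →ₗ[PS K ℓ] (Fin ℓ → PS K ℓ), ∀ x, T (T' x) = LinearMap.det T • x := by
  refine ⟨Matrix.toLin' (LinearMap.toMatrix' T).adjugate, fun x => ?_⟩
  have : T = Matrix.toLin' (LinearMap.toMatrix' T) := (Matrix.toLin'_toMatrix' T).symm
  conv_lhs => rw [this]
  rw [← LinearMap.comp_apply, ← Matrix.toLin'_mul, LinearMap.toMatrix'_toLin',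
    Matrix.mul_adjugate, LinearMap.det_toMatrix']
  simp

theorem exists_pow_det_smul_mem_range (T : (Fin ℓ → PS K ℓ) →ₗ[PS K ℓ] (Fin ℓ → PS K ℓ))
    (η : ExtF K ℓ) : ∃ (N : ℕ) (x : ExtF K ℓ),
    LinearMap.det T ^ N • η = ExteriorAlgebra.map T x := by
  induction η using ExtF_induction with
  | hC f => exact ⟨0, algebraMap _ _ f, by rw [AlgHom.commutes, pow_zero, one_smul]⟩
  | hd c =>
    obtain ⟨T', hT'⟩ := exists_adjugate T
    exact ⟨1, ExteriorAlgebra.ι _ (T' fun i => C (c i)),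
      by rw [ExteriorAlgebra.map_apply_ι, hT', map_smul, pow_one, dP]⟩
  | hmul x y hx hy =>
    obtain ⟨N, x', hx⟩ := hx
    obtain ⟨N', y', hy⟩ := hy
    exact ⟨N + N', x' * y', by rw [map_mul, ← hx, ← hy, smul_mul_smul_comm, pow_add]⟩
  | hadd x y hx hy =>
    obtain ⟨N, x', hx⟩ := hx
    obtain ⟨N', y', hy⟩ := hy
    refine ⟨N + N', LinearMap.det T ^ N' • x' + LinearMap.det T ^ N • y', ?_⟩
    rw [map_add, map_smul, map_smul, ← hx, ← hy, ← mul_smul, ← mul_smul, ← pow_add, ← pow_add,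
      add_comm N' N, smul_add]

/-- Cramer's rule in all exterior degrees. -/
theorem det_smul_eq_sum {T : (Fin ℓ → PS K ℓ) →ₗ[PS K ℓ] (Fin ℓ → PS K ℓ)}
    (hT : LinearMap.det T ≠ 0) (η : ExtF K ℓ) : LinearMap.det T • η =
      ∑ s : Finset (Fin ℓ), (sgn K s * top K ℓ (η * ExteriorAlgebra.map T (extBasis K ℓ sᶜ))) •
        ExteriorAlgebra.map T (extBasis K ℓ s) := by
  obtain ⟨N, x, hx⟩ := exists_pow_det_smul_mem_range T η
  refine smul_left_cancel (pow_ne_zero N hT) ?_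
  rw [smul_comm, hx, Finset.smul_sum]
  conv_lhs => rw [eq_sum_top x, map_sum, Finset.smul_sum]
  refine Finset.sum_congr rfl fun s _ => ?_
  rw [map_smul, ← mul_smul, ← mul_smul]
  congr 1
  rw [mul_left_comm, ← top_map, map_mul, ← hx, smul_mul_assoc, map_smul, smul_eq_mul]
  ring

end TopForm

section Saito

variable {A : Arrangement K ℓ} {m : (Fin ℓ → K) → ℕ}
  {T : (Fin ℓ → PS K ℓ) →ₗ[PS K ℓ] (Fin ℓ → PS K ℓ)}

theorem eq_algebraMap_of_mem_formsP_zero {η : ExtF K ℓ} (hη : η ∈ formsP K ℓ 0) :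
    ∃ f : PS K ℓ, η = algebraMap _ _ f := by
  rw [formsP, pow_zero, Submodule.mem_one] at hη
  obtain ⟨f, hf⟩ := hη
  exact ⟨f, hf.symm⟩

theorem smul_dP_mem_Omega {f : PS K ℓ} {c : Fin ℓ → K}
    (h : ∀ c' ∈ A.hyps, c' ≠ c → linP c' ^ m c' ∣ f) : f • dP c ∈ Omega A m 1 := by
  refine mem_Omega.2 ⟨Submodule.smul_mem _ _ (dP_mem c), fun c' hc' => ?_⟩
  rw [mul_smul_comm]
  by_cases hcc : c' = c
  · rw [hcc, dP_mul_self, smul_zero]; exact sdvd_zero _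
  · exact sdvd_smul_of_dvd (h c' hc' hcc) _

theorem map_eq_smul (hT : ∀ x, ExteriorAlgebra.ι (PS K ℓ) (T x) ∈ Omega A m 1) {p : ℕ}
    {η : ExtF K ℓ} (hη : η ∈ formsP K ℓ (p + 1)) :
    ∃ ζ ∈ Omega A m (p + 1), ExteriorAlgebra.map T η = Qpoly A m ^ p • ζ := by
  refine formsP_induction (P := fun r η => ∀ p, r = p + 1 → ∃ ζ ∈ Omega A m (p + 1),
    ExteriorAlgebra.map T η = Qpoly A m ^ p • ζ) (fun f p hp => by omega) ?_ ?_ ?_ hη p rfl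
  · intro r x y hx hy p hp
    obtain ⟨ζ, hζ, h⟩ := hx p hp
    obtain ⟨ζ', hζ', h'⟩ := hy p hp
    exact ⟨ζ + ζ', add_mem hζ hζ', by rw [map_add, h, h', smul_add]⟩
  · intro r f x hx p hp
    obtain ⟨ζ, hζ, h⟩ := hx p hp
    exact ⟨f • ζ, Submodule.smul_mem _ _ hζ, by rw [map_smul, h, smul_comm]⟩
  · intro r c x hx hr p hp
    obtain rfl : r = p := by omega
    have hc : ExteriorAlgebra.map T (dP c) ∈ Omega A m 1 := by
      rw [dP, ExteriorAlgebra.map_apply_ι]; exact hT _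
    cases r with
    | zero =>
      obtain ⟨f, rfl⟩ := eq_algebraMap_of_mem_formsP_zero hx
      refine ⟨f • ExteriorAlgebra.map T (dP c), Submodule.smul_mem _ _ hc, ?_⟩
      rw [map_mul, AlgHom.commutes, ← Algebra.commutes, ← Algebra.smul_def, pow_zero, one_smul]
    | succ r =>
      obtain ⟨ζ, hζ, h⟩ := hr r rfl
      obtain ⟨ζ', hζ', h'⟩ := Omega_mul hc hζ
      rw [add_comm] at hζ'
      exact ⟨ζ', hζ', by rw [map_mul, h, mul_smul_comm, h', ← mul_smul, pow_succ]⟩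

theorem det_dvd_of_range (hT : ∀ x, ExteriorAlgebra.ι (PS K ℓ) x ∈ Omega A m 1 →
    x ∈ LinearMap.range T) {F : (Fin ℓ → PS K ℓ) →ₗ[PS K ℓ] (Fin ℓ → PS K ℓ)}
    (hF : ∀ i, ExteriorAlgebra.ι (PS K ℓ) (F (Pi.single i 1)) ∈ Omega A m 1) :
    LinearMap.det T ∣ LinearMap.det F := by
  choose g hg using fun i => hT _ (hF i)
  have : F = T ∘ₗ (Pi.basisFun (PS K ℓ) (Fin ℓ)).constr (PS K ℓ) g := by
    refine (Pi.basisFun (PS K ℓ) (Fin ℓ)).ext fun i => ?_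
    rw [LinearMap.comp_apply, Module.Basis.constr_basis, hg, Pi.basisFun_apply]
  rw [this, LinearMap.det_comp]
  exact dvd_mul_right _ _

theorem ι_Qpoly_smul_mem (x : Fin ℓ → PS K ℓ) :
    ExteriorAlgebra.ι (PS K ℓ) (Qpoly A m • x) ∈ Omega A m 1 := by
  rw [map_smul, ι_eq_sum, Finset.smul_sum]
  refine Submodule.sum_mem _ fun j _ => ?_
  rw [smul_comm]
  exact Submodule.smul_mem _ _ (smul_dP_mem_Omega fun c hc _ => linP_pow_dvd_Qpoly hc m)

theorem det_dvd_Qpoly_pow (hT : ∀ x, ExteriorAlgebra.ι (PS K ℓ) x ∈ Omega A m 1 →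
    x ∈ LinearMap.range T) : LinearMap.det T ∣ Qpoly A m ^ ℓ := by
  have := det_dvd_of_range hT (F := Qpoly A m • LinearMap.id) fun i => by
    exact ι_Qpoly_smul_mem _
  rwa [LinearMap.det_smul, LinearMap.det_id, mul_one, Module.finrank_fin_fun] at this

theorem det_dvd_Qpoly_erase (hT : ∀ x, ExteriorAlgebra.ι (PS K ℓ) x ∈ Omega A m 1 →
    x ∈ LinearMap.range T) {c : Fin ℓ → K} (hc : c ∈ A.hyps) :
    LinearMap.det T ∣ Qpoly A m ^ (ℓ - 1) * ∏ c' ∈ A.hyps.erase c, linP c' ^ m c' := by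
  obtain ⟨i, hi⟩ := Function.ne_iff.1 (A.ne_zero c hc)
  rw [Pi.zero_apply] at hi
  set Qc := ∏ c' ∈ A.hyps.erase c, linP c' ^ m c' with hQc
  let a : Fin ℓ → PS K ℓ := fun j => if j = i then Qc else Qpoly A m
  let N : Matrix (Fin ℓ) (Fin ℓ) (PS K ℓ) :=
    (1 : Matrix (Fin ℓ) (Fin ℓ) (PS K ℓ)).updateCol i (fun j => C (c j)) * Matrix.diagonal a
  have hN : LinearMap.det (Matrix.toLin' N) = C (c i) * (Qpoly A m ^ (ℓ - 1) * Qc) := by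
    rw [LinearMap.det_toLin', Matrix.det_mul, Matrix.det_diagonal, ← Matrix.cramer_apply,
      Matrix.cramer_one, ← Finset.mul_prod_erase _ _ (Finset.mem_univ i), Module.End.one_apply]
    have h1 : ∏ j ∈ Finset.univ.erase i, a j = Qpoly A m ^ (ℓ - 1) := by
      rw [Finset.prod_congr rfl fun j hj => if_neg (Finset.ne_of_mem_erase hj),
        Finset.prod_const, Finset.card_erase_of_mem (Finset.mem_univ i), Finset.card_univ,
        Fintype.card_fin]
    rw [h1]
    simp only [a, if_true]
    ring
  have hd := det_dvd_of_range hT (F := Matrix.toLin' N) fun j => by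
    have hcol : Matrix.toLin' N (Pi.single j 1) = a j •
        fun k => (1 : Matrix (Fin ℓ) (Fin ℓ) (PS K ℓ)).updateCol i (fun j => C (c j)) k j := by
      ext1 k
      simp [N, mul_comm]
    rw [hcol, map_smul]
    by_cases hj : j = i
    · have : (fun k => (1 : Matrix (Fin ℓ) (Fin ℓ) (PS K ℓ)).updateCol i
          (fun j => C (c j)) k j) = fun k => C (c k) := by
        ext1 k; rw [hj, Matrix.updateCol_self]
      rw [this]
      refine smul_dP_mem_Omega fun c' hc' hcc => ?_
      simp only [a, if_pos hj]
      exact Finset.dvd_prod_of_mem (fun c' => linP c' ^ m c') (Finset.mem_erase.2 ⟨hcc, hc'⟩)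
    · simp only [a, if_neg hj]
      rw [← map_smul]
      exact ι_Qpoly_smul_mem _
  rw [hN] at hd
  have hu : IsUnit (C (c i) : PS K ℓ) := (isUnit_iff_ne_zero.2 hi).map C
  exact (hu.dvd_mul_left).1 hd

/-- Saito's criterion for the polynomial model of the logarithmic one-forms. -/
theorem exists_isUnit_det (hℓ : 1 ≤ ℓ) (hT : ∀ x, ExteriorAlgebra.ι (PS K ℓ) x ∈ Omega A m 1 ↔
    x ∈ LinearMap.range T) : ∃ u, IsUnit u ∧ LinearMap.det T = Qpoly A m ^ (ℓ - 1) * u := by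
  have hQ := Qpoly_ne_zero A m
  obtain ⟨p, rfl⟩ := Nat.exists_eq_add_of_le' hℓ
  simp only [Nat.add_sub_cancel]
  have htop : extBasis K (p + 1) Finset.univ ∈ formsP K (p + 1) (p + 1) := by
    simpa using extBasis_mem (K := K) (Finset.univ : Finset (Fin (p + 1)))
  obtain ⟨ζ, -, hζ⟩ := map_eq_smul (fun x => (hT _).2 ⟨x, rfl⟩) htop
  have hdet := top_map T (extBasis K (p + 1) Finset.univ)
  rw [top_extBasis, if_pos rfl, mul_one, hζ, map_smul, smul_eq_mul] at hdet
  refine ⟨top K _ ζ, ?_, hdet.symm⟩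
  have h1 : top K _ ζ ∣ Qpoly A m := by
    have := det_dvd_Qpoly_pow fun x => (hT x).1
    rwa [← hdet, pow_succ, mul_dvd_mul_iff_left (pow_ne_zero _ hQ)] at this
  have h2 : ∀ c ∈ A.hyps, top K _ ζ ∣ ∏ c' ∈ A.hyps.erase c, linP c' ^ m c' := by
    intro c hc
    have := det_dvd_Qpoly_erase (fun x => (hT x).1) hc
    rwa [← hdet, Nat.add_sub_cancel, mul_dvd_mul_iff_left (pow_ne_zero _ hQ)] at this
  have hrel : IsRelPrime (top K _ ζ) (Qpoly A m) := by
    refine IsRelPrime.prod_right fun c hc => ?_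
    refine IsRelPrime.of_dvd_left ?_ (h2 c hc)
    refine IsRelPrime.prod_left fun c' hc' => ?_
    exact pairwise_isRelPrime_hyps A m (Finset.mem_of_mem_erase hc') hc
      (Finset.ne_of_mem_erase hc')
  exact hrel dvd_rfl h1

theorem finrank_of_smul_mem {W : Submodule (PS K ℓ) (Fin ℓ → PS K ℓ)} {f : PS K ℓ} (hf : f ≠ 0)
    (hmem : ∀ x : Fin ℓ → PS K ℓ, f • x ∈ W) : Module.finrank (PS K ℓ) W = ℓ := by
  have h0 : Module.finrank (PS K ℓ) (Fin ℓ → PS K ℓ) = ℓ := Module.finrank_fin_fun _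
  refine le_antisymm ?_ ?_
  · exact (LinearMap.finrank_le_finrank_of_injective W.injective_subtype).trans h0.le
  · let g : (Fin ℓ → PS K ℓ) →ₗ[PS K ℓ] W := (LinearMap.lsmul _ _ f).codRestrict W hmem
    have hg : Function.Injective g := fun x y hxy =>
      smul_left_cancel hf (congrArg Subtype.val hxy :)
    exact h0.ge.trans (LinearMap.finrank_le_finrank_of_injective hg)

theorem map_comap_Omega_one :
    ((Omega A m 1).comap (ExteriorAlgebra.ι (PS K ℓ))).map (ExteriorAlgebra.ι (PS K ℓ)) =
      Omega A m 1 := by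
  rw [Submodule.map_comap_eq, inf_eq_right]
  exact fun η hη => by simpa [formsP] using (mem_Omega.1 hη).1

theorem exists_range_eq_of_finrank {W : Submodule (PS K ℓ) (Fin ℓ → PS K ℓ)}
    [Module.Free (PS K ℓ) W] (h : Module.finrank (PS K ℓ) W = ℓ) :
    ∃ T : (Fin ℓ → PS K ℓ) →ₗ[PS K ℓ] (Fin ℓ → PS K ℓ), LinearMap.range T = W := by
  let b : Module.Basis (Fin ℓ) (PS K ℓ) W := Module.finBasisOfFinrankEq _ _ h
  refine ⟨W.subtype ∘ₗ (b.equivFun.symm : (Fin ℓ → PS K ℓ) →ₗ[PS K ℓ] W), ?_⟩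
  rw [LinearMap.range_comp, LinearEquiv.range, Submodule.map_top, Submodule.range_subtype]

/-- A free module of logarithmic one-forms is parametrized by an endomorphism of `S^ℓ`. -/
theorem exists_range_eq (h : FreeM A m) :
    ∃ T : (Fin ℓ → PS K ℓ) →ₗ[PS K ℓ] (Fin ℓ → PS K ℓ),
      (∀ x, ExteriorAlgebra.ι (PS K ℓ) x ∈ Omega A m 1 ↔ x ∈ LinearMap.range T) ∧
      LinearMap.det T ≠ 0 := by
  have hι : Function.Injective (ExteriorAlgebra.ι (PS K ℓ) (M := Fin ℓ → PS K ℓ)) :=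
    ExteriorAlgebra.ι_leftInverse.injective
  have hfree : Module.Free (PS K ℓ) (Omega A m 1) := h
  have hWfree : Module.Free (PS K ℓ) ((Omega A m 1).comap (ExteriorAlgebra.ι (PS K ℓ))) :=
    Module.Free.of_equiv ((Submodule.equivMapOfInjective _ hι _).trans
      (LinearEquiv.ofEq _ _ map_comap_Omega_one)).symm
  obtain ⟨T, hT⟩ := exists_range_eq_of_finrank
    (finrank_of_smul_mem (W := (Omega A m 1).comap (ExteriorAlgebra.ι (PS K ℓ)))
      (Qpoly_ne_zero A m) (ι_Qpoly_smul_mem (A := A) (m := m)))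
  refine ⟨T, fun x => by rw [hT, Submodule.mem_comap], fun h0 => ?_⟩
  have h1 := det_dvd_Qpoly_pow (A := A) (m := m) (T := T) (fun x hx => by rw [hT]; exact hx)
  rw [h0, zero_dvd_iff] at h1
  exact pow_ne_zero _ (Qpoly_ne_zero A m) h1

end Saito

section Pairing

/-- The pairing of a one-form with the constant vector field `z`. -/
def prs (z : Fin ℓ → K) : ExtF K ℓ →ₗ[PS K ℓ] PS K ℓ :=
  ExteriorAlgebra.algebraMapInv.toLinearMap ∘ₗ contr z

theorem contr_dP (z c : Fin ℓ → K) : contr z (dP c) = algebraMap _ _ (C (dot c z) : PS K ℓ) := by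
  have := contr_dP_mul z c 1
  rw [mul_one, ← map_one (algebraMap (PS K ℓ) (ExtF K ℓ)), contr_algebraMap, mul_zero, sub_zero]
    at this
  rw [this, Algebra.smul_def, map_one, mul_one]

theorem prs_dP (z c : Fin ℓ → K) : prs z (dP c) = C (dot c z) := by
  rw [prs, LinearMap.comp_apply, contr_dP]
  exact ExteriorAlgebra.algebraMap_leftInverse _ _

theorem contr_eq_prs (z : Fin ℓ → K) {η : ExtF K ℓ} (hη : η ∈ formsP K ℓ 1) :
    contr z η = algebraMap _ _ (prs z η) := by
  obtain ⟨f, hf⟩ := eq_algebraMap_of_mem_formsP_zero (contr_mem z hη).1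
  rw [prs, LinearMap.comp_apply, hf]
  exact congrArg _ (ExteriorAlgebra.algebraMap_leftInverse _ _).symm

theorem prs_ι (z : Fin ℓ → K) (w : Fin ℓ → PS K ℓ) :
    prs z (ExteriorAlgebra.ι (PS K ℓ) w) = ∑ j, w j * C (z j) := by
  rw [ι_eq_sum, map_sum]
  exact Finset.sum_congr rfl fun j _ => by rw [map_smul, prs_dP, single_dot, smul_eq_mul]

theorem exists_eq_ι {η : ExtF K ℓ} (hη : η ∈ formsP K ℓ 1) :
    ∃ w, ExteriorAlgebra.ι (PS K ℓ) w = η := by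
  rwa [formsP, pow_one] at hη

theorem prs_ι_single (j : Fin ℓ) (w : Fin ℓ → PS K ℓ) :
    prs (Pi.single j (1 : K)) (ExteriorAlgebra.ι (PS K ℓ) w) = w j := by
  rw [prs_ι, Finset.sum_eq_single j]
  · simp
  · intro k _ hk; simp [hk]
  · simp

theorem prs_add {η : ExtF K ℓ} (hη : η ∈ formsP K ℓ 1) (z z' : Fin ℓ → K) :
    prs (z + z') η = prs z η + prs z' η := by
  obtain ⟨w, rfl⟩ := exists_eq_ι hη
  simp only [prs_ι, Pi.add_apply, map_add, mul_add, Finset.sum_add_distrib]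

theorem prs_smul {η : ExtF K ℓ} (hη : η ∈ formsP K ℓ 1) (t : K) (z : Fin ℓ → K) :
    prs (t • z) η = C t * prs z η := by
  obtain ⟨w, rfl⟩ := exists_eq_ι hη
  simp only [prs_ι, Pi.smul_apply, smul_eq_mul, map_mul, Finset.mul_sum]
  exact Finset.sum_congr rfl fun j _ => by ring

theorem eq_zero_of_prs {η : ExtF K ℓ} (hη : η ∈ formsP K ℓ 1) (h : ∀ z, prs z η = 0) : η = 0 := by
  obtain ⟨w, rfl⟩ := exists_eq_ι hη
  have : w = 0 := by
    ext1 j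
    rw [← prs_ι_single j w, h, Pi.zero_apply]
  rw [this, map_zero]

theorem exists_dot_eq_one {c : Fin ℓ → K} (hc : c ≠ 0) : ∃ z, dot c z = 1 := by
  obtain ⟨i, hi⟩ := Function.ne_iff.1 hc
  exact ⟨(c i)⁻¹ • Pi.single i 1, by rw [dot_smul, dot_single, inv_mul_cancel₀ hi]⟩

theorem dvd_of_sdvd_smul_dP {c : Fin ℓ → K} (hc : c ≠ 0) {f g : PS K ℓ} (h : SDvd f (g • dP c)) :
    f ∣ g := by
  obtain ⟨z, hz⟩ := exists_dot_eq_one hc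
  obtain ⟨ξ, hξ⟩ := h
  have := congrArg (prs z) hξ
  rw [map_smul, map_smul, prs_dP, hz, map_one, smul_eq_mul, mul_one, smul_eq_mul] at this
  exact ⟨_, this⟩

theorem dvd_prs {c z : Fin ℓ → K} (hc : c ≠ 0) (hz : dot c z = 0) {f : PS K ℓ} {η : ExtF K ℓ}
    (hη : η ∈ formsP K ℓ 1) (h : SDvd f (dP c * η)) : f ∣ prs z η := by
  obtain ⟨ξ, hξ⟩ := h
  have := congrArg (contr z) hξ
  rw [contr_dP_mul, hz, map_zero, zero_smul, zero_sub, map_smul, contr_eq_prs z hη,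
    ← Algebra.commutes, ← Algebra.smul_def, ← neg_smul] at this
  exact (dvd_neg).1 (dvd_of_sdvd_smul_dP hc ⟨_, this⟩)

theorem isHomogeneous_prs {d : ℕ} {η : ExtF K ℓ} (h : IsHomogForm 1 d η) (z : Fin ℓ → K) :
    (prs z η).IsHomogeneous d := by
  induction h using AddSubgroup.closure_induction with
  | mem x hx =>
    obtain ⟨f, l, hf, hl, rfl⟩ := hx
    obtain ⟨i, rfl⟩ := List.length_eq_one_iff.1 hl
    have : wedgeList [i] = dP (Pi.single i (1 : K)) := by
      rw [wedgeList, dP, List.map_singleton, List.prod_singleton]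
      congr 1
      ext1 j
      rcases eq_or_ne j i with rfl | hj
      · simp
      · simp [hj]
    rw [this, map_smul, prs_dP, smul_eq_mul]
    simpa using hf.mul (isHomogeneous_C _ (dot (Pi.single i 1) z))
  | zero => rw [map_zero]; exact isHomogeneous_zero _ _ _
  | add x y _ _ hx hy => rw [map_add]; exact hx.add hy
  | neg x _ hx => rw [map_neg]; exact hx.neg

end Pairing

section Degrees

theorem isHomogeneous_linP (c : Fin ℓ → K) : (linP c).IsHomogeneous 1 :=
  IsHomogeneous.sum _ _ _ fun i _ => by
    simpa using (isHomogeneous_C _ (c i)).mul (isHomogeneous_X K i)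

theorem isHomogeneous_prod_linP (s : Finset (Fin ℓ → K)) (m : (Fin ℓ → K) → ℕ) :
    (∏ c ∈ s, linP c ^ m c).IsHomogeneous (∑ c ∈ s, m c) :=
  IsHomogeneous.prod _ _ _ fun c _ => by simpa using (isHomogeneous_linP c).pow (m c)

theorem isHomogeneous_Qpoly (A : Arrangement K ℓ) (m : (Fin ℓ → K) → ℕ) :
    (Qpoly A m).IsHomogeneous (msum A m) := isHomogeneous_prod_linP _ _

theorem eq_zero_of_dvd_of_degree_lt {f g : PS K ℓ} {d d' : ℕ} (hf : f.IsHomogeneous d)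
    (hg : g.IsHomogeneous d') (h : g ∣ f) (hd : d < d') : f = 0 := by
  by_contra hf0
  obtain ⟨k, rfl⟩ := h
  have hg0 : g ≠ 0 := left_ne_zero_of_mul hf0
  have hk0 : k ≠ 0 := right_ne_zero_of_mul hf0
  have := hf.totalDegree hf0
  rw [totalDegree_mul_of_isDomain hg0 hk0, hg.totalDegree hg0] at this
  omega

theorem exists_eq_C_mul_of_dvd {f g : PS K ℓ} {d : ℕ} (hf : f.IsHomogeneous d)
    (hg : g.IsHomogeneous d) (h : g ∣ f) (hf0 : f ≠ 0) : ∃ a : K, a ≠ 0 ∧ f = C a * g := by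
  obtain ⟨k, rfl⟩ := h
  have hg0 : g ≠ 0 := left_ne_zero_of_mul hf0
  have hk0 : k ≠ 0 := right_ne_zero_of_mul hf0
  have := hf.totalDegree hf0
  rw [totalDegree_mul_of_isDomain hg0 hk0, hg.totalDegree hg0] at this
  have hk : k.totalDegree = 0 := by omega
  rw [totalDegree_eq_zero_iff_eq_C] at hk
  exact ⟨coeff 0 k, fun h => hk0 (by rw [hk, h, map_zero]), by rw [mul_comm, ← hk]⟩

theorem isHomogeneous_det {N : Matrix (Fin ℓ) (Fin ℓ) (PS K ℓ)} {D : Fin ℓ → ℕ}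
    (h : ∀ i j, (N i j).IsHomogeneous (D j)) : N.det.IsHomogeneous (∑ j, D j) := by
  rw [Matrix.det_apply]
  refine IsHomogeneous.sum _ _ _ fun σ _ => ?_
  have := IsHomogeneous.prod Finset.univ (fun j => N (σ j) j) D fun j _ => h _ _
  rcases Int.units_eq_one_or (Equiv.Perm.sign σ) with hs | hs
  · rwa [hs, one_smul]
  · rw [hs, Units.neg_smul, one_smul]; exact this.neg

/-- The degrees of a homogeneous basis of the logarithmic one-forms have a prescribed sum. -/
theorem sum_degrees (hℓ : 1 ≤ ℓ) {A : Arrangement K ℓ} {m : (Fin ℓ → K) → ℕ} {b : Fin ℓ → ExtF K ℓ}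
    {D : Fin ℓ → ℕ} (hb : ∀ i, b i ∈ Omega A m 1) (hD : ∀ i, IsHomogForm 1 (D i) (b i))
    (hspan : Omega A m 1 ≤ Submodule.span (PS K ℓ) (Set.range b)) :
    ∑ i, D i = (ℓ - 1) * msum A m := by
  choose w hw using fun i => exists_eq_ι (mem_Omega.1 (hb i)).1
  let T := (Pi.basisFun (PS K ℓ) (Fin ℓ)).constr (PS K ℓ) w
  have hιT : LinearMap.range (ExteriorAlgebra.ι (PS K ℓ) ∘ₗ T) =
      Submodule.span (PS K ℓ) (Set.range b) := by
    rw [LinearMap.range_comp, Module.Basis.constr_range, Submodule.map_span, ← Set.range_comp]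
    congr 2
    exact funext hw
  have hT : ∀ x, ExteriorAlgebra.ι (PS K ℓ) x ∈ Omega A m 1 ↔ x ∈ LinearMap.range T := by
    intro x
    constructor
    · intro hx
      obtain ⟨y, hy⟩ := hιT.ge (hspan hx)
      exact ⟨y, ExteriorAlgebra.ι_leftInverse.injective hy⟩
    · rintro ⟨y, rfl⟩
      have h1 : Submodule.span (PS K ℓ) (Set.range b) ≤ Omega A m 1 :=
        Submodule.span_le.2 (by rintro _ ⟨i, rfl⟩; exact hb i)
      exact h1 (hιT.le ⟨y, rfl⟩)
  obtain ⟨u, hu, hdet⟩ := exists_isUnit_det hℓ hT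
  have h0 : LinearMap.det T ≠ 0 := by
    rw [hdet]; exact mul_ne_zero (pow_ne_zero _ (Qpoly_ne_zero A m)) hu.ne_zero
  have h1 : (LinearMap.det T).IsHomogeneous (∑ i, D i) := by
    rw [← LinearMap.det_toMatrix']
    refine isHomogeneous_det fun i j => ?_
    have : LinearMap.toMatrix' T i j = w j i := by
      rw [LinearMap.toMatrix'_apply]
      have := (Pi.basisFun (PS K ℓ) (Fin ℓ)).constr_basis (PS K ℓ) w j
      rw [Pi.basisFun_apply] at this
      exact congrFun this i
    rw [this, ← prs_ι_single i (w j), hw]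
    exact isHomogeneous_prs (hD j) _
  have h2 := ((isHomogeneous_Qpoly A m).pow (ℓ - 1)).totalDegree
    (pow_ne_zero _ (Qpoly_ne_zero A m))
  have h3 := h1.totalDegree h0
  have h4 : u.totalDegree = 0 := by
    obtain ⟨u', hu'⟩ := hu.exists_right_inv
    have hu0 : u' ≠ 0 := right_ne_zero_of_mul (hu'.trans_ne one_ne_zero)
    have := totalDegree_mul_of_isDomain hu.ne_zero hu0
    rw [hu', totalDegree_one] at this
    omega
  rw [hdet, totalDegree_mul_of_isDomain (pow_ne_zero _ (Qpoly_ne_zero A m)) hu.ne_zero, h2, h4]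
    at h3
  rw [← h3, add_zero, mul_comm]

end Degrees

section Planar

theorem dot_sub (c x y : Fin ℓ → K) : dot c (x - y) = dot c x - dot c y :=
  eq_sub_of_add_eq (by rw [← dot_add, sub_add_cancel])

theorem add_dot (c c' x : Fin ℓ → K) : dot (c + c') x = dot c x + dot c' x := by
  simp [dot, add_mul, Finset.sum_add_distrib]

theorem Qpoly_dvd {A : Arrangement K ℓ} {m : (Fin ℓ → K) → ℕ} {f : PS K ℓ}
    (h : ∀ c ∈ A.hyps, linP c ^ m c ∣ f) : Qpoly A m ∣ f :=
  Finset.prod_dvd_of_isRelPrime (pairwise_isRelPrime_hyps A m) h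

theorem msum_mdel {A : Arrangement K ℓ} {m : (Fin ℓ → K) → ℕ} {c0 : Fin ℓ → K}
    (hc0 : c0 ∈ A.hyps) (hm : 0 < m c0) : msum A (mdel m c0) + 1 = msum A m := by
  rw [msum, msum, ← Finset.add_sum_erase _ _ hc0, ← Finset.add_sum_erase _ _ hc0]
  have : ∑ c ∈ A.hyps.erase c0, mdel m c0 c = ∑ c ∈ A.hyps.erase c0, m c :=
    Finset.sum_congr rfl fun c hc => if_neg (Finset.ne_of_mem_erase hc)
  rw [this, mdel, if_pos rfl]
  omega

theorem mdel_le {F : Type} (m : (Fin ℓ → F) → ℕ) (c0 c : Fin ℓ → F) : mdel m c0 c ≤ m c := by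
  rw [mdel]; split_ifs <;> omega

theorem mdel_self {F : Type} (m : (Fin ℓ → F) → ℕ) (c0 : Fin ℓ → F) : mdel m c0 c0 = m c0 - 1 :=
  if_pos rfl

theorem mdel_of_ne {F : Type} {m : (Fin ℓ → F) → ℕ} {c0 c : Fin ℓ → F} (h : c ≠ c0) :
    mdel m c0 c = m c :=
  if_neg h

theorem Omega_le_of_le {A : Arrangement K ℓ} {m m' : (Fin ℓ → K) → ℕ} (h : ∀ c, m' c ≤ m c)
    (p : ℕ) : Omega A m p ≤ Omega A m' p := fun η hη => by
  rw [mem_Omega] at hη ⊢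
  exact ⟨hη.1, fun c hc => (hη.2 c hc).of_dvd (pow_dvd_pow _ (h c))⟩

theorem sum_expVec (hℓ : 2 ≤ ℓ) (M d1 d2 : ℕ) :
    ∑ i : Fin ℓ, (M - expVec d1 d2 i) = (M - d1) + (M - d2) + (ℓ - 2) * M := by
  obtain ⟨k, rfl⟩ := Nat.exists_eq_add_of_le' hℓ
  rw [Fin.sum_univ_succ, Fin.sum_univ_succ]
  simp [expVec, add_assoc]

variable {n : ℕ} {c0 : Fin ℓ → K} {e : (Fin n → K) →ₗ[K] (Fin ℓ → K)}
  {q : (Fin ℓ → K) →ₗ[K] (Fin n → K)} {v : Fin ℓ → K}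

theorem IsSplit.q_v (h : IsSplit c0 e q v) : q v = 0 := by
  have h1 := h.split v
  rw [h.dot_v, one_smul] at h1
  have h2 := h.q_e (q v)
  rwa [add_eq_right.1 h1, map_zero, eq_comm] at h2

theorem IsSplit.dot_rstr_v (h : IsSplit c0 e q v) (c : Fin n → K) : dot (rstr q c) v = 0 := by
  rw [dot_rstr, h.q_v]; simp [dot]

variable {A : Arrangement K ℓ} {m : (Fin ℓ → K) → ℕ} {c' y0 : Fin n → K}

theorem IsSplit.eq_planar (h : IsSplit c0 e q v) (hy0 : dot c' y0 = 1)
    (hA : ∀ c ∈ A.hyps, ∃ t : K, rstr e c = t • c') {η : ExtF K ℓ} {d : ℕ}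
    (hη : η ∈ Omega A m 1) (hd : IsHomogForm 1 d η) (hdm : d < msum A m) :
    η = prs v η • dP c0 + prs (e y0) η • dP (rstr q c') := by
  have hη1 := (mem_Omega.1 hη).1
  have hmem : prs v η • dP c0 + prs (e y0) η • dP (rstr q c') ∈ formsP K ℓ 1 :=
    add_mem (Submodule.smul_mem _ _ (dP_mem _)) (Submodule.smul_mem _ _ (dP_mem _))
  refine sub_eq_zero.1 (eq_zero_of_prs (sub_mem hη1 hmem) fun z => ?_)
  set z' := z - dot c0 z • v - dot (rstr q c') z • e y0 with hz'
  have h0 : dot c0 z' = 0 := by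
    rw [hz', dot_sub, dot_sub, dot_smul, dot_smul, h.dot_v, h.dot_e]; ring
  have h1 : dot (rstr q c') z' = 0 := by
    rw [hz', dot_sub, dot_sub, dot_smul, dot_smul, h.dot_rstr_v, dot_rstr q c' (e y0), h.q_e, hy0]
    ring
  have h2 : prs z' η = 0 := by
    refine eq_zero_of_dvd_of_degree_lt (isHomogeneous_prs hd z') (isHomogeneous_Qpoly A m)
      (Qpoly_dvd fun c hc => ?_) hdm
    refine dvd_prs (A.ne_zero c hc) ?_ hη1 ((mem_Omega.1 hη).2 c hc)
    obtain ⟨t, ht⟩ := hA c hc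
    rw [h.sub_rstr c, ht, rstr_smul, add_dot, smul_dot, smul_dot, h0, h1]
    ring
  have h3 : z = z' + dot c0 z • v + dot (rstr q c') z • e y0 := by rw [hz']; abel
  have h4 : prs z η = C (dot c0 z) * prs v η + C (dot (rstr q c') z) * prs (e y0) η := by
    conv_lhs => rw [h3]
    rw [prs_add hη1, prs_add hη1, prs_smul hη1, prs_smul hη1, h2, zero_add]
  rw [map_sub, map_add, map_smul, map_smul, prs_dP, prs_dP, h4, smul_eq_mul, smul_eq_mul]
  ring

theorem planar_mul (a b : Fin ℓ → K) (g f g' f' : PS K ℓ) :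
    (g • dP a + f • dP b) * (g' • dP a + f' • dP b) = (g * f' - f * g') • (dP a * dP b) := by
  simp only [add_mul, mul_add, smul_mul_smul_comm, dP_mul_self, smul_zero, zero_add, add_zero]
  rw [dP_mul_swap b a, smul_neg, sub_smul, sub_eq_add_neg, add_comm]

theorem IsSplit.dvd_of_sdvd_planar (h : IsSplit c0 e q v) (hc' : c' ≠ 0) {f g : PS K ℓ}
    (hs : SDvd f (g • (dP c0 * dP (rstr q c')))) : f ∣ g := by
  have hb : rstr q c' ≠ 0 := fun h0 => hc' (by
    rw [← h.rstr_rstr c', h0]; ext i; simp [rstr])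
  refine dvd_of_sdvd_smul_dP hb ?_
  obtain ⟨ξ, hξ⟩ := hs
  have := congrArg (contr v) hξ
  rw [map_smul, contr_dP_mul, contr_dP, h.dot_v, h.dot_rstr_v, map_zero, map_zero, mul_zero,
    sub_zero, map_one, one_smul, map_smul] at this
  exact ⟨_, this⟩

theorem det_eq_zero_of_left {R : Type} [CommRing R] [IsDomain R] {g f g₁ f₁ g₂ f₂ : R}
    (h0 : g ≠ 0 ∨ f ≠ 0) (h1 : g * f₁ - f * g₁ = 0) (h2 : g * f₂ - f * g₂ = 0) :
    g₁ * f₂ - f₁ * g₂ = 0 := by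
  rcases h0 with h0 | h0
  · refine (mul_eq_zero.1 (?_ : g * (g₁ * f₂ - f₁ * g₂) = 0)).resolve_left h0
    linear_combination g₁ * h2 - g₂ * h1
  · refine (mul_eq_zero.1 (?_ : f * (g₁ * f₂ - f₁ * g₂) = 0)).resolve_left h0
    linear_combination f₁ * h2 - f₂ * h1

theorem det_ne_zero_of_linearIndependent {ι M : Type} [AddCommGroup M] [Module (PS K ℓ) M]
    {b : ι → M} (hb : LinearIndependent (PS K ℓ) b) {i j : ι} (hij : i ≠ j) {x y : M}
    {g f g' f' : PS K ℓ} (hi : b i = g • x + f • y) (hj : b j = g' • x + f' • y) :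
    g * f' - f * g' ≠ 0 := by
  intro h0
  have hp := (LinearIndependent.pair_iff (R := PS K ℓ)).1
    (hb.comp ![i, j] (by
      intro a b hab
      fin_cases a <;> fin_cases b <;> simp_all [eq_comm]) |> fun h => by
        have : b ∘ ![i, j] = ![b i, b j] := by ext k; fin_cases k <;> rfl
        rwa [this] at h)
  have h1 := hp f' (-f) (by
    rw [hi, hj, smul_add, smul_add, ← mul_smul, ← mul_smul, ← mul_smul, ← mul_smul,
      show f' * f = f * f' from mul_comm _ _, show f' * g = -(-f * g') by
        linear_combination h0, neg_smul, neg_mul f f', neg_smul]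
    abel)
  have h2 := hp g' (-g) (by
    rw [hi, hj, smul_add, smul_add, ← mul_smul, ← mul_smul, ← mul_smul, ← mul_smul,
      show g' * f = -(-g * f') by linear_combination -h0, neg_smul, mul_comm g' g, neg_mul g g',
      neg_smul]
    abel)
  have h3 : b i = 0 := by
    rw [hi, neg_eq_zero.1 h1.2, neg_eq_zero.1 h2.2, zero_smul, zero_smul, add_zero]
  exact hb.ne_zero i h3

end Planar

section RankTwo

variable {n : ℕ} {c0 : Fin ℓ → K} {e : (Fin n → K) →ₗ[K] (Fin ℓ → K)}
  {q : (Fin ℓ → K) →ₗ[K] (Fin n → K)} {v : Fin ℓ → K}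
  {A : Arrangement K ℓ} {m : (Fin ℓ → K) → ℕ} {c' y0 : Fin n → K}

/-- The exponents of a rank-two multiarrangement with at least two lines. -/
theorem IsSplit.exponents (h : IsSplit c0 e q v) (hℓ : 2 ≤ ℓ) (hc0 : c0 ∈ A.hyps)
    (hm : ∀ c ∈ A.hyps, 0 < m c) (hc' : c' ≠ 0)
    (hA : ∀ c ∈ A.hyps, ∃ t : K, rstr e c = t • c') {c1 : Fin ℓ → K} (hc1 : c1 ∈ A.hyps)
    (hne : c1 ≠ c0) {d1 d2 : ℕ} (hF : FreeWithExp A m (expVec d1 d2)) :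
    1 ≤ d1 ∧ 1 ≤ d2 ∧ d1 + d2 = msum A m := by
  obtain ⟨y0, hy0⟩ := exists_dot_eq_one hc'
  obtain ⟨b, hb, hD, hlin, hspan⟩ := hF
  have hM : 1 ≤ msum A m :=
    (hm c0 hc0).trans_le (Finset.single_le_sum (f := m) (fun _ _ => Nat.zero_le _) hc0)
  have hsum := sum_degrees (one_le_two.trans hℓ) hb hD hspan
  rw [sum_expVec hℓ] at hsum
  have hℓ1 : ℓ - 1 = (ℓ - 2) + 1 := by omega
  rw [hℓ1, add_mul, one_mul] at hsum
  have hlow : ∀ i : Fin ℓ, msum A m - expVec d1 d2 i ≠ 0 := by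
    intro i hi
    have hDi := hD i
    rw [hi] at hDi
    have hpl := h.eq_planar hy0 hA (hb i) hDi (by omega)
    set g := prs v (b i) with hg
    set f := prs (e y0) (b i) with hf
    have hdeg : ∀ (k : PS K ℓ) (c : Fin ℓ → K), c ∈ A.hyps → k.IsHomogeneous 0 →
        linP c ^ m c ∣ k → k = 0 := fun k c hc hk hd =>
      eq_zero_of_dvd_of_degree_lt hk ((isHomogeneous_linP c).pow (m c)) hd (by
        rw [one_mul]; exact hm c hc)
    have hf0 : f = 0 := by
      refine hdeg f c0 hc0 (isHomogeneous_prs hDi _) (h.dvd_of_sdvd_planar hc' ?_)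
      have := (mem_Omega.1 (hb i)).2 c0 hc0
      rwa [hpl, mul_add, mul_smul_comm, dP_mul_self, smul_zero, zero_add, mul_smul_comm] at this
    have hg0 : g = 0 := by
      refine hdeg g c1 hc1 (isHomogeneous_prs hDi _) ?_
      have h1 := (mem_Omega.1 (hb i)).2 c1 hc1
      obtain ⟨t, ht⟩ := hA c1 hc1
      have ht0 : t ≠ 0 := by
        rintro rfl
        have := h.sub_rstr c1
        rw [ht, rstr_smul, zero_smul, zero_add] at this
        exact A.nonprop c1 hc1 c0 hc0 hne _ this
      rw [hpl, hf0, zero_smul, add_zero, mul_smul_comm, h.sub_rstr c1, ht, rstr_smul, dP_add,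
        dP_smul, dP_smul, add_mul, smul_mul_assoc, smul_mul_assoc, dP_mul_self, smul_zero,
        add_zero, dP_mul_swap, smul_neg, smul_neg, ← mul_smul] at h1
      have h2 := h1.neg
      rw [neg_neg] at h2
      have h3 := h.dvd_of_sdvd_planar hc' h2
      have hc1' : c1 = t • rstr q c' + dot c1 v • c0 := by
        rw [← rstr_smul, ← ht]; exact h.sub_rstr c1
      rw [← hc1'] at h3
      exact ((isUnit_iff_ne_zero.2 ht0).map C).dvd_mul_right.1 h3
    refine hlin.ne_zero i ?_
    rw [hpl, hf0, hg0, zero_smul, zero_smul, add_zero]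
  have h0 := hlow ⟨0, by omega⟩
  have h1 := hlow ⟨1, by omega⟩
  simp only [expVec, if_true, one_ne_zero, if_false] at h0 h1
  omega

/-- Logarithmic one-forms of a rank-two multiarrangement and of its deletion, with degrees
prescribed by the exponents and with nonzero determinant. -/
theorem IsSplit.exists_planar_pair (h : IsSplit c0 e q v) (hℓ : 2 ≤ ℓ) (hc0 : c0 ∈ A.hyps)
    (hm : ∀ c ∈ A.hyps, 0 < m c) (hc' : c' ≠ 0)
    (hA : ∀ c ∈ A.hyps, ∃ t : K, rstr e c = t • c') {c1 : Fin ℓ → K} (hc1 : c1 ∈ A.hyps)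
    (hne : c1 ≠ c0) {d1 d2 : ℕ} (hF : FreeWithExp A m (expVec d1 d2))
    (hF' : FreeWithExp A (mdel m c0) (expVec (d1 - 1) d2)) :
    ∃ (g f g' f' : PS K ℓ) (a : K), a ≠ 0 ∧ g.IsHomogeneous d2 ∧
      g • dP c0 + f • dP (rstr q c') ∈ Omega A m 1 ∧
      g' • dP c0 + f' • dP (rstr q c') ∈ Omega A (mdel m c0) 1 ∧
      g * f' - f * g' = C a * Qpoly A (mdel m c0) := by
  obtain ⟨hd1, hd2, hd⟩ := h.exponents hℓ hc0 hm hc' hA hc1 hne hF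
  have hM' := msum_mdel hc0 (hm c0 hc0)
  obtain ⟨y0, hy0⟩ := exists_dot_eq_one hc'
  obtain ⟨b, hb, hD, hlin, -⟩ := hF
  obtain ⟨b', hb', hD', hlin', -⟩ := hF'
  let i0 : Fin ℓ := ⟨0, by omega⟩
  let i1 : Fin ℓ := ⟨1, by omega⟩
  have hi : i0 ≠ i1 := fun hi => zero_ne_one (congrArg Fin.val hi)
  have e0 : IsHomogForm 1 d2 (b i0) := by
    convert hD i0 using 1
    simp only [expVec, i0, if_true]; omega
  have e1 : IsHomogForm 1 d1 (b i1) := by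
    convert hD i1 using 1
    simp only [expVec, i1, if_true, one_ne_zero, if_false]; omega
  have e0' : IsHomogForm 1 d2 (b' i0) := by
    convert hD' i0 using 1
    simp only [expVec, i0, if_true]; omega
  have e1' : IsHomogForm 1 (d1 - 1) (b' i1) := by
    convert hD' i1 using 1
    simp only [expVec, i1, if_true, one_ne_zero, if_false]; omega
  let δ : ExtF K ℓ → ExtF K ℓ → PS K ℓ := fun x y =>
    prs v x * prs (e y0) y - prs (e y0) x * prs v y
  have hdvd : ∀ {m'' : (Fin ℓ → K) → ℕ} {x y : ExtF K ℓ}, x ∈ Omega A m'' 1 → y ∈ Omega A m'' 1 →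
      x = prs v x • dP c0 + prs (e y0) x • dP (rstr q c') →
      y = prs v y • dP c0 + prs (e y0) y • dP (rstr q c') → Qpoly A m'' ∣ δ x y := by
    intro m'' x y hx hy hx' hy'
    obtain ⟨ζ, -, hζ⟩ := Omega_mul hx hy
    refine h.dvd_of_sdvd_planar hc' ⟨ζ, ?_⟩
    rw [← hζ, ← planar_mul, ← hx', ← hy']
  have hdeg : ∀ {x y : ExtF K ℓ} {r s : ℕ}, IsHomogForm 1 r x → IsHomogForm 1 s y →
      (δ x y).IsHomogeneous (r + s) := by
    intro x y r s hx hy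
    exact ((isHomogeneous_prs hx _).mul (isHomogeneous_prs hy _)).sub
      ((isHomogeneous_prs hx _).mul (isHomogeneous_prs hy _))
  have hle := Omega_le_of_le (A := A) (mdel_le m c0) 1
  have p0 := h.eq_planar hy0 hA (hb i0) e0 (by omega)
  have p1 := h.eq_planar hy0 hA (hb i1) e1 (by omega)
  have p1' := h.eq_planar hy0 hA (hb' i1) e1' (by omega)
  have hnz : ∀ {x : ExtF K ℓ}, x ≠ 0 → x = prs v x • dP c0 + prs (e y0) x • dP (rstr q c') →
      prs v x ≠ 0 ∨ prs (e y0) x ≠ 0 := by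
    intro x hx hx'
    by_contra! h0
    exact hx (by rw [hx', h0.1, h0.2, zero_smul, zero_smul, add_zero])
  have hswap : ∀ x y, δ x y = 0 → δ y x = 0 := fun x y hxy => by
    simp only [δ] at hxy ⊢
    linear_combination -hxy
  obtain ⟨x, y, hx, hy, hdx, hdy, px, py, hδ⟩ : ∃ x y, x ∈ Omega A m 1 ∧
      y ∈ Omega A (mdel m c0) 1 ∧ IsHomogForm 1 d2 x ∧ IsHomogForm 1 (d1 - 1) y ∧
      x = prs v x • dP c0 + prs (e y0) x • dP (rstr q c') ∧
      y = prs v y • dP c0 + prs (e y0) y • dP (rstr q c') ∧ δ x y ≠ 0 := by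
    by_cases hc : d1 ≤ d2
    · by_cases h0 : δ (b i0) (b' i1) = 0
      · have h1 : δ (b i1) (b' i1) ≠ 0 := fun h1 =>
          det_ne_zero_of_linearIndependent hlin hi p0 p1
            (det_eq_zero_of_left (hnz (hlin'.ne_zero i1) p1') (hswap _ _ h0) (hswap _ _ h1))
        have : d1 = d2 := by
          by_contra hdd
          exact h1 (eq_zero_of_dvd_of_degree_lt (hdeg e1 e1') (isHomogeneous_Qpoly A (mdel m c0))
            (hdvd (hle (hb i1)) (hb' i1) p1 p1') (by omega))
        exact ⟨_, _, hb i1, hb' i1, this ▸ e1, e1', p1, p1', h1⟩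
      · exact ⟨_, _, hb i0, hb' i1, e0, e1', p0, p1', h0⟩
    · have p0' := h.eq_planar hy0 hA (hb' i0) e0' (by omega)
      by_cases h1 : δ (b i0) (b' i1) = 0
      · have h0 : δ (b i0) (b' i0) ≠ 0 := fun h0 =>
          det_ne_zero_of_linearIndependent hlin' hi p0' p1'
            (det_eq_zero_of_left (hnz (hlin.ne_zero i0) p0) h0 h1)
        have : d2 = d1 - 1 := by
          by_contra hdd
          exact h0 (eq_zero_of_dvd_of_degree_lt (hdeg e0 e0') (isHomogeneous_Qpoly A (mdel m c0))
            (hdvd (hle (hb i0)) (hb' i0) p0 p0') (by omega))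
        exact ⟨_, _, hb i0, hb' i0, e0, this ▸ e0', p0, p0', h0⟩
      · exact ⟨_, _, hb i0, hb' i1, e0, e1', p0, p1', h1⟩
  have hdd : d2 + (d1 - 1) = msum A (mdel m c0) := by omega
  obtain ⟨a, ha, haQ⟩ := exists_eq_C_mul_of_dvd (hdd ▸ hdeg hdx hdy) (isHomogeneous_Qpoly A _)
    (hdvd (hle hx) hy px py) hδ
  exact ⟨_, _, _, _, a, ha, isHomogeneous_prs hdx v, px ▸ hx, py ▸ hy, haQ⟩

theorem isHomogeneous_pullP {f : PS K ℓ} {d : ℕ} (hf : f.IsHomogeneous d) :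
    (pullP e f).IsHomogeneous d := by
  have := hf.aeval (fun j => linP (rstr e (Pi.single j 1))) fun j => isHomogeneous_linP _
  rwa [one_mul] at this

theorem exists_eq_C_mul_pow {c : Fin n → K} (hc : c ≠ 0) {g f : PS K n} {a : K} (ha : a ≠ 0)
    {d k : ℕ} (hg : g.IsHomogeneous d) (h : g * f = C a * linP c ^ k) :
    d ≤ k ∧ (∃ u : K, u ≠ 0 ∧ g = C u * linP c ^ d) ∧
      ∃ u : K, u ≠ 0 ∧ f = C u * linP c ^ (k - d) := by
  have hp := prime_linP hc
  have hu : IsUnit (C a : PS K n) := (isUnit_iff_ne_zero.2 ha).map C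
  have hne : C a * linP c ^ k ≠ 0 := mul_ne_zero hu.ne_zero (pow_ne_zero _ hp.ne_zero)
  have hg0 : g ≠ 0 := left_ne_zero_of_mul (h.trans_ne hne)
  obtain ⟨i, hi, hgi⟩ := (dvd_prime_pow hp k).1 (hu.dvd_mul_left.1 ⟨f, h.symm⟩)
  obtain ⟨w, hw⟩ := hgi.symm
  obtain ⟨u, hu', huw⟩ := isUnit_iff_eq_C_of_isReduced.1 w.isUnit
  have hgu : g = C u * linP c ^ i := by rw [← hw, huw, mul_comm]
  have hdi : d = i := by
    refine hg.inj_right ?_ hg0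
    rw [hgu]
    simpa using (isHomogeneous_C _ u).mul ((isHomogeneous_linP c).pow i)
  subst hdi
  refine ⟨hi, ⟨u, hu'.ne_zero, hgu⟩, u⁻¹ * a, mul_ne_zero (inv_ne_zero hu'.ne_zero) ha, ?_⟩
  refine mul_left_cancel₀ hg0 ?_
  rw [h, hgu, map_mul]
  have h1 : (C u : PS K n) * C u⁻¹ = 1 := by rw [← C_mul, mul_inv_cancel₀ hu'.ne_zero, C_1]
  calc C a * linP c ^ k = (C u * C u⁻¹) * C a * (linP c ^ d * linP c ^ (k - d)) := by
        rw [h1, ← pow_add, Nat.add_sub_cancel' hi, one_mul]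
    _ = _ := by ring

/-- The restriction of the product of the remaining forms of a rank-two arrangement. -/
theorem IsSplit.pullP_prod_erase (h : IsSplit c0 e q v) (hc0 : c0 ∈ A.hyps)
    (hA : ∀ c ∈ A.hyps, ∃ t : K, rstr e c = t • c') (m : (Fin ℓ → K) → ℕ) :
    ∃ a : K, a ≠ 0 ∧ pullP e (∏ c ∈ A.hyps.erase c0, linP c ^ m c) =
      C a * linP c' ^ ∑ c ∈ A.hyps.erase c0, m c := by
  choose! t ht using hA
  have ht0 : ∀ c ∈ A.hyps.erase c0, t c ≠ 0 := by
    intro c hc h0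
    have hc1 := Finset.mem_of_mem_erase hc
    have := h.sub_rstr c
    rw [ht c hc1, h0, rstr_smul, zero_smul, zero_add] at this
    exact A.nonprop c hc1 c0 hc0 (Finset.ne_of_mem_erase hc) _ this
  refine ⟨∏ c ∈ A.hyps.erase c0, t c ^ m c,
    Finset.prod_ne_zero_iff.2 fun c hc => pow_ne_zero _ (ht0 c hc), ?_⟩
  rw [map_prod, map_prod, ← Finset.prod_pow_eq_pow_sum, ← Finset.prod_mul_distrib]
  refine Finset.prod_congr rfl fun c hc => ?_
  rw [map_pow, pullP_linP, ht c (Finset.mem_of_mem_erase hc), linP_smul, mul_pow, map_pow]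

/-- The two forms that govern the Euler multiplicity at a rank-two flat. -/
theorem IsSplit.exists_euler_forms (h : IsSplit c0 e q v) (hℓ : 2 ≤ ℓ) (hc0 : c0 ∈ A.hyps)
    (hm : ∀ c ∈ A.hyps, 0 < m c) (hc' : c' ≠ 0)
    (hA : ∀ c ∈ A.hyps, ∃ t : K, rstr e c = t • c') {c1 : Fin ℓ → K} (hc1 : c1 ∈ A.hyps)
    (hne : c1 ≠ c0) {d1 d2 : ℕ} (hF : FreeWithExp A m (expVec d1 d2))
    (hF' : FreeWithExp A (mdel m c0) (expVec (d1 - 1) d2)) :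
    d2 ≤ ∑ c ∈ A.hyps.erase c0, m c ∧
    (∃ η ∈ Omega A m 1, ∃ u : K, u ≠ 0 ∧ res e v η = algebraMap _ _ (C u * linP c' ^ d2)) ∧
    ∃ (f : PS K ℓ) (τ : ExtF K ℓ) (u : K), u ≠ 0 ∧
      f • dP c0 + linP c0 ^ (m c0 - 1) • τ ∈ Omega A (mdel m c0) 1 ∧
      pullF e τ = (C u * linP c' ^ ((∑ c ∈ A.hyps.erase c0, m c) - d2)) • dP c' := by
  obtain ⟨g, f, g', f', a, ha, hg, hx, hy, hQ⟩ :=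
    h.exists_planar_pair hℓ hc0 hm hc' hA hc1 hne hF hF'
  have hα : linP c0 ≠ 0 := linP_ne_zero h.ne_zero
  obtain ⟨m0, hm0⟩ := Nat.exists_eq_succ_of_ne_zero (hm c0 hc0).ne'
  have hf : linP c0 ^ m c0 ∣ f := by
    refine h.dvd_of_sdvd_planar hc' ?_
    have := (mem_Omega.1 hx).2 c0 hc0
    rwa [mul_add, mul_smul_comm, dP_mul_self, smul_zero, zero_add, mul_smul_comm] at this
  have hf' : linP c0 ^ (m c0 - 1) ∣ f' := by
    refine h.dvd_of_sdvd_planar hc' ?_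
    have := (mem_Omega.1 hy).2 c0 hc0
    rwa [mdel_self, mul_add, mul_smul_comm, dP_mul_self, smul_zero, zero_add, mul_smul_comm]
      at this
  obtain ⟨f1, rfl⟩ := hf
  obtain ⟨f2, rfl⟩ := hf'
  have hQ0 : Qpoly A (mdel m c0) =
      linP c0 ^ (m c0 - 1) * ∏ c ∈ A.hyps.erase c0, linP c ^ m c := by
    rw [Qpoly, ← Finset.mul_prod_erase _ _ hc0, mdel_self]
    congr 1
    exact Finset.prod_congr rfl fun c hc => by rw [mdel_of_ne (Finset.ne_of_mem_erase hc)]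
  have h1 : g * f2 - linP c0 * (f1 * g') = C a * ∏ c ∈ A.hyps.erase c0, linP c ^ m c := by
    refine mul_left_cancel₀ (pow_ne_zero (m c0 - 1) hα) ?_
    rw [hQ0, hm0, Nat.succ_sub_one, pow_succ] at hQ
    rw [hm0, Nat.succ_sub_one]
    linear_combination hQ
  obtain ⟨a', ha', hprod⟩ := h.pullP_prod_erase hc0 hA m
  have h2 := congrArg (pullP e) h1
  rw [map_sub, map_mul, map_mul, h.pullP_self, zero_mul, sub_zero, map_mul, hprod,
    ← algebraMap_eq, AlgHom.commutes, algebraMap_eq, ← mul_assoc, ← C_mul] at h2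
  obtain ⟨hle, ⟨u, hu, hgu⟩, u', hu', hfu⟩ :=
    exists_eq_C_mul_pow hc' (mul_ne_zero ha ha') (isHomogeneous_pullP hg) h2
  refine ⟨hle, ⟨_, hx, u, hu, ?_⟩, g', f2 • dP (rstr q c'), u', hu', ?_, ?_⟩
  · rw [res_apply, map_add, map_smul, map_smul, contr_dP, contr_dP, h.dot_v, h.dot_rstr_v,
      map_zero, map_zero, smul_zero, add_zero, map_one, map_one, ← Algebra.algebraMap_eq_smul_one,
      pullF_algebraMap, hgu]
  · rwa [← mul_smul]
  · rw [pullF_smul, pullF_dP, h.rstr_rstr, hfu]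

end RankTwo

section EulerRestriction

variable {n : ℕ} {c0 : Fin ℓ → K} {e : (Fin n → K) →ₗ[K] (Fin ℓ → K)}
  {q : (Fin ℓ → K) →ₗ[K] (Fin n → K)} {v : Fin ℓ → K}
  {A : Arrangement K ℓ} {m : (Fin ℓ → K) → ℕ} {c' : Fin n → K}
  {B : Arrangement K n} {ms : (Fin n → K) → ℕ}

/-- The product of the powers of the defining forms other than `c0`. -/
def Qrest (A : Arrangement K ℓ) (c0 : Fin ℓ → K) (m : (Fin ℓ → K) → ℕ) : PS K ℓ :=
  ∏ c ∈ A.hyps.erase c0, linP c ^ m c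

theorem Qpoly_eq (hc0 : c0 ∈ A.hyps) : Qpoly A m = linP c0 ^ m c0 * Qrest A c0 m :=
  (Finset.mul_prod_erase _ _ hc0).symm

theorem Qrest_mdel : Qrest A c0 (mdel m c0) = Qrest A c0 m :=
  Finset.prod_congr rfl fun c hc => by rw [mdel_of_ne (Finset.ne_of_mem_erase hc)]

theorem Qpoly_mdel_eq (hc0 : c0 ∈ A.hyps) :
    Qpoly A (mdel m c0) = linP c0 ^ (m c0 - 1) * Qrest A c0 m := by
  rw [Qpoly_eq hc0, mdel_self, Qrest_mdel]

theorem isRelPrime_Qrest (hc0 : c0 ∈ A.hyps) (k : ℕ) :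
    IsRelPrime (linP c0 ^ k) (Qrest A c0 m) :=
  IsRelPrime.prod_right fun _ hc => (isRelPrime_of_mem_hyps A hc0 (Finset.mem_of_mem_erase hc)
    (Finset.ne_of_mem_erase hc).symm).pow

theorem sdvd_Qrest {η : ExtF K ℓ} (h : ∀ c ∈ A.hyps, c ≠ c0 → SDvd (linP c ^ m c) η) :
    SDvd (Qrest A c0 m) η :=
  sdvd_prod ((pairwise_isRelPrime_hyps A m).mono fun _ hc => Finset.mem_of_mem_erase hc)
    fun c hc => h c (Finset.mem_of_mem_erase hc) (Finset.ne_of_mem_erase hc)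

/-- The localization of `A` at the flat cut out on the hyperplane by `c'`. -/
def flatArr (A : Arrangement K ℓ) (e : (Fin n → K) →ₗ[K] (Fin ℓ → K)) (c' : Fin n → K) :
    Arrangement K ℓ where
  hyps := A.hyps.filter (fun c => ∃ t : K, rstr e c = t • c')
  ne_zero := fun c hc => A.ne_zero c (Finset.mem_filter.mp hc).1
  nonprop := fun c hc c'' hc'' =>
    A.nonprop c (Finset.mem_filter.mp hc).1 c'' (Finset.mem_filter.mp hc'').1

theorem mem_flatArr {c : Fin ℓ → K} :
    c ∈ (flatArr A e c').hyps ↔ c ∈ A.hyps ∧ ∃ t : K, rstr e c = t • c' :=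
  Finset.mem_filter

/-- The multiplicity with which the forms other than `c0` restrict to `c'`. -/
def restMult (A : Arrangement K ℓ) (e : (Fin n → K) →ₗ[K] (Fin ℓ → K)) (c0 : Fin ℓ → K)
    (m : (Fin ℓ → K) → ℕ) (c' : Fin n → K) : ℕ :=
  ∑ c ∈ (flatArr A e c').hyps.erase c0, m c

theorem Omega_flatArr {p : ℕ} : Omega A m p ≤ Omega (flatArr A e c') m p := fun _ hη =>
  mem_Omega.2 ⟨(mem_Omega.1 hη).1, fun c hc => (mem_Omega.1 hη).2 c (mem_flatArr.1 hc).1⟩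

theorem mul_dP_of_mem {p : ℕ} {η : ExtF K ℓ} (hη : η ∈ formsP K ℓ p) (c : Fin ℓ → K) :
    η * dP c = (-1 : PS K ℓ) ^ p • (dP c * η) := by
  refine formsP_induction (P := fun p η => η * dP c = (-1 : PS K ℓ) ^ p • (dP c * η))
    ?_ ?_ ?_ ?_ hη
  · intro f
    rw [pow_zero, one_smul, Algebra.commutes]
  · intro p x y hx hy
    rw [add_mul, mul_add, smul_add, hx, hy]
  · intro p f x hx
    rw [smul_mul_assoc, hx, mul_smul_comm, smul_comm]
  · intro p c' x _ hx
    rw [mul_assoc, hx, mul_smul_comm, ← mul_assoc, ← mul_assoc, dP_mul_swap, neg_mul, smul_neg,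
      pow_succ, mul_neg_one, neg_smul]

theorem sdvd_dP_mul_of_mul_dP {p : ℕ} {η : ExtF K ℓ} (hη : η ∈ formsP K ℓ p) {c : Fin ℓ → K}
    {f : PS K ℓ} (h : SDvd f (η * dP c)) : SDvd f (dP c * η) := by
  have h1 := (mul_dP_of_mem hη c ▸ h).smul ((-1 : PS K ℓ) ^ p)
  rwa [← mul_smul, ← pow_add, ← two_mul, pow_mul, neg_one_sq, one_pow, one_smul] at h1

/-- The properties of the Euler restriction `(B, ms)` of `(A, m)` to the hyperplane of `c0`
that are inherited by localizations. -/
structure IsEuler (A : Arrangement K ℓ) (m : (Fin ℓ → K) → ℕ) (c0 : Fin ℓ → K)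
    (e : (Fin n → K) →ₗ[K] (Fin ℓ → K)) (q : (Fin ℓ → K) →ₗ[K] (Fin n → K)) (v : Fin ℓ → K)
    (B : Arrangement K n) (ms : (Fin n → K) → ℕ) : Prop where
  split : IsSplit c0 e q v
  mem : c0 ∈ A.hyps
  pos : 0 < m c0
  exists_rstr : ∀ c ∈ A.hyps, c ≠ c0 → ∃ c' ∈ B.hyps, ∃ t : K, t ≠ 0 ∧ rstr e c = t • c'
  le_restMult : ∀ c' ∈ B.hyps, ms c' ≤ restMult A e c0 m c'
  exists_form : ∀ c' ∈ B.hyps, ∃ η ∈ Omega (flatArr A e c') m 1, ∃ u : K, u ≠ 0 ∧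
    res e v η = algebraMap _ _ (C u * linP c' ^ ms c')
  exists_form_mdel : ∀ c' ∈ B.hyps, ∃ (f : PS K ℓ) (τ : ExtF K ℓ) (u : K), u ≠ 0 ∧
    f • dP c0 + linP c0 ^ (m c0 - 1) • τ ∈ Omega (flatArr A e c') (mdel m c0) 1 ∧
    pullF e τ = (C u * linP c' ^ (restMult A e c0 m c' - ms c')) • dP c'

namespace IsEuler

theorem mem_flat (h : IsEuler A m c0 e q v B ms) (c' : Fin n → K) :
    c0 ∈ (flatArr A e c').hyps :=
  mem_flatArr.2 ⟨h.mem, 0, by rw [h.split.rstr_self, zero_smul]⟩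

theorem pullP_Qrest_flat (h : IsEuler A m c0 e q v B ms) (c' : Fin n → K) :
    ∃ a : K, a ≠ 0 ∧ pullP e (Qrest (flatArr A e c') c0 m) =
      C a * linP c' ^ restMult A e c0 m c' :=
  h.split.pullP_prod_erase (h.mem_flat c') (fun _ hc => (mem_flatArr.1 hc).2) m

theorem pow_dvd_pullP_Qrest_flat (h : IsEuler A m c0 e q v B ms) (c' : Fin n → K) :
    linP c' ^ restMult A e c0 m c' ∣ pullP e (Qrest (flatArr A e c') c0 m) := by
  obtain ⟨a, -, ha⟩ := h.pullP_Qrest_flat c'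
  exact ⟨C a, by rw [ha, mul_comm]⟩

theorem sdvd_res_flat (h : IsEuler A m c0 e q v B ms) {η : ExtF K ℓ}
    (hη : SDvd (Qrest (flatArr A e c') c0 m) η) :
    SDvd (linP c' ^ restMult A e c0 m c') (res e v η) := by
  obtain ⟨ξ, rfl⟩ := hη
  rw [res_smul]
  exact sdvd_smul_of_dvd (h.pow_dvd_pullP_Qrest_flat c') _

theorem sdvd_C_mul {N : Type} [AddCommGroup N] [Module (PS K n) N] {u : K} (hu : u ≠ 0)
    {f g : PS K n} {η : N} (h : SDvd f ((C u * g) • η)) : SDvd f (g • η) := by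
  have h1 := h.smul (C u⁻¹)
  rwa [← mul_smul, ← mul_assoc, ← C_mul, inv_mul_cancel₀ hu, C_1, one_mul] at h1

/-- The residue of a logarithmic form is logarithmic for the Euler multiplicity. -/
theorem res_mem_Omega (h : IsEuler A m c0 e q v B ms) {p : ℕ} {η : ExtF K ℓ}
    (hη : η ∈ Omega A m (p + 1)) : res e v η ∈ Omega B ms p := by
  refine mem_Omega.2 ⟨res_mem (mem_Omega.1 hη).1, fun c' hc' => ?_⟩
  have hα : linP c0 ≠ 0 := linP_ne_zero h.split.ne_zero
  obtain ⟨f1, τ1, u, hu, hη1, hτ1⟩ := h.exists_form_mdel c' hc'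
  obtain ⟨ξ, hξ⟩ := (mem_Omega.1 hη).2 c0 h.mem
  set ρ := contr v ξ with hρ
  set σ := contr v η with hσ
  have hηd : η = dP c0 * σ + linP c0 ^ m c0 • ρ := by
    conv_lhs => rw [h.split.eq_add_contr η, hξ, map_smul]
  obtain ⟨m0, hm0⟩ := Nat.exists_eq_succ_of_ne_zero h.pos.ne'
  rw [hm0, Nat.succ_sub_one] at hη1
  set η1 := f1 • dP c0 + linP c0 ^ m0 • τ1 with hη_def
  obtain ⟨ζ, -, hζ⟩ := Omega_mul
    (Omega_le_of_le (mdel_le m c0) _ (Omega_flatArr (e := e) (c' := c') hη)) hη1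
  have key : η * η1 = linP c0 ^ m0 • (dP c0 * (σ * τ1) + linP c0 • (ρ * η1)) := by
    conv_lhs => rw [hηd, add_mul, smul_mul_assoc]
    conv_lhs => enter [1]; rw [hη_def, mul_add, mul_smul_comm, dP_mul_mul_dP, smul_zero, zero_add,
      mul_smul_comm, mul_assoc]
    rw [smul_add, ← mul_smul, hm0, pow_succ]
  rw [key, Qpoly_mdel_eq (h.mem_flat c'), hm0, Nat.succ_sub_one, mul_smul] at hζ
  have h2 := h.sdvd_res_flat ⟨ζ, smul_left_cancel (pow_ne_zero m0 hα) hζ⟩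
  rw [map_add, h.split.res_smul_self, add_zero, h.split.res_dP_mul, map_mul, hτ1,
    mul_smul_comm] at h2
  refine sdvd_dP_mul_of_mul_dP (res_mem (mem_Omega.1 hη).1)
    (sdvd_of_smul_smul (pow_ne_zero (restMult A e c0 m c' - ms c')
      (linP_ne_zero (B.ne_zero c' hc'))) ?_)
  rw [← pow_add, Nat.sub_add_cancel (h.le_restMult c' hc')]
  exact sdvd_C_mul hu h2

/-- The hyperplanes other than that of `c0` are sorted by the restricted hyperplanes. -/
theorem pullP_Qrest (h : IsEuler A m c0 e q v B ms) :
    ∃ a : K, a ≠ 0 ∧ pullP e (Qrest A c0 m) =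
      C a * ∏ c' ∈ B.hyps, linP c' ^ restMult A e c0 m c' := by
  have hsplit : Qrest A c0 m = ∏ c' ∈ B.hyps, Qrest (flatArr A e c') c0 m := by
    have hset : A.hyps.erase c0 = B.hyps.biUnion fun c' => (flatArr A e c').hyps.erase c0 := by
      ext c
      simp only [Finset.mem_erase, Finset.mem_biUnion, mem_flatArr]
      constructor
      · rintro ⟨hne, hc⟩
        obtain ⟨c', hc', t, -, ht⟩ := h.exists_rstr c hc hne
        exact ⟨c', hc', hne, hc, t, ht⟩
      · rintro ⟨c', -, hne, hc, -⟩
        exact ⟨hne, hc⟩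
    rw [Qrest, hset, Finset.prod_biUnion]
    · rfl
    · intro c' hc' c'' hc'' hne
      refine Finset.disjoint_left.2 fun c hc1 hc2 => ?_
      simp only [Finset.mem_erase, mem_flatArr] at hc1 hc2
      obtain ⟨hn, hc, t, ht⟩ := hc1
      obtain ⟨-, -, s, hs⟩ := hc2
      obtain ⟨d, hd, r, hr, hrd⟩ := h.exists_rstr c hc hn
      have aux : ∀ b ∈ B.hyps, ∀ t : K, rstr e c = t • b → b = d := by
        intro b hb t ht
        by_contra hbd
        refine B.nonprop d hd b hb (Ne.symm hbd) (r⁻¹ * t) ?_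
        rw [mul_smul, ← ht, hrd, smul_smul, inv_mul_cancel₀ hr, one_smul]
      exact hne ((aux c' hc' t ht).trans (aux c'' hc'' s hs).symm)
  choose a ha0 ha using h.pullP_Qrest_flat
  refine ⟨∏ c' ∈ B.hyps, a c', Finset.prod_ne_zero_iff.2 fun c' _ => ha0 c', ?_⟩
  rw [hsplit, map_prod, map_prod, ← Finset.prod_mul_distrib]
  exact Finset.prod_congr rfl fun x _ => ha x

/-- The restriction of a logarithmic one-form of the deletion. -/
theorem exists_Qpoly_smul_eq (h : IsEuler A m c0 e q v B ms) {f : PS K ℓ} {τ : ExtF K ℓ}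
    (hτ1 : τ ∈ formsP K ℓ 1)
    (hτ : f • dP c0 + linP c0 ^ (m c0 - 1) • τ ∈ Omega A (mdel m c0) 1) :
    ∃ θ ∈ Omega B ms 1, Qpoly B ms • pullF e τ = pullP e (Qrest A c0 m) • θ := by
  have hα : linP c0 ≠ 0 := linP_ne_zero h.split.ne_zero
  obtain ⟨m0, hm0⟩ := Nat.exists_eq_succ_of_ne_zero h.pos.ne'
  obtain ⟨a, ha, hQ⟩ := h.pullP_Qrest
  have hCa : IsUnit (C a : PS K n) := (isUnit_iff_ne_zero.2 ha).map C
  have hmul : ∀ c' ∈ B.hyps, SDvd (linP c' ^ restMult A e c0 m c')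
      (linP c' ^ ms c' • pullF e τ) := by
    intro c' hc'
    obtain ⟨η, hη, u, hu, hres⟩ := h.exists_form c' hc'
    obtain ⟨ξ, hξ⟩ := (mem_Omega.1 hη).2 c0 (h.mem_flat c')
    have hηd : η = dP c0 * contr v η + linP c0 ^ m c0 • contr v ξ := by
      conv_lhs => rw [h.split.eq_add_contr η, hξ, map_smul]
    obtain ⟨ζ, -, hζ⟩ := Omega_mul (Omega_le_of_le (mdel_le m c0) _ hη)
      (Omega_flatArr (e := e) (c' := c') hτ)
    have key : η * (f • dP c0 + linP c0 ^ (m c0 - 1) • τ) = linP c0 ^ m0 •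
        (dP c0 * (contr v η * τ) + linP c0 • (contr v ξ *
          (f • dP c0 + linP c0 ^ (m c0 - 1) • τ))) := by
      conv_lhs => rw [hηd, add_mul, smul_mul_assoc]
      conv_lhs => enter [1]; rw [mul_add, mul_smul_comm, dP_mul_mul_dP, smul_zero, zero_add,
        mul_smul_comm, mul_assoc]
      rw [smul_add, ← mul_smul, hm0, pow_succ, Nat.succ_sub_one]
    rw [key, Qpoly_mdel_eq (h.mem_flat c'), hm0, Nat.succ_sub_one, mul_smul] at hζ
    have h2 := h.sdvd_res_flat ⟨ζ, smul_left_cancel (pow_ne_zero m0 hα) hζ⟩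
    rw [map_add, h.split.res_smul_self, add_zero, h.split.res_dP_mul, map_mul, ← res_apply,
      hres, ← Algebra.smul_def] at h2
    exact sdvd_C_mul hu h2
  have hdP : ∀ c' ∈ B.hyps, SDvd (linP c' ^ restMult A e c0 m c') (dP c' * pullF e τ) := by
    intro c' hc'
    have h1 : SDvd (Qrest (flatArr A e c') c0 m) (dP c0 * (dP (rstr q c') * τ)) := by
      refine sdvd_Qrest fun c hc hne => ?_
      obtain ⟨hcA, t, ht⟩ := mem_flatArr.1 hc
      have ht0 : t ≠ 0 := by
        rintro rfl
        have := h.split.sub_rstr c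
        rw [ht, rstr_smul, zero_smul, zero_add] at this
        exact A.nonprop c hcA c0 h.mem hne _ this
      have h2 := ((mem_Omega.1 hτ).2 c hcA).mul_left (dP c0)
      have h3 : dP c0 * (dP c * (f • dP c0 + linP c0 ^ (m c0 - 1) • τ)) =
          linP c0 ^ (m c0 - 1) • (C t : PS K ℓ) • (dP c0 * (dP (rstr q c') * τ)) := by
        have hdc : dP c0 * dP c = (C t : PS K ℓ) • (dP c0 * dP (rstr q c')) := by
          conv_lhs => rw [h.split.sub_rstr c, ht, rstr_smul, dP_add, dP_smul, dP_smul]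
          rw [mul_add, mul_smul_comm, mul_smul_comm, dP_mul_self, smul_zero, add_zero]
        rw [← mul_assoc, mul_add, mul_smul_comm, dP_mul_mul_dP, smul_zero, zero_add,
          mul_smul_comm, hdc, smul_mul_assoc, mul_assoc]
      rw [h3, mdel_of_ne hne] at h2
      have h4 := SDvd.of_smul ((isRelPrime_of_mem_hyps A hcA h.mem hne).pow) h2
      have h5 := h4.smul (C t⁻¹)
      rwa [← mul_smul, ← C_mul, inv_mul_cancel₀ ht0, C_1, one_smul] at h5
    have h2 := h.sdvd_res_flat h1
    rwa [h.split.res_dP_mul, map_mul, pullF_dP, h.split.rstr_rstr] at h2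
  obtain ⟨θ, hθ⟩ : SDvd (pullP e (Qrest A c0 m)) (Qpoly B ms • pullF e τ) := by
    rw [hQ]
    refine SDvd.of_dvd (hCa.mul_left_dvd.2 dvd_rfl) (sdvd_prod (pairwise_isRelPrime_hyps B _) ?_)
    intro c' hc'
    obtain ⟨g, hg⟩ := linP_pow_dvd_Qpoly hc' ms
    rw [hg, mul_comm, mul_smul]
    exact (hmul c' hc').smul g
  have hne : pullP e (Qrest A c0 m) ≠ 0 := by
    rw [hQ]
    exact mul_ne_zero hCa.ne_zero (Finset.prod_ne_zero_iff.2 fun c' hc' =>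
      pow_ne_zero _ (linP_ne_zero (B.ne_zero c' hc')))
  refine ⟨θ, mem_Omega.2 ⟨mem_formsP_of_smul hne (hθ ▸ Submodule.smul_mem _ _ (pullF_mem e hτ1)),
    fun c' hc' => ?_⟩, hθ⟩
  obtain ⟨ξ, hξ⟩ := hdP c' hc'
  obtain ⟨g, hg⟩ := linP_pow_dvd_Qpoly hc' ms
  have hβ : linP c' ^ restMult A e c0 m c' ≠ 0 :=
    pow_ne_zero _ (linP_ne_zero (B.ne_zero c' hc'))
  have h1 : linP c' ^ restMult A e c0 m c' • (C a * ∏ d ∈ B.hyps.erase c',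
      linP d ^ restMult A e c0 m d) • (dP c' * θ) =
      linP c' ^ restMult A e c0 m c' • Qpoly B ms • ξ := by
    rw [← mul_smul, mul_left_comm, Finset.mul_prod_erase _ (fun d => linP d ^ _) hc', ← hQ,
      ← mul_smul_comm, ← hθ, mul_smul_comm, hξ, smul_comm]
  have h2 := smul_left_cancel hβ h1
  have h3 : SDvd (linP c' ^ ms c') ((C a * ∏ d ∈ B.hyps.erase c',
      linP d ^ restMult A e c0 m d) • (dP c' * θ)) := by
    rw [h2]
    exact sdvd_smul_of_dvd (linP_pow_dvd_Qpoly hc' ms) _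
  refine SDvd.of_smul ?_ (sdvd_C_mul ha h3)
  exact IsRelPrime.prod_right fun d hd => (isRelPrime_of_mem_hyps B hc'
    (Finset.mem_of_mem_erase hd) (Finset.ne_of_mem_erase hd).symm).pow

end IsEuler

end EulerRestriction

section LocalSurjectivity

variable {n : ℕ} {c0 : Fin ℓ → K} {e : (Fin n → K) →ₗ[K] (Fin ℓ → K)}
  {q : (Fin ℓ → K) →ₗ[K] (Fin n → K)} {v : Fin ℓ → K}
  {A : Arrangement K ℓ} {m : (Fin ℓ → K) → ℕ}
  {B : Arrangement K n} {ms : (Fin n → K) → ℕ}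
  {T : (Fin ℓ → PS K ℓ) →ₗ[PS K ℓ] (Fin ℓ → PS K ℓ)}

namespace IsEuler

theorem exists_eq_smul_dP_add (h : IsEuler A m c0 e q v B ms) {b : ExtF K ℓ}
    (hb : b ∈ Omega A (mdel m c0) 1) :
    ∃ f : PS K ℓ, ∃ τ ∈ formsP K ℓ 1, b = f • dP c0 + linP c0 ^ (m c0 - 1) • τ := by
  obtain ⟨hb1, hb2⟩ := mem_Omega.1 hb
  obtain ⟨ξ, hξ⟩ := hb2 c0 h.mem
  rw [mdel_self] at hξ
  obtain ⟨f, hf⟩ := eq_algebraMap_of_mem_formsP_zero (contr_mem v hb1).1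
  have hξ2 : ξ ∈ formsP K ℓ 2 := mem_formsP_of_smul
    (pow_ne_zero (m c0 - 1) (linP_ne_zero h.split.ne_zero)) (hξ ▸ dP_mul_mem c0 hb1)
  refine ⟨f, contr v ξ, (contr_mem v hξ2).1, ?_⟩
  conv_lhs => rw [h.split.eq_add_contr b, hξ, map_smul, hf, ← Algebra.commutes,
    ← Algebra.smul_def]

theorem exists_mul_pullF_eq (h : IsEuler A m c0 e q v B ms) {f : PS K ℓ} {τ : ExtF K ℓ}
    (hτ1 : τ ∈ formsP K ℓ 1)
    (hτ : f • dP c0 + linP c0 ^ (m c0 - 1) • τ ∈ Omega A (mdel m c0) 1) {p : ℕ} {y : ExtF K n}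
    (hy : y ∈ Omega B ms p) :
    ∃ κ ∈ Omega B ms (p + 1), y * pullF e τ = pullP e (Qrest A c0 m) • κ := by
  obtain ⟨θ, hθ, hQ⟩ := h.exists_Qpoly_smul_eq hτ1 hτ
  obtain ⟨κ, hκ, hyκ⟩ := Omega_mul hy hθ
  refine ⟨κ, hκ, smul_left_cancel (Qpoly_ne_zero B ms) ?_⟩
  rw [← mul_smul_comm, hQ, mul_smul_comm, hyκ, smul_comm]

theorem exists_dP_mul_map_eq (h : IsEuler A m c0 e q v B ms)
    (hT : ∀ x, ExteriorAlgebra.ι (PS K ℓ) (T x) ∈ Omega A (mdel m c0) 1) {r : ℕ} {x : ExtF K ℓ}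
    (hx : x ∈ formsP K ℓ r) :
    ∃ τ, dP c0 * ExteriorAlgebra.map T x = linP c0 ^ ((m c0 - 1) * r) • (dP c0 * τ) ∧
      ∀ p, ∀ y ∈ Omega B ms p, ∃ κ ∈ Omega B ms (p + r),
        y * pullF e τ = pullP e (Qrest A c0 m) ^ r • κ := by
  refine formsP_induction (P := fun r x => ∃ τ, dP c0 * ExteriorAlgebra.map T x =
      linP c0 ^ ((m c0 - 1) * r) • (dP c0 * τ) ∧ ∀ p, ∀ y ∈ Omega B ms p,
      ∃ κ ∈ Omega B ms (p + r), y * pullF e τ = pullP e (Qrest A c0 m) ^ r • κ) ?_ ?_ ?_ ?_ hx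
  · intro f
    refine ⟨algebraMap _ _ f, ?_, fun p y hy => ⟨pullP e f • y, Submodule.smul_mem _ _ hy, ?_⟩⟩
    · rw [AlgHom.commutes, mul_zero, pow_zero, one_smul]
    · rw [pullF_algebraMap, ← Algebra.commutes, ← Algebra.smul_def, pow_zero, one_smul]
  · rintro r x x' ⟨τ, h1, h2⟩ ⟨τ', h1', h2'⟩
    refine ⟨τ + τ', by rw [map_add, mul_add, h1, h1', mul_add, smul_add], fun p y hy => ?_⟩
    obtain ⟨κ, hκ, hk⟩ := h2 p y hy
    obtain ⟨κ', hκ', hk'⟩ := h2' p y hy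
    exact ⟨κ + κ', add_mem hκ hκ', by rw [map_add, mul_add, hk, hk', smul_add]⟩
  · rintro r f x ⟨τ, h1, h2⟩
    refine ⟨f • τ, by rw [map_smul, mul_smul_comm, h1, mul_smul_comm, smul_comm], fun p y hy => ?_⟩
    obtain ⟨κ, hκ, hk⟩ := h2 p y hy
    exact ⟨pullP e f • κ, Submodule.smul_mem _ _ hκ,
      by rw [pullF_smul, mul_smul_comm, hk, smul_comm]⟩
  · rintro r c x - ⟨τ, h1, h2⟩
    have hb : ExteriorAlgebra.map T (dP c) ∈ Omega A (mdel m c0) 1 := by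
      rw [dP, ExteriorAlgebra.map_apply_ι]; exact hT _
    obtain ⟨f, τ1, hτ1, hbd⟩ := h.exists_eq_smul_dP_add hb
    rw [hbd] at hb
    refine ⟨τ1 * τ, ?_, fun p y hy => ?_⟩
    · obtain ⟨z, hz⟩ := exists_dP_mul_eq_mul_dP c0 τ1
      rw [map_mul, hbd, ← mul_assoc, mul_add, mul_smul_comm, dP_mul_self, smul_zero, zero_add,
        mul_smul_comm, smul_mul_assoc, hz, mul_assoc, h1, mul_smul_comm, ← mul_assoc, ← hz,
        ← mul_smul, ← pow_add, mul_assoc, mul_add, mul_one, add_comm]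
    · obtain ⟨κ1, hκ1, hk1⟩ := h.exists_mul_pullF_eq hτ1 hb hy
      obtain ⟨κ, hκ, hk⟩ := h2 _ κ1 hκ1
      refine ⟨κ, by rwa [add_assoc, add_comm 1 r] at hκ, ?_⟩
      rw [map_mul, ← mul_assoc, hk1, smul_mul_assoc, hk, ← mul_smul, pow_succ']

theorem exists_mul_map_eq (h : IsEuler A m c0 e q v B ms)
    (hT : ∀ x, ExteriorAlgebra.ι (PS K ℓ) (T x) ∈ Omega A (mdel m c0) 1) {r : ℕ} {x : ExtF K ℓ}
    (hx : x ∈ formsP K ℓ r) {p : ℕ} {y : ExtF K n} (hy : y ∈ Omega B ms p) :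
    ∃ κ k : ExtF K ℓ, dP c0 * pullF q y * ExteriorAlgebra.map T x =
      linP c0 ^ ((m c0 - 1) * r) • (Qrest A c0 m ^ r • κ + linP c0 • k) := by
  obtain ⟨τ, hτ, hκ⟩ := h.exists_dP_mul_map_eq hT hx
  obtain ⟨κ, -, hk⟩ := hκ p y hy
  have h0 : pullF e (pullF q y * τ - Qrest A c0 m ^ r • pullF q κ) = 0 := by
    rw [map_sub, map_mul, h.split.pullF_pullF, pullF_smul, h.split.pullF_pullF, hk, map_pow,
      sub_self]
  obtain ⟨k, hk⟩ := (h.split.pullF_eq_zero_iff _).1 h0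
  refine ⟨dP c0 * pullF q κ, k, ?_⟩
  obtain ⟨z, hz⟩ := exists_dP_mul_eq_mul_dP c0 (pullF q y)
  rw [hz, mul_assoc, hτ, mul_smul_comm, ← mul_assoc, ← hz, mul_assoc, ← hk, mul_sub,
    mul_smul_comm, add_sub_cancel]

/-- The residue is surjective if the deletion is free. -/
theorem exists_res_eq (h : IsEuler A m c0 e q v B ms) (hF : FreeM A (mdel m c0)) {p : ℕ}
    (hp : p + 1 ≤ ℓ) {y : ExtF K n} (hy : y ∈ Omega B ms p) :
    ∃ η ∈ Omega A m (p + 1), res e v η = y := by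
  have hα : linP c0 ≠ 0 := linP_ne_zero h.split.ne_zero
  obtain ⟨r, hr⟩ := Nat.exists_eq_add_of_le hp
  obtain ⟨T, hT, hdet⟩ := exists_range_eq hF
  have hT' : ∀ x, ExteriorAlgebra.ι (PS K ℓ) (T x) ∈ Omega A (mdel m c0) 1 :=
    fun x => (hT _).2 ⟨x, rfl⟩
  obtain ⟨u, hu, hdetu⟩ := exists_isUnit_det (by omega) hT
  set ψ := dP c0 * pullF q y with hψ
  have hψmem : ψ ∈ formsP K ℓ (p + 1) := dP_mul_mem c0 (pullF_mem q (mem_Omega.1 hy).1)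
  have key : ∀ s : Finset (Fin ℓ), ∃ ξ ∈ Omega A (mdel m c0) (p + 1), ∃ f g : PS K ℓ,
      (sgn K s * top K ℓ (ψ * ExteriorAlgebra.map T (extBasis K ℓ sᶜ))) •
        ExteriorAlgebra.map T (extBasis K ℓ s) =
      (linP c0 ^ ((m c0 - 1) * r) * Qpoly A (mdel m c0) ^ p) •
        ((Qrest A c0 m ^ r * f + linP c0 * g) • ξ) := by
    intro s
    have hsc : sᶜ.card = ℓ - s.card := by rw [Finset.card_compl, Fintype.card_fin]
    have hsl : s.card ≤ ℓ := by simpa using s.card_le_univ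
    by_cases hs : s.card = p + 1
    · obtain ⟨ξ, hξ, hξs⟩ := map_eq_smul hT' (hs ▸ extBasis_mem (K := K) s)
      have hsr : sᶜ.card = r := by omega
      obtain ⟨κ, k, hκ⟩ := h.exists_mul_map_eq hT' (hsr ▸ extBasis_mem (K := K) sᶜ) hy
      refine ⟨ξ, hξ, sgn K s * top K ℓ κ, sgn K s * top K ℓ k, ?_⟩
      rw [hξs, hκ, map_smul, map_add, map_smul, map_smul, ← mul_smul, ← mul_smul]
      congr 1
      simp only [smul_eq_mul]
      ring
    · refine ⟨0, zero_mem _, 0, 0, ?_⟩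
      rw [top_eq_zero (r := p + 1 + sᶜ.card) (by omega)
        (formsP_mul hψmem (map_mem T (extBasis_mem _))), mul_zero, zero_smul, smul_zero, smul_zero]
  choose ξ hξ f g hfg using key
  have hsum := det_smul_eq_sum hdet ψ
  rw [Finset.sum_congr rfl fun s _ => hfg s, ← Finset.smul_sum, hdetu,
    show ℓ - 1 = p + r by omega, pow_add, mul_assoc] at hsum
  have hQ : Qpoly A (mdel m c0) ^ r = linP c0 ^ ((m c0 - 1) * r) * Qrest A c0 m ^ r := by
    rw [Qpoly_mdel_eq h.mem, mul_pow, pow_mul]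
  have hsum2 : (Qrest A c0 m ^ r * u) • ψ =
      ∑ s, (Qrest A c0 m ^ r * f s + linP c0 * g s) • ξ s := by
    refine smul_left_cancel (mul_ne_zero (pow_ne_zero ((m c0 - 1) * r) hα)
      (pow_ne_zero p (Qpoly_ne_zero A (mdel m c0)))) (Eq.trans ?_ hsum)
    rw [← mul_smul, hQ]
    congr 1
    ring
  obtain ⟨u', hu'⟩ := hu.exists_left_inv
  set η := u' • ∑ s, f s • ξ s with hη
  set ω := u' • ∑ s, g s • ξ s with hω
  have hηmem : η ∈ Omega A (mdel m c0) (p + 1) := Submodule.smul_mem _ _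
    (Submodule.sum_mem _ fun s _ => Submodule.smul_mem _ _ (hξ s))
  have hωmem : ω ∈ Omega A (mdel m c0) (p + 1) := Submodule.smul_mem _ _
    (Submodule.sum_mem _ fun s _ => Submodule.smul_mem _ _ (hξ s))
  have hdiff : Qrest A c0 m ^ r • (ψ - η) = linP c0 • ω := by
    have h1 : u' • ((Qrest A c0 m ^ r * u) • ψ) = Qrest A c0 m ^ r • ψ := by
      rw [← mul_smul, mul_left_comm, hu', mul_one]
    rw [smul_sub, ← h1, hsum2, hη, hω, smul_comm _ u', ← smul_sub, smul_comm _ u',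
      Finset.smul_sum, Finset.smul_sum, ← Finset.sum_sub_distrib]
    congr 1
    refine Finset.sum_congr rfl fun s _ => ?_
    rw [add_smul, mul_smul, mul_smul, add_sub_cancel_left]
  have hrel : ∀ k, IsRelPrime (linP c0 ^ k) (Qrest A c0 m ^ r) := fun k =>
    (isRelPrime_Qrest h.mem k).pow_right
  refine ⟨η, mem_Omega.2 ⟨(mem_Omega.1 hηmem).1, fun c hc => ?_⟩, ?_⟩
  · by_cases hcc : c = c0
    · subst hcc
      obtain ⟨ζ, hζ⟩ := (mem_Omega.1 hωmem).2 c h.mem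
      rw [mdel_self] at hζ
      refine SDvd.of_smul (hrel (m c)) ⟨-ζ, ?_⟩
      have h1 := congrArg (fun x => dP c * x) hdiff
      simp only [mul_smul_comm, mul_sub, hψ, ← mul_assoc, dP_mul_self, zero_mul, zero_sub,
        hζ] at h1
      rw [smul_neg] at h1
      rw [smul_neg, neg_eq_iff_eq_neg.1 h1, ← mul_smul, ← pow_succ', Nat.sub_add_cancel h.pos]
    · have := (mem_Omega.1 hηmem).2 c hc
      rwa [mdel_of_ne hcc] at this
  · obtain ⟨ζ, hζ⟩ : SDvd (linP c0) (ψ - η) := by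
      refine SDvd.of_smul (pow_one (linP c0) ▸ hrel 1) (hdiff ▸ sdvd_smul_self _ _)
    have h1 := congrArg (res e v) hζ
    rw [h.split.res_smul_self, map_sub, h.split.res_dP_mul, h.split.pullF_pullF, sub_eq_zero] at h1
    exact h1.symm

end IsEuler

end LocalSurjectivity

section Localization
variable {n : ℕ} {c0 : Fin ℓ → K} {e : (Fin n → K) →ₗ[K] (Fin ℓ → K)}
  {q : (Fin ℓ → K) →ₗ[K] (Fin n → K)} {v : Fin ℓ → K}
  {A : Arrangement K ℓ} {m : (Fin ℓ → K) → ℕ} {B : Arrangement K n} {ms : (Fin n → K) → ℕ}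

theorem isEuler_of_isEulerMult {e : (Fin (ℓ - 1) → K) →ₗ[K] (Fin ℓ → K)}
    {q : (Fin ℓ → K) →ₗ[K] (Fin (ℓ - 1) → K)} {B : Arrangement K (ℓ - 1)}
    {ms : (Fin (ℓ - 1) → K) → ℕ} (h : IsSplit c0 e q v) (hm : ∀ c ∈ A.hyps, 0 < m c)
    (hc0 : c0 ∈ A.hyps) (hB : IsRestrictionOf B A c0 e) (hms : IsEulerMult A m c0 e B ms) :
    IsEuler A m c0 e q v B ms := by
  have key : ∀ c' ∈ B.hyps, ms c' ≤ restMult A e c0 m c' ∧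
      (∃ η ∈ Omega (flatArr A e c') m 1, ∃ u : K, u ≠ 0 ∧
        res e v η = algebraMap _ _ (C u * linP c' ^ ms c')) ∧
      ∃ (f : PS K ℓ) (τ : ExtF K ℓ) (u : K), u ≠ 0 ∧
        f • dP c0 + linP c0 ^ (m c0 - 1) • τ ∈ Omega (flatArr A e c') (mdel m c0) 1 ∧
        pullF e τ = (C u * linP c' ^ (restMult A e c0 m c' - ms c')) • dP c' := fun c' hc' => by
    obtain ⟨d1, d2, hF, hF', hd⟩ := hms c' hc'
    obtain ⟨c1, hc1, hne, t, -, ht⟩ := hB.2 c' hc'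
    have hℓ : 2 ≤ ℓ := by
      by_contra hlt
      exact B.ne_zero c' hc' (funext fun i => absurd i.2 (by omega))
    have := h.exists_euler_forms (A := flatArr A e c') (m := m) hℓ
      (mem_flatArr.2 ⟨hc0, 0, by rw [h.rstr_self, zero_smul]⟩)
      (fun c hc => hm c (mem_flatArr.1 hc).1) (B.ne_zero c' hc')
      (fun c hc => (mem_flatArr.1 hc).2) (mem_flatArr.2 ⟨hc1, t, ht⟩) hne hF hF'
    rw [← hd] at this
    exact this
  exact ⟨h, hc0, hm c0 hc0, hB.1, fun c' hc' => (key c' hc').1, fun c' hc' => (key c' hc').2.1,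
    fun c' hc' => (key c' hc').2.2⟩

theorem mem_locArr {c x : Fin ℓ → K} : c ∈ (locArr A x).hyps ↔ c ∈ A.hyps ∧ dot c x = 0 :=
  Finset.mem_filter

theorem Arrangement_ext {A A' : Arrangement K ℓ} (h : A.hyps = A'.hyps) : A = A' := by
  cases A; cases A'; cases h; rfl

theorem flatArr_locArr {x c' : Fin n → K} (h : dot c' x = 0) :
    flatArr (locArr A (e x)) e c' = flatArr A e c' := by
  refine Arrangement_ext (Finset.ext fun c => ?_)
  rw [mem_flatArr, mem_flatArr, mem_locArr]
  constructor
  · rintro ⟨⟨hc, -⟩, ht⟩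
    exact ⟨hc, ht⟩
  · rintro ⟨hc, t, ht⟩
    exact ⟨⟨hc, by rw [← dot_rstr, ht, smul_dot, h, mul_zero]⟩, t, ht⟩

theorem IsEuler.loc (h : IsEuler A m c0 e q v B ms) (x : Fin n → K) :
    IsEuler (locArr A (e x)) m c0 e q v (locArr B x) ms where
  split := h.split
  mem := mem_locArr.2 ⟨h.mem, h.split.dot_e x⟩
  pos := h.pos
  exists_rstr := fun c hc hne => by
    obtain ⟨hc, hx⟩ := mem_locArr.1 hc
    obtain ⟨c', hc', t, ht, hct⟩ := h.exists_rstr c hc hne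
    refine ⟨c', mem_locArr.2 ⟨hc', ?_⟩, t, ht, hct⟩
    rw [← dot_rstr, hct, smul_dot] at hx
    exact (mul_eq_zero.1 hx).resolve_left ht
  le_restMult := fun c' hc' => by
    rw [restMult, flatArr_locArr (mem_locArr.1 hc').2]
    exact h.le_restMult c' (mem_locArr.1 hc').1
  exists_form := fun c' hc' => by
    rw [flatArr_locArr (mem_locArr.1 hc').2]
    exact h.exists_form c' (mem_locArr.1 hc').1
  exists_form_mdel := fun c' hc' => by
    rw [restMult, flatArr_locArr (mem_locArr.1 hc').2]
    exact h.exists_form_mdel c' (mem_locArr.1 hc').1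

theorem Omega_locArr (x : Fin ℓ → K) {p : ℕ} : Omega A m p ≤ Omega (locArr A x) m p :=
  fun _ hη => mem_Omega.2
    ⟨(mem_Omega.1 hη).1, fun c hc => (mem_Omega.1 hη).2 c (mem_locArr.1 hc).1⟩

/-- The product of the powers of the defining forms that do not vanish at `x`. -/
def Qaway (A : Arrangement K ℓ) (m : (Fin ℓ → K) → ℕ) (x : Fin ℓ → K) : PS K ℓ :=
  ∏ c ∈ A.hyps.filter (fun c => dot c x ≠ 0), linP c ^ m c

theorem Qaway_smul_mem {x : Fin ℓ → K} {p : ℕ} {η : ExtF K ℓ} (hη : η ∈ Omega (locArr A x) m p) :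
    Qaway A m x • η ∈ Omega A m p := by
  obtain ⟨h1, h2⟩ := mem_Omega.1 hη
  refine mem_Omega.2 ⟨Submodule.smul_mem _ _ h1, fun c hc => ?_⟩
  rw [mul_smul_comm]
  by_cases hx : dot c x = 0
  · exact (h2 c (mem_locArr.2 ⟨hc, hx⟩)).smul _
  · exact sdvd_smul_of_dvd
      (Finset.dvd_prod_of_mem (fun c => linP c ^ m c) (Finset.mem_filter.2 ⟨hc, hx⟩)) _

theorem IsEuler.exists_res_eq_Qaway_smul (h : IsEuler A m c0 e q v B ms)
    (hF : LocallyFreeAlong A (mdel m c0) c0) {x : Fin n → K} (hx : x ≠ 0) {p : ℕ}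
    (hp : p + 1 ≤ ℓ) {y : ExtF K n} (hy : y ∈ Omega B ms p) :
    ∃ η ∈ Omega A m (p + 1), res e v η = pullP e (Qaway A m (e x)) • y := by
  have hex : e x ≠ 0 := fun h0 => hx (by rw [← h.split.q_e x, h0, map_zero])
  obtain ⟨η, hη, rfl⟩ := (h.loc x).exists_res_eq (hF _ hex (h.split.dot_e x)) hp
    (Omega_locArr x hy)
  exact ⟨Qaway A m (e x) • η, Qaway_smul_mem hη, res_smul (Qaway A m (e x)) η⟩

end Localization

section Saturation

variable {A : Arrangement K ℓ} {m : (Fin ℓ → K) → ℕ}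

theorem mem_Omega_of_vars_smul_mem (hℓ : 2 ≤ ℓ) {p : ℕ} {η : ExtF K ℓ}
    (h : ∀ i, (X i : PS K ℓ) • η ∈ Omega A m p) : η ∈ Omega A m p := by
  have hX : (X ⟨0, by omega⟩ : PS K ℓ) ≠ 0 := X_ne_zero _
  have h0 := (mem_Omega.1 (h ⟨0, by omega⟩)).1
  refine mem_Omega.2 ⟨mem_formsP_of_smul hX h0, fun c hc => ?_⟩
  obtain ⟨i, hi⟩ : ∃ i, ∀ t : K, Pi.single i (1 : K) ≠ t • c := by
    by_contra! hcon
    obtain ⟨s, hs⟩ := hcon ⟨0, by omega⟩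
    obtain ⟨t, ht⟩ := hcon ⟨1, by omega⟩
    have hs0 := congrFun hs ⟨0, by omega⟩
    have hs1 := congrFun hs ⟨1, by omega⟩
    have ht1 := congrFun ht ⟨1, by omega⟩
    simp at hs0 hs1 ht1
    rcases hs1 with h0 | h0
    · simp [h0] at hs0
    · simp [h0] at ht1
  have h1 := (mem_Omega.1 (h i)).2 c hc
  rw [mul_smul_comm, ← linP_single] at h1
  exact SDvd.of_smul (isRelPrime_linP (A.ne_zero c hc) hi).pow_left h1

end Saturation

section ResidueSequence
variable {n : ℕ} {c0 : Fin ℓ → K} {e : (Fin n → K) →ₗ[K] (Fin ℓ → K)}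
  {q : (Fin ℓ → K) →ₗ[K] (Fin n → K)} {v : Fin ℓ → K}
  {A : Arrangement K ℓ} {m : (Fin ℓ → K) → ℕ} {B : Arrangement K n} {ms : (Fin n → K) → ℕ}

/-- The logarithmic forms of `(B, ms)`, regarded as a module over the polynomial ring of the
ambient space. -/
def RestrOmega (_e : (Fin n → K) →ₗ[K] (Fin ℓ → K)) (B : Arrangement K n)
    (ms : (Fin n → K) → ℕ) (p : ℕ) : Type := Omega B ms p

instance (p : ℕ) : AddCommGroup (RestrOmega e B ms p) :=
  inferInstanceAs (AddCommGroup (Omega B ms p))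

instance (p : ℕ) : Module (PS K n) (RestrOmega e B ms p) :=
  inferInstanceAs (Module (PS K n) (Omega B ms p))

instance (p : ℕ) : Module (PS K ℓ) (RestrOmega e B ms p) :=
  Module.compHom (RestrOmega e B ms p) (pullP e).toRingHom

/-- The underlying form of an element of `RestrOmega`. -/
def RestrOmega.form {p : ℕ} (y : RestrOmega e B ms p) : ExtF K n := Subtype.val y

theorem RestrOmega.form_smul {p : ℕ} (f : PS K ℓ) (y : RestrOmega e B ms p) :
    (f • y).form = pullP e f • y.form := rfl

theorem RestrOmega.form_mem {p : ℕ} (y : RestrOmega e B ms p) : y.form ∈ Omega B ms p := y.2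

theorem RestrOmega.ext {p : ℕ} {y z : RestrOmega e B ms p} (h : y.form = z.form) : y = z :=
  Subtype.ext h

theorem smul_mem_Omega (hpos : 0 < m c0) {p : ℕ} {η : ExtF K ℓ}
    (hη : η ∈ Omega A (mdel m c0) p) : linP c0 • η ∈ Omega A m p := by
  obtain ⟨h1, h2⟩ := mem_Omega.1 hη
  refine mem_Omega.2 ⟨Submodule.smul_mem _ _ h1, fun c hc => ?_⟩
  rw [mul_smul_comm]
  by_cases h : c = c0
  · subst h
    have := (h2 c hc).smul_smul (g := linP c)
    rwa [mdel_self, ← pow_succ', Nat.sub_add_cancel hpos] at this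
  · have := (h2 c hc).smul (linP c0)
    rwa [mdel_of_ne h] at this

theorem mem_Omega_mdel_of_smul (hc0 : c0 ∈ A.hyps) (hpos : 0 < m c0) {p : ℕ} {η : ExtF K ℓ}
    (hη : linP c0 • η ∈ Omega A m p) : η ∈ Omega A (mdel m c0) p := by
  obtain ⟨h1, h2⟩ := mem_Omega.1 hη
  have hα : linP c0 ≠ 0 := linP_ne_zero (A.ne_zero c0 hc0)
  refine mem_Omega.2 ⟨mem_formsP_of_smul hα h1, fun c hc => ?_⟩
  have h3 := h2 c hc
  rw [mul_smul_comm] at h3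
  by_cases h : c = c0
  · subst h
    rw [mdel_self]
    refine sdvd_of_smul_smul hα ?_
    rwa [← pow_succ', Nat.sub_add_cancel hpos]
  · rw [mdel_of_ne h]
    exact SDvd.of_smul (isRelPrime_of_mem_hyps A hc hc0 h).pow_left h3

/-- Multiplication by the defining form of the hyperplane. -/
def mulLin (A : Arrangement K ℓ) (hpos : 0 < m c0) (p : ℕ) :
    Omega A (mdel m c0) p →ₗ[PS K ℓ] Omega A m p where
  toFun η := ⟨linP c0 • η.1, smul_mem_Omega hpos η.2⟩
  map_add' _ _ := Subtype.ext (smul_add _ _ _)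
  map_smul' _ _ := Subtype.ext (smul_comm _ _ _)

theorem mulLin_injective (hc0 : c0 ∈ A.hyps) (hpos : 0 < m c0) (p : ℕ) :
    Function.Injective (mulLin A hpos p) := fun _ _ h =>
  Subtype.ext (smul_left_cancel (linP_ne_zero (A.ne_zero c0 hc0)) (congrArg Subtype.val h))

theorem mem_range_mulLin (hc0 : c0 ∈ A.hyps) (hpos : 0 < m c0) {p : ℕ} {η : Omega A m p}
    (hη : SDvd (linP c0) η.1) : η ∈ Set.range (mulLin A hpos p) := by
  obtain ⟨ξ, hξ⟩ := hη
  exact ⟨⟨ξ, mem_Omega_mdel_of_smul hc0 hpos (hξ ▸ η.2)⟩, Subtype.ext hξ.symm⟩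

theorem sdvd_dP_mul_of_mem_Omega (hc0 : c0 ∈ A.hyps) (hpos : 0 < m c0) {p : ℕ} {η : ExtF K ℓ}
    (hη : η ∈ Omega A m p) : SDvd (linP c0) (dP c0 * η) :=
  ((mem_Omega.1 hη).2 c0 hc0).of_dvd (dvd_pow_self _ hpos.ne')

namespace IsEuler

/-- The residue map on logarithmic forms. -/
def resLin (h : IsEuler A m c0 e q v B ms) (p : ℕ) :
    Omega A m (p + 1) →ₗ[PS K ℓ] RestrOmega e B ms p where
  toFun η := ⟨res e v η.1, h.res_mem_Omega η.2⟩
  map_add' _ _ := Subtype.ext (map_add _ _ _)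
  map_smul' f η := Subtype.ext (res_smul f η.1)

theorem exact (h : IsEuler A m c0 e q v B ms) (p : ℕ) :
    Function.Exact (mulLin A h.pos (p + 1)) (h.resLin p) := by
  intro η
  constructor
  · intro hη
    exact mem_range_mulLin h.mem h.pos (h.split.sdvd_of_res_eq_zero
      (sdvd_dP_mul_of_mem_Omega h.mem h.pos η.2) (congrArg RestrOmega.form hη))
  · rintro ⟨ξ, rfl⟩
    exact RestrOmega.ext (h.split.res_smul_self ξ.1)

theorem mulLin_surjective (h : IsEuler A m c0 e q v B ms) :
    Function.Surjective (mulLin A h.pos 0) := fun η =>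
  mem_range_mulLin h.mem h.pos (h.split.sdvd_of_res_eq_zero
    (sdvd_dP_mul_of_mem_Omega h.mem h.pos η.2) (by
      rw [res_apply, (contr_mem v (mem_Omega.1 η.2).1).2 rfl, map_zero]))

theorem pdLE_restrOmega (h : IsEuler A m c0 e q v B ms) {p k : ℕ}
    (hB : pdLE (PS K n) k (Omega B ms p)) : pdLE (PS K ℓ) (k + 1) (RestrOmega e B ms p) := by
  let _ : Algebra (PS K ℓ) (PS K n) := (pullP e).toRingHom.toAlgebra
  have _ : IsScalarTower (PS K ℓ) (PS K n) (RestrOmega e B ms p) :=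
    ⟨fun f g y => mul_smul (pullP e f) g y⟩
  exact pdLE_restrictScalars (T := PS K n) (N := RestrOmega e B ms p)
    (mem_nonZeroDivisors_of_ne_zero (linP_ne_zero h.split.ne_zero)) h.split.pullP_surjective
    h.split.pullP_eq_zero_iff hB

theorem ext_Omega (hℓ : 2 ≤ ℓ) (p : ℕ) : Subsingleton
    (CategoryTheory.Abelian.Ext (resMod K ℓ) (ModuleCat.of (PS K ℓ) (Omega A m p)) 1) := by
  refine ext_one_of_saturated (G := ExtF K ℓ) hℓ (f := (Omega A m p).subtype)
    (Submodule.injective_subtype _) fun x hx => ?_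
  rw [Submodule.range_subtype] at hx ⊢
  exact mem_Omega_of_vars_smul_mem hℓ hx

theorem eq_zero_of_vars_smul_eq_zero (h : IsEuler A m c0 e q v B ms) (hn : 0 < n) {p : ℕ}
    (y : RestrOmega e B ms p) (hy : ∀ i, (X i : PS K ℓ) • y = 0) : y = 0 := by
  have h1 : ∀ c : Fin ℓ → K, linP c • y = 0 := fun c => by
    rw [linP, Finset.sum_smul]
    exact Finset.sum_eq_zero fun i _ => by rw [mul_smul, hy, smul_zero]
  have h2 := congrArg RestrOmega.form (h1 (rstr q (Pi.single ⟨0, hn⟩ 1)))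
  rw [RestrOmega.form_smul, pullP_linP, h.split.rstr_rstr, linP_single] at h2
  have hX : (X ⟨0, hn⟩ : PS K n) ≠ 0 := X_ne_zero _
  exact RestrOmega.ext (smul_left_cancel hX (h2.trans (smul_zero _).symm))

theorem resLin_surjective (h : IsEuler A m c0 e q v B ms) (hn : 0 < n)
    (hF : LocallyFreeAlong A (mdel m c0) c0) {p : ℕ} (hp : p + 4 ≤ ℓ)
    (hpd : pdLE (PS K ℓ) (p + 1) (Omega A (mdel m c0) (p + 1))) :
    Function.Surjective (h.resLin p) := by
  rw [← LinearMap.range_eq_top, ← Submodule.Quotient.subsingleton_iff]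
  by_contra hne
  rw [not_subsingleton_iff_nontrivial] at hne
  obtain ⟨P, hP⟩ := associatedPrimes.nonempty (PS K ℓ)
    (RestrOmega e B ms p ⧸ LinearMap.range (h.resLin p))
  obtain ⟨hprime, y', hy'⟩ := isAssociatedPrime_iff.1 hP
  obtain ⟨y, rfl⟩ := Submodule.Quotient.mk_surjective _ y'
  have hmem : ∀ f : PS K ℓ, f ∈ P ↔ f • y ∈ LinearMap.range (h.resLin p) := fun f => by
    rw [hy', Submodule.mem_colon_singleton, Submodule.mem_bot, ← Submodule.Quotient.mk_smul,
      Submodule.Quotient.mk_eq_zero]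
  let U : Submodule K (Fin ℓ → K) :=
    { carrier := {c | linP c ∈ P}
      add_mem' := fun {a b} ha hb => by
        change linP (a + b) ∈ P
        rw [linP_add]; exact P.add_mem ha hb
      zero_mem' := by
        change linP 0 ∈ P
        simp [linP]
      smul_mem' := fun t a ha => by
        change linP (t • a) ∈ P
        rw [linP_smul]; exact P.mul_mem_left _ ha }
  have hU0 : c0 ∈ U := (hmem _).2 ⟨0, RestrOmega.ext (by
    rw [RestrOmega.form_smul, h.split.pullP_self, zero_smul, map_zero]; rfl)⟩
  have hU : U = ⊤ := by
    by_contra hU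
    obtain ⟨φ, hφ, hle⟩ := U.exists_le_ker_of_lt_top (lt_top_iff_ne_top.2 hU)
    let x : Fin ℓ → K := fun i => φ (Pi.single i 1)
    have hx : ∀ c, dot c x = φ c := fun c => by
      rw [φ.pi_apply_eq_sum_univ c]
      simp only [dot, x, smul_eq_mul]
      refine Finset.sum_congr rfl fun i _ => ?_
      congr 2
      ext j
      simp [Pi.single_apply, eq_comm]
    have hx0 : dot c0 x = 0 := (hx c0).trans (hle hU0)
    have hqx : e (q x) = x := by
      have := h.split.split x
      rwa [hx0, zero_smul, add_zero] at this
    have hne : q x ≠ 0 := fun h0 => hφ (LinearMap.ext fun c => by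
      rw [← hx, ← hqx, h0, map_zero]; simp [dot])
    obtain ⟨η, hη, hres⟩ := h.exists_res_eq_Qaway_smul hF hne (by omega) y.form_mem
    have hQ : Qaway A m (e (q x)) ∈ P := (hmem _).2 ⟨⟨η, hη⟩, RestrOmega.ext hres⟩
    obtain ⟨c, hc, hcP⟩ := hprime.prod_mem_iff.1 hQ
    refine (Finset.mem_filter.1 hc).2 ?_
    rw [hqx, hx]
    exact hle (hprime.mem_of_pow_mem _ hcP)
  have hy : y ∈ LinearMap.range (h.resLin p) := by
    refine mem_range_of_vars_smul_mem_range (p := p + 1) (by omega) hpd (ext_Omega (by omega) _)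
      (mulLin_injective h.mem h.pos _) (h.exact p) (h.eq_zero_of_vars_smul_eq_zero hn) y
      fun i => (hmem _).1 ?_
    rw [← linP_single]
    exact (hU ▸ Submodule.mem_top : Pi.single i 1 ∈ U)
  refine hprime.ne_top (P.eq_top_iff_one.2 ((hmem 1).2 ?_))
  rwa [one_smul]

end IsEuler
end ResidueSequence

section ProjectiveDimension

variable {A : Arrangement K ℓ} {m : (Fin ℓ → K) → ℕ}

instance free_formsP (p : ℕ) : Module.Free (PS K ℓ) (formsP K ℓ p) := by
  change Module.Free (PS K ℓ) (⋀[PS K ℓ]^p (Fin ℓ → PS K ℓ))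
  infer_instance

/-- Componentwise multiplication by the powers of the defining forms. -/
def powLin (A : Arrangement K ℓ) (m : (Fin ℓ → K) → ℕ) :
    (A.hyps → ExtF K ℓ) →ₗ[PS K ℓ] (A.hyps → ExtF K ℓ) :=
  LinearMap.pi fun c => (linP c.1 ^ m c.1) • LinearMap.proj c

/-- The classes of the products of a form with the `dP c`, modulo the powers of the defining
forms. -/
def wedgeLin (A : Arrangement K ℓ) (m : (Fin ℓ → K) → ℕ) (p : ℕ) :
    formsP K ℓ p →ₗ[PS K ℓ] (A.hyps → ExtF K ℓ) ⧸ LinearMap.range (powLin A m) :=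
  (LinearMap.range (powLin A m)).mkQ ∘ₗ
    (LinearMap.pi fun c => LinearMap.mulLeft (PS K ℓ) (dP c.1)) ∘ₗ (formsP K ℓ p).subtype

theorem powLin_injective : Function.Injective (powLin A m) := fun _ _ h => funext fun c =>
  smul_left_cancel (pow_ne_zero (m c.1) (linP_ne_zero (A.ne_zero c.1 c.2))) (congrFun h c)

theorem mem_ker_wedgeLin {p : ℕ} {η : formsP K ℓ p} :
    η ∈ LinearMap.ker (wedgeLin A m p) ↔ η.1 ∈ Omega A m p := by
  rw [LinearMap.mem_ker, wedgeLin, LinearMap.comp_apply, Submodule.mkQ_apply,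
    Submodule.Quotient.mk_eq_zero, mem_Omega]
  constructor
  · rintro ⟨ξ, hξ⟩
    exact ⟨η.2, fun c hc => ⟨ξ ⟨c, hc⟩, (congrFun hξ ⟨c, hc⟩).symm⟩⟩
  · rintro ⟨-, h⟩
    choose ξ hξ using h
    exact ⟨fun c => ξ c.1 c.2, funext fun c => (hξ c.1 c.2).symm⟩

theorem map_ker_wedgeLin (p : ℕ) :
    (LinearMap.ker (wedgeLin A m p)).map (formsP K ℓ p).subtype = Omega A m p := by
  ext η
  constructor
  · rintro ⟨ξ, hξ, rfl⟩
    exact mem_ker_wedgeLin.1 hξ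
  · intro hη
    exact ⟨⟨η, (mem_Omega.1 hη).1⟩, mem_ker_wedgeLin.2 hη, rfl⟩

/-- Logarithmic forms of degree at least `ℓ - 2` satisfy the tameness bound. -/
theorem pdLE_Omega_of_le {p : ℕ} (hp : ℓ ≤ p + 2) : pdLE (PS K ℓ) p (Omega A m p) := by
  have hT : pdLE (PS K ℓ) (p + 1) ((A.hyps → ExtF K ℓ) ⧸ LinearMap.range (powLin A m)) :=
    pdLE_right powLin_injective (Submodule.mkQ_surjective _) (LinearMap.exact_map_mkQ_range _)
      (pdLE_of_projective p) (pdLE_of_projective (p + 1))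
  have hR : pdLE (PS K ℓ) (p + 1) (LinearMap.range (wedgeLin A m p)) :=
    pdLE_left (Submodule.injective_subtype _) (Submodule.mkQ_surjective _)
      (LinearMap.exact_subtype_mkQ _) hT (pdLE_mono hp (hilbert_syzygy ℓ _))
  have hk : pdLE (PS K ℓ) p (LinearMap.ker (wedgeLin A m p)) :=
    pdLE_left (Submodule.injective_subtype _) (wedgeLin A m p).surjective_rangeRestrict
      (fun x => by
        rw [← LinearMap.mem_ker, LinearMap.ker_rangeRestrict]
        exact ⟨fun hx => ⟨⟨x, hx⟩, rfl⟩, fun ⟨y, hy⟩ => hy ▸ y.2⟩)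
      (pdLE_of_projective p) hR
  exact pdLE_of_equiv ((Submodule.equivSubtypeMap _ _).trans
    (LinearEquiv.ofEq _ _ (map_ker_wedgeLin p))) hk

end ProjectiveDimension

end TameAux

/-- **Addition theorem for tameness of multiarrangements II.**  If the Euler restriction
`(A^H, m^*)` is tame and `(A, m - δ_H)` is locally free along `H`, then `(A, m)` is tame
whenever `(A, m - δ_H)` is tame. -/
theorem addition_theorem_for_tameness_multi_II
    {K : Type} [Field K] {ℓ : ℕ} (A : Arrangement K ℓ) (hess : Essential A)
    (m : (Fin ℓ → K) → ℕ) (hm : ∀ c ∈ A.hyps, 0 < m c)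
    (c0 : Fin ℓ → K) (hc0 : c0 ∈ A.hyps)
    (heuler_tame : ∃ (e : (Fin (ℓ - 1) → K) →ₗ[K] (Fin ℓ → K)) (B : Arrangement K (ℓ - 1))
      (ms : (Fin (ℓ - 1) → K) → ℕ),
      IsHypEmbedding c0 e ∧ IsRestrictionOf B A c0 e ∧ IsEulerMult A m c0 e B ms ∧
        TameM B ms)
    (hlf' : LocallyFreeAlong A (mdel m c0) c0)
    (hdel_tame : TameM A (mdel m c0)) :
    TameM A m := by
  obtain ⟨e, B, ms, he, hB, hms, hBtame⟩ := heuler_tame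
  obtain ⟨q, v, hsplit⟩ := TameAux.exists_isSplit (A.ne_zero c0 hc0) he
  have h := TameAux.isEuler_of_isEulerMult hsplit hm hc0 hB hms
  intro p hp
  by_cases hlarge : ℓ ≤ p + 2
  · exact TameAux.pdLE_Omega_of_le hlarge
  · cases p with
    | zero =>
      exact TameAux.pdLE_of_equiv (LinearEquiv.ofBijective _
        ⟨TameAux.mulLin_injective hc0 h.pos 0, h.mulLin_surjective⟩) (hdel_tame 0 hp)
    | succ p =>
      have hdel := hdel_tame (p + 1) hp
      exact TameAux.pdLE_middle (TameAux.mulLin_injective hc0 h.pos (p + 1))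
        (h.resLin_surjective (by omega) hlf' (by omega) hdel) (h.exact p) hdel
        (h.pdLE_restrOmega (hBtame p (by omega)))
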